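/- Let d = p^{e₁} with p a prime ≡ 1 (mod 9) and e₁ ∈ {1, 2}, L = ℚ(∛d), k = ℚ(∛d, ζ₃). Then: (i) Q = 1 if and only if there exists w ≥ 1 with C_{L,3} ≅ ℤ/3^wℤ and C_{k,3} ≅ ℤ/3^wℤ × ℤ/3^{w−1}ℤ (interpreted as the cyclic group of order 3 when w = 1), and this holds if and only if L is of principal factorization type α; (ii) Q = 3 if and only if there exists w ≥ 2 with C_{L,3} ≅ ℤ/3^wℤ and C_{k,3} ≅ ℤ/3^wℤ × ℤ/3^wℤ, and this holds if and only if L is of type γ; in particular C_{k,3} is never of type (3,3). Furthermore, writing p𝓞_k = 𝔓³·(τ(𝔓))³ with 𝔓 a prime ideal of k, one has Q = 1 if and only if 𝔓 is a principal ideal. -/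

import Mathlib

open IntermediateField NumberField
open scoped nonZeroDivisors

set_option synthInstance.maxHeartbeats 1000000
set_option maxHeartbeats 2000000

noncomputable section

instance : Fact (Nat.Prime 3) := ⟨by norm_num⟩

/-- A positive integer is cube-free if no prime cube divides it. -/
def IsCubeFree (d : ℕ) : Prop := ∀ p : ℕ, p.Prime → ¬ (p ^ 3 ∣ d)

/-- The primitive cube root of unity `ζ₃ = e^{2πi/3}`. -/
def zeta3 : ℂ := Complex.exp (2 * Real.pi * Complex.I / 3)

lemma zeta3_isPrimitiveRoot : IsPrimitiveRoot zeta3 3 := by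
  simpa [zeta3] using Complex.isPrimitiveRoot_exp 3 (by norm_num)

lemma isIntegral_zeta3 : IsIntegral ℚ zeta3 :=
  (zeta3_isPrimitiveRoot.isIntegral (by norm_num)).tower_top

/-- The real cube root of `d`, as a complex number. -/
def cbrt (d : ℕ) : ℂ := ((d : ℝ) ^ ((3 : ℝ)⁻¹) : ℝ)

lemma cbrt_pow_three (d : ℕ) : (cbrt d) ^ 3 = (d : ℂ) := by
  have h : ((d : ℝ) ^ ((3 : ℝ)⁻¹)) ^ (3 : ℕ) = (d : ℝ) := by
    rw [← Real.rpow_natCast ((d : ℝ) ^ ((3 : ℝ)⁻¹)) 3, ← Real.rpow_mul (by positivity)]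
    norm_num
  calc (cbrt d) ^ 3 = (((((d : ℝ) ^ ((3 : ℝ)⁻¹)) ^ (3:ℕ) : ℝ)) : ℂ) := by
        push_cast [cbrt]; ring
    _ = ((d : ℝ) : ℂ) := by rw [h]
    _ = (d : ℂ) := by norm_num

lemma isIntegral_cbrt (d : ℕ) : IsIntegral ℚ (cbrt d) := by
  have h : IsIntegral ℤ (cbrt d) := by
    refine ⟨Polynomial.X ^ 3 - Polynomial.C (d : ℤ), ?_, ?_⟩
    · exact Polynomial.monic_X_pow_sub_C _ (by norm_num)
    · simp [Polynomial.eval₂, cbrt_pow_three d]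
  exact h.tower_top

/-- `k = ℚ(∛d, ζ₃)`, the normal closure of the pure cubic field `ℚ(∛d)`,
realized as a subfield of `ℂ`. -/
def Kc (d : ℕ) : IntermediateField ℚ ℂ := ℚ⟮cbrt d, zeta3⟯

instance (d : ℕ) : NumberField (Kc d) where
  to_finiteDimensional := by
    apply IntermediateField.finiteDimensional_adjoin
    rintro x (rfl | rfl)
    · exact isIntegral_cbrt d
    · exact isIntegral_zeta3

lemma zeta3_mem (d : ℕ) : zeta3 ∈ Kc d :=
  IntermediateField.subset_adjoin _ _ (by simp)

lemma cbrt_mem (d : ℕ) : cbrt d ∈ Kc d :=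
  IntermediateField.subset_adjoin _ _ (by simp)

/-- `ζ₃` as an element of `k`. -/
def zetaK (d : ℕ) : Kc d := ⟨zeta3, zeta3_mem d⟩

/-- `∛d` as an element of `k`. -/
def cbrtK (d : ℕ) : Kc d := ⟨cbrt d, cbrt_mem d⟩

/-- `k₀ = ℚ(ζ₃)` realized as a subfield of `k`. -/
def k0S (d : ℕ) : IntermediateField ℚ (Kc d) := ℚ⟮zetaK d⟯

/-- `L = ℚ(∛d)` realized as a subfield of `k`. -/
def LS (d : ℕ) : IntermediateField ℚ (Kc d) := ℚ⟮cbrtK d⟯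

instance (d : ℕ) : NumberField ↥(k0S d) where
instance (d : ℕ) : NumberField ↥(LS d) where

/-- `ζ₃` as an element of `k₀ ⊆ k`. -/
def zetaK0 (d : ℕ) : ↥(k0S d) := ⟨zetaK d, IntermediateField.mem_adjoin_simple_self ℚ (zetaK d)⟩

/-- `∛d` as an element of `L ⊆ k`. -/
def cbrtL (d : ℕ) : ↥(LS d) := ⟨cbrtK d, IntermediateField.mem_adjoin_simple_self ℚ (cbrtK d)⟩

-- Shortcut instances (these hold by instance search; they are registered to speed up
-- elaboration).
instance (priority := 10000) (d : ℕ) : IsDedekindDomain (𝓞 ↥(Kc d)) := inferInstance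
instance (priority := 10000) (d : ℕ) : IsDedekindDomain (𝓞 ↥(LS d)) := inferInstance
instance (priority := 10000) (d : ℕ) : Algebra (𝓞 ↥(Kc d)) ↥(Kc d) := inferInstance
instance (priority := 10000) (d : ℕ) : Algebra (𝓞 ↥(LS d)) ↥(LS d) := inferInstance
instance (priority := 10000) (d : ℕ) : Module (𝓞 ↥(Kc d)) ↥(Kc d) := Algebra.toModule
instance (priority := 10000) (d : ℕ) : Module (𝓞 ↥(LS d)) ↥(LS d) := Algebra.toModule
instance (priority := 10000) (d : ℕ) : IsFractionRing (𝓞 ↥(Kc d)) ↥(Kc d) := inferInstance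
instance (priority := 10000) (d : ℕ) : IsFractionRing (𝓞 ↥(LS d)) ↥(LS d) := inferInstance
instance (priority := 10000) (d : ℕ) : Algebra ↥(k0S d) ↥(Kc d) := inferInstance
instance (priority := 10000) (d : ℕ) : Algebra ↥(LS d) ↥(Kc d) := inferInstance
instance (priority := 10000) (d : ℕ) :
    CommGroup ((FractionalIdeal (𝓞 ↥(Kc d))⁰ ↥(Kc d))ˣ) := inferInstance
instance (priority := 10000) (d : ℕ) :
    CommGroup ((FractionalIdeal (𝓞 ↥(LS d))⁰ ↥(LS d))ˣ) := inferInstance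

/-- The subgroup `N_{k/k₀}(E_k)` of `E_{k₀}` consisting of relative norms of units of `k`. -/
def unitNormSubgroup (d : ℕ) : Subgroup ((𝓞 ↥(k0S d))ˣ) :=
  Subgroup.closure
    {u | ∃ v : (𝓞 ↥(Kc d))ˣ,
      Algebra.norm ↥(k0S d) ((v : 𝓞 ↥(Kc d)) : ↥(Kc d)) = ((u : 𝓞 ↥(k0S d)) : ↥(k0S d))}

/-- The unit norm index `(E_{k₀} : N_{k/k₀}(E_k))`. -/
def unitNormIndex (d : ℕ) : ℕ := (unitNormSubgroup d).index

/-- The subgroup `E₀ = ⟨E_{k₀}, E_L, E_{L^σ}, E_{L^{σ²}}⟩` of `E_k` generated by the units of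
all proper subfields of `k`. -/
def subfieldUnits (d : ℕ) (σ : ↥(Kc d) ≃ₐ[ℚ] ↥(Kc d)) : Subgroup ((𝓞 ↥(Kc d))ˣ) :=
  Subgroup.closure
    {u | ((u : 𝓞 ↥(Kc d)) : ↥(Kc d)) ∈ k0S d ∨
         ((u : 𝓞 ↥(Kc d)) : ↥(Kc d)) ∈ LS d ∨
         ((u : 𝓞 ↥(Kc d)) : ↥(Kc d)) ∈ (LS d).map (σ : ↥(Kc d) →ₐ[ℚ] ↥(Kc d)) ∨
         ((u : 𝓞 ↥(Kc d)) : ↥(Kc d)) ∈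
           (LS d).map ((σ * σ : ↥(Kc d) ≃ₐ[ℚ] ↥(Kc d)) : ↥(Kc d) →ₐ[ℚ] ↥(Kc d))}

/-- The subfield unit index `Q = (E_k : E₀)`. -/
def subfieldUnitIndex (d : ℕ) (σ : ↥(Kc d) ≃ₐ[ℚ] ↥(Kc d)) : ℕ := (subfieldUnits d σ).index

/-- `𝒫_k^G`: the group of `σ`-invariant (ambiguous) principal fractional ideals of `k`. -/
def ambPrincipalK (d : ℕ) (σ : ↥(Kc d) ≃ₐ[ℚ] ↥(Kc d)) :
    Subgroup ((FractionalIdeal (𝓞 ↥(Kc d))⁰ ↥(Kc d))ˣ) :=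
  Subgroup.closure
    {I | ∃ x : (↥(Kc d))ˣ, I = toPrincipalIdeal (𝓞 ↥(Kc d)) ↥(Kc d) x ∧
      FractionalIdeal.spanSingleton (𝓞 ↥(Kc d))⁰ (σ (x : ↥(Kc d))) =
        FractionalIdeal.spanSingleton (𝓞 ↥(Kc d))⁰ (x : ↥(Kc d))}

/-- `𝒫_{k₀}`: the group of principal fractional ideals of `k` extended from `k₀`,
i.e. generated by nonzero elements of `k₀`. -/
def principalFromK0 (d : ℕ) : Subgroup ((FractionalIdeal (𝓞 ↥(Kc d))⁰ ↥(Kc d))ˣ) :=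
  Subgroup.closure
    {I | ∃ y : (↥(Kc d))ˣ, ((y : ↥(Kc d)) ∈ k0S d) ∧
      I = toPrincipalIdeal (𝓞 ↥(Kc d)) ↥(Kc d) y}

/-- The quotient `𝒫_k^G/𝒫_{k₀}` of primitive ambiguous principal ideals of `k/k₀`. -/
def ambPrincipalQuot (d : ℕ) (σ : ↥(Kc d) ≃ₐ[ℚ] ↥(Kc d)) :=
  ↥(ambPrincipalK d σ) ⧸ (principalFromK0 d).subgroupOf (ambPrincipalK d σ)

instance (d : ℕ) (σ : ↥(Kc d) ≃ₐ[ℚ] ↥(Kc d)) : CommGroup (ambPrincipalQuot d σ) := by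
  unfold ambPrincipalQuot; infer_instance

/-- `𝒫_L^G`: the group of principal fractional ideals of `L` whose extension to `k`
is `σ`-invariant. -/
def ambPrincipalL (d : ℕ) (σ : ↥(Kc d) ≃ₐ[ℚ] ↥(Kc d)) :
    Subgroup ((FractionalIdeal (𝓞 ↥(LS d))⁰ ↥(LS d))ˣ) :=
  Subgroup.closure
    {I | ∃ x : (↥(LS d))ˣ, I = toPrincipalIdeal (𝓞 ↥(LS d)) ↥(LS d) x ∧
      FractionalIdeal.spanSingleton (𝓞 ↥(Kc d))⁰ (σ (algebraMap ↥(LS d) ↥(Kc d) (x : ↥(LS d)))) =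
        FractionalIdeal.spanSingleton (𝓞 ↥(Kc d))⁰ (algebraMap ↥(LS d) ↥(Kc d) (x : ↥(LS d)))}

/-- `𝒫_ℚ = 𝓘_ℚ`: the group of fractional ideals of `L` generated by nonzero rational
numbers. -/
def principalFromQ (d : ℕ) : Subgroup ((FractionalIdeal (𝓞 ↥(LS d))⁰ ↥(LS d))ˣ) :=
  Subgroup.closure
    {I | ∃ r : ℚˣ,
      I = toPrincipalIdeal (𝓞 ↥(LS d)) ↥(LS d) (Units.map (algebraMap ℚ ↥(LS d)).toMonoidHom r)}

/-- The quotient `𝒫_L^G/𝒫_ℚ` of absolute principal factors. -/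
def absPrincipalFactors (d : ℕ) (σ : ↥(Kc d) ≃ₐ[ℚ] ↥(Kc d)) :=
  ↥(ambPrincipalL d σ) ⧸ (principalFromQ d).subgroupOf (ambPrincipalL d σ)

instance (d : ℕ) (σ : ↥(Kc d) ≃ₐ[ℚ] ↥(Kc d)) : CommGroup (absPrincipalFactors d σ) := by
  unfold absPrincipalFactors; infer_instance

/-- The kernel of the homomorphism `𝒫_k^G/𝒫_{k₀} → 𝓘_L^G/𝓘_ℚ` induced by the relative norm
`N_{k/L}`: the class of an ambiguous principal ideal `(x)` of `k` lies in the kernel if and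
only if the norm `N_{k/L}(x)` generates an ideal of `L` lying in `𝓘_ℚ`, i.e. differs from a
rational number by a unit of `𝓞_L`. -/
def relPrincipalFactors (d : ℕ) (σ : ↥(Kc d) ≃ₐ[ℚ] ↥(Kc d)) :
    Subgroup (ambPrincipalQuot d σ) :=
  Subgroup.closure
    {c | ∃ (x : (↥(Kc d))ˣ)
        (h : FractionalIdeal.spanSingleton (𝓞 ↥(Kc d))⁰ (σ (x : ↥(Kc d))) =
          FractionalIdeal.spanSingleton (𝓞 ↥(Kc d))⁰ (x : ↥(Kc d))),
      QuotientGroup.mk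
        (⟨toPrincipalIdeal (𝓞 ↥(Kc d)) ↥(Kc d) x,
          Subgroup.subset_closure ⟨x, rfl, h⟩⟩ : ↥(ambPrincipalK d σ)) = c ∧
      ∃ (r : ℚˣ) (u : (𝓞 ↥(LS d))ˣ),
        Algebra.norm ↥(LS d) (x : ↥(Kc d)) =
          algebraMap ℚ ↥(LS d) (r : ℚ) * ((u : 𝓞 ↥(LS d)) : ↥(LS d))}

section ClassGroupModule

variable {C : Type*} [AddCommGroup C] (s t : C →+ C) (c : C)

theorem exists_two_mul_sub_one (n : ℕ) : ∃ k : ℕ, 2 * k = 3 ^ n + 1 := by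
  have : Odd (3 ^ n) := Odd.pow (by decide)
  obtain ⟨k, hk⟩ := this
  exact ⟨k + 1, by omega⟩

theorem eq_zero_of_two_nsmul {x : C} {n : ℕ} (hn : 3 ^ n • x = 0) (h2 : 2 • x = 0) : x = 0 := by
  obtain ⟨k, hk⟩ := exists_two_mul_sub_one n
  have h : (3 ^ n + 1) • x = 0 := by rw [← hk, mul_comm, mul_nsmul', h2, smul_zero]
  rwa [add_smul, hn, one_smul, zero_add] at h

/-- A finite `3`-primary abelian group with an action of the dihedral group of order six on which
the norm `1 + s + s²` vanishes, with at most three `s`-fixed points and a `t`-fixed element `c`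
outside the image of `s - 1`, is the direct sum of the cyclic subgroups generated by `c` and
`s c - s² c`. -/
theorem dihedral_decomposition [Finite C] (n : ℕ) (hn : ∀ x : C, 3 ^ n • x = 0)
    (hN : ∀ x, x + s x + s (s x) = 0)
    (hts : ∀ x, t (s x) = s (s (t x))) (hc : t c = c) (hcl : ∀ x, s x - x ≠ c)
    (hfix : Nat.card {x // s x = x} ≤ 3) :
    ∃ w j : ℕ, 1 ≤ w ∧ (j = w ∨ j + 1 = w) ∧ addOrderOf c = 3 ^ w ∧
      Nonempty (C ≃+ ZMod (3 ^ w) × ZMod (3 ^ j)) ∧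
      (∀ x, t x = x ↔ x ∈ AddSubgroup.zmultiples c) ∧
      (j = w ↔ ∀ x, s x = x → t x = x → x = 0) := by
  have hss : ∀ x, s (s x) = - x - s x := fun x => by
    have := hN x
    rw [← sub_eq_zero]; rw [← this]; abel
  have hl2 : ∀ x, s (s x - x) - (s x - x) = -(3 • s x) := fun x => by
    rw [map_sub, hss]; abel
  -- the cokernel of `s - 1` is cyclic of order three
  set l : C →+ C := s - AddMonoidHom.id C with hl
  have hlx : ∀ x, l x = s x - x := fun x => rfl
  have hker : Nat.card l.ker ≤ 3 := by
    refine le_trans (le_of_eq ?_) hfix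
    refine Nat.card_congr (Equiv.subtypeEquivRight fun x => ?_)
    rw [AddMonoidHom.mem_ker, hlx, sub_eq_zero]
  have hidx : l.range.index ≤ 3 := by
    have h1 := AddSubgroup.card_mul_index l.ker
    rw [AddSubgroup.index_ker] at h1
    have h2 := AddSubgroup.card_mul_index l.range
    have h3 : 0 < Nat.card l.range := Nat.card_pos
    have : l.range.index = Nat.card l.ker := by
      rw [← h1, mul_comm] at h2
      exact Nat.eq_of_mul_eq_mul_right h3 h2
    omega
  have hcr : c ∉ l.range := fun ⟨x, hx⟩ => hcl x hx
  have hgen : ∀ x, ∃ a : ℤ, ∃ y, x = a • c + l y := by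
    intro x
    let A := C ⧸ l.range
    have hA : Nat.card A ≤ 3 := hidx
    have hc0 : (QuotientAddGroup.mk c : A) ≠ 0 := by
      rwa [Ne, QuotientAddGroup.eq_zero_iff]
    have h3 : 3 • (QuotientAddGroup.mk c : A) = 0 := by
      rw [← QuotientAddGroup.mk_nsmul, QuotientAddGroup.eq_zero_iff]
      refine ⟨l (c + s c), ?_⟩
      simp only [hlx, map_neg, map_add, map_sub, hss]
      abel
    have hord : addOrderOf (QuotientAddGroup.mk c : A) = 3 := by
      apply addOrderOf_eq_prime h3 hc0
    have htop : AddSubgroup.zmultiples (QuotientAddGroup.mk c : A) = ⊤ := by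
      apply AddSubgroup.eq_top_of_le_card
      rw [Nat.card_zmultiples, hord]; exact hA
    have hx : (QuotientAddGroup.mk x : A) ∈ AddSubgroup.zmultiples (QuotientAddGroup.mk c : A) := by
      rw [htop]; trivial
    obtain ⟨a, ha⟩ := hx
    change a • (QuotientAddGroup.mk c : A) = _ at ha
    rw [← QuotientAddGroup.mk_zsmul, QuotientAddGroup.eq] at ha
    obtain ⟨y, hy⟩ := ha
    exact ⟨a, y, by rw [hy]; abel⟩
  -- hence `C` is generated by `c` and `s c`
  have hgen2 : ∀ k : ℕ, ∀ x, ∃ a b : ℤ, ∃ y, x = a • c + b • s c + 3 ^ k • y := by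
    intro k
    induction k with
    | zero => intro x; exact ⟨0, 0, x, by simp⟩
    | succ k ih =>
      intro x
      obtain ⟨a, b, y, rfl⟩ := ih x
      obtain ⟨a', y', rfl⟩ := hgen y
      obtain ⟨a₂, y₂, rfl⟩ := hgen y'
      refine ⟨a + 3 ^ k * a' - 3 ^ k * a₂, b + 3 ^ k * a₂, - s y₂, ?_⟩
      have e1 : l (a₂ • c + l y₂) = a₂ • (s c - c) + (-(3 • s y₂)) := by
        rw [map_add, map_zsmul, hlx c, hlx (l y₂), hlx y₂, hl2]
      rw [e1]
      simp only [← natCast_zsmul]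
      push_cast
      module
  have hgen3 : ∀ x, ∃ a b : ℤ, x = a • c + b • s c := by
    intro x
    obtain ⟨a, b, y, h⟩ := hgen2 n x
    exact ⟨a, b, by rw [h, hn, add_zero]⟩
  set v : C := c + 2 • s c with hv
  have htsc : t (s c) = s (s c) := by rw [hts, hc]
  have htv : t v = - v := by
    rw [hv, map_add, map_nsmul, hc, htsc, hss]; abel
  have hsv : v + 2 • s v = - (3 • c) := by
    rw [hv, map_add, map_nsmul, hss]; abel
  obtain ⟨k2, hk2⟩ := exists_two_mul_sub_one n
  have h2k : ∀ x : C, (2 * k2) • x = x := fun x => by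
    rw [hk2, add_smul, hn, one_smul, zero_add]
  have hgen4 : ∀ x, ∃ a b : ℤ, x = a • c + b • v := by
    intro x
    obtain ⟨a, b, h⟩ := hgen3 x
    refine ⟨a - b * k2, b * k2, ?_⟩
    have : s c = (2 * k2) • s c := (h2k _).symm
    rw [h, this, hv]
    simp only [smul_add, sub_smul, mul_smul, natCast_zsmul, smul_comm k2 2]
    abel
  have h2inj : ∀ x : C, 2 • x = 0 → x = 0 := fun x hx => eq_zero_of_two_nsmul (hn x) hx
  have hdisj : ∀ a b : ℤ, a • c + b • v = 0 → a • c = 0 ∧ b • v = 0 := by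
    intro a b h
    have h' := congrArg t h
    rw [map_add, map_zsmul, map_zsmul, hc, htv, map_zero] at h'
    have h1 : 2 • (a • c) = 0 := by
      have : 2 • (a • c) = (a • c + b • v) + (a • c + b • (-v)) := by rw [smul_neg]; abel
      rw [this, h, h', add_zero]
    have h1 := h2inj _ h1
    exact ⟨h1, by rwa [h1, zero_add] at h⟩
  have hp3 : Fact (Nat.Prime 3) := ⟨by norm_num⟩
  obtain ⟨w, -, hw⟩ := (Nat.dvd_prime_pow Nat.prime_three).1 (addOrderOf_dvd_of_nsmul_eq_zero (hn c))
  obtain ⟨j, -, hj⟩ := (Nat.dvd_prime_pow Nat.prime_three).1 (addOrderOf_dvd_of_nsmul_eq_zero (hn v))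
  have hvx : ∀ a : ℤ, a • c = 0 → a • v = 0 := fun a ha => by
    rw [hv, smul_add, ha, smul_comm, ← map_zsmul, ha]; simp
  have hxv : ∀ a : ℤ, a • v = 0 → a • (3 • c) = 0 := fun a ha => by
    have : a • v + 2 • s (a • v) = 0 := by rw [ha]; simp
    rw [map_zsmul, smul_comm 2, ← smul_add, hsv, smul_neg, neg_eq_zero] at this
    exact this
  have hjw : j ≤ w := by
    have : 3 ^ j ∣ 3 ^ w := by
      rw [← hj]; apply addOrderOf_dvd_of_nsmul_eq_zero
      rw [← natCast_zsmul]; apply hvx; rw [natCast_zsmul, ← hw, addOrderOf_nsmul_eq_zero]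
    exact (Nat.pow_dvd_pow_iff_le_right (by norm_num)).1 this
  have hwj : w ≤ j + 1 := by
    have : 3 ^ w ∣ 3 ^ (j + 1) := by
      rw [← hw]; apply addOrderOf_dvd_of_nsmul_eq_zero
      rw [pow_succ, mul_smul, ← natCast_zsmul]; apply hxv
      rw [natCast_zsmul, ← hj, addOrderOf_nsmul_eq_zero]
    exact (Nat.pow_dvd_pow_iff_le_right (by norm_num)).1 this
  have hw1 : 1 ≤ w := by
    by_contra h0
    have : w = 0 := by omega
    rw [this, pow_zero, AddMonoid.addOrderOf_eq_one_iff] at hw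
    exact hcl 0 (by simp [hw])
  refine ⟨w, j, hw1, by omega, hw, ?_, ?_, ?_⟩
  · let f : ZMod (3 ^ w) →+ C := ZMod.lift (3 ^ w) ⟨zmultiplesHom C c, by
      simp [← hw, addOrderOf_nsmul_eq_zero]⟩
    let g : ZMod (3 ^ j) →+ C := ZMod.lift (3 ^ j) ⟨zmultiplesHom C v, by
      simp [← hj, addOrderOf_nsmul_eq_zero]⟩
    have hf : ∀ a : ℤ, f a = a • c := fun a => by simp [f]
    have hg : ∀ a : ℤ, g a = a • v := fun a => by simp [g]
    refine ⟨(AddEquiv.ofBijective (f.coprod g) ⟨?_, ?_⟩).symm⟩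
    · rw [injective_iff_map_eq_zero]
      rintro ⟨a, b⟩ h
      obtain ⟨a, rfl⟩ := ZMod.intCast_surjective a
      obtain ⟨b, rfl⟩ := ZMod.intCast_surjective b
      rw [AddMonoidHom.coprod_apply, hf, hg] at h
      obtain ⟨h1, h2⟩ := hdisj a b h
      rw [← addOrderOf_dvd_iff_zsmul_eq_zero, hw] at h1
      rw [← addOrderOf_dvd_iff_zsmul_eq_zero, hj] at h2
      rw [Prod.mk_eq_zero, ZMod.intCast_zmod_eq_zero_iff_dvd, ZMod.intCast_zmod_eq_zero_iff_dvd]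
      exact ⟨by exact_mod_cast h1, by exact_mod_cast h2⟩
    · intro x
      obtain ⟨a, b, h⟩ := hgen4 x
      exact ⟨(a, b), by rw [AddMonoidHom.coprod_apply, hf, hg, h]⟩
  · intro x
    constructor
    · intro hx
      obtain ⟨a, b, rfl⟩ := hgen4 x
      rw [map_add, map_zsmul, map_zsmul, hc, htv] at hx
      have : 2 • (b • v) = 0 := by
        have : 2 • (b • v) = (a • c + b • v) - (a • c + b • (-v)) := by rw [smul_neg]; abel
        rw [this, hx, sub_self]
      rw [h2inj _ this, add_zero]
      exact ⟨a, rfl⟩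
    · rintro ⟨a, rfl⟩
      simp only [map_zsmul, hc]
  · have key : ∀ a : ℤ, s (a • c) = a • c ↔ a • v = 0 := by
      intro a
      have h3 : ∀ x, s x = x → 3 • x = 0 := fun x hx => by
        have := hN x; rw [hx, hx] at this; rw [← this]; abel
      have hav : a • v = a • c + 2 • s (a • c) := by rw [hv, smul_add, smul_comm, map_zsmul]
      rw [hav]
      constructor
      · intro h
        have := h3 _ h
        rw [h, ← this]; abel
      · intro h
        have h0 : s (a • c) + 2 • s (s (a • c)) = 0 := by
          rw [← map_nsmul, ← map_add, h, map_zero]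
        rw [hss] at h0
        have h5 : 2 • (s (a • c) - a • c) = 0 := by
          have e : 2 • (s (a • c) - a • c) =
              (s (a • c) + 2 • (-(a • c) - s (a • c))) + (a • c + 2 • s (a • c)) + 
                (s (a • c) - a • c) := by abel
          have e3 : 3 • (a • c) = 0 := by
            have : 3 • (a • c) = -((s (a • c) + 2 • (-(a • c) - s (a • c))) + (s (a • c) + 2 • (-(a • c) - s (a • c))) + (a • c + 2 • s (a • c)) ) := by abel
            rw [this, h, h0]; simp
          have : 2 • (s (a • c) - a • c) = (a • c + 2 • s (a • c)) - 3 • (a • c) := by abel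
          rw [this, h, e3, sub_zero]
        exact sub_eq_zero.1 (h2inj _ h5)
    constructor
    · intro hjw' x hsx htx
      have : x ∈ AddSubgroup.zmultiples c := by
        obtain ⟨a, b, rfl⟩ := hgen4 x
        rw [map_add, map_zsmul, map_zsmul, hc, htv] at htx
        have : 2 • (b • v) = 0 := by
          have : 2 • (b • v) = (a • c + b • v) - (a • c + b • (-v)) := by rw [smul_neg]; abel
          rw [this, htx, sub_self]
        rw [h2inj _ this, add_zero]
        exact ⟨a, rfl⟩
      obtain ⟨a, rfl⟩ := this
      simp only at hsx ⊢
      have := (key a).1 hsx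
      rw [← addOrderOf_dvd_iff_zsmul_eq_zero, hj, hjw', ← hw] at this
      exact addOrderOf_dvd_iff_zsmul_eq_zero.1 this
    · intro h
      by_contra hne
      have hj' : j + 1 = w := by omega
      have h1 : ((3 ^ j : ℕ) : ℤ) • v = 0 := by
        rw [natCast_zsmul, ← hj, addOrderOf_nsmul_eq_zero]
      have h2 := h _ ((key _).2 h1) (by rw [map_zsmul, hc])
      rw [natCast_zsmul] at h2
      have := addOrderOf_dvd_of_nsmul_eq_zero h2
      rw [hw] at this
      have := (Nat.pow_dvd_pow_iff_le_right (by norm_num)).1 this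
      omega

end ClassGroupModule

theorem index_range_of_comp_self_eq {A : Type*} [AddCommGroup A]
    (e : A ≃+ (Fin 2 → ℤ)) (l s : A →+ A) (hs : Function.Surjective s)
    (hl : ∀ x, l (l x) = -(3 • s x)) (hs' : Function.Injective s) : l.range.index = 3 := by
  have h3 : ∀ x : A, 3 • x = 0 → x = 0 := fun x hx => by
    have h : e (3 • x) = 0 := by rw [hx, map_zero]
    rw [map_nsmul] at h
    have : e x = 0 := by
      ext i
      have := congrFun h i
      simpa using this
    simpa using this
  have hinj : Function.Injective l := by
    rw [injective_iff_map_eq_zero]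
    intro x hx
    have := hl x
    rw [hx, map_zero, eq_comm, neg_eq_zero] at this
    exact (injective_iff_map_eq_zero s).1 hs' _ (h3 _ this)
  have h1 := AddSubgroup.index_map_of_injective (H := l.range) hinj
  let q : A →+ (Fin 2 → ZMod 3) :=
    (AddMonoidHom.compLeft (Int.castAddHom (ZMod 3)) (Fin 2)).comp e.toAddMonoidHom
  have hq : l.range.map l = q.ker := by
    ext x
    simp only [AddSubgroup.mem_map, AddMonoidHom.mem_range, AddMonoidHom.mem_ker]
    constructor
    · rintro ⟨_, ⟨y, rfl⟩, rfl⟩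
      rw [hl, map_neg, map_nsmul]
      ext i
      change -(3 • (q (s y) i)) = 0
      have : ((3 : ℕ) : ZMod 3) = 0 := by decide
      rw [nsmul_eq_mul, this]; simp
    · intro h
      have h' : ∀ i, ∃ m, e x i = 3 * m := fun i => by
        have := congrFun h i
        change ((e x i : ℤ) : ZMod 3) = 0 at this
        rw [ZMod.intCast_zmod_eq_zero_iff_dvd] at this
        exact this
      choose m hm using h'
      obtain ⟨y, hy⟩ := hs (e.symm m)
      refine ⟨l (-y), ⟨-y, rfl⟩, ?_⟩
      rw [hl, map_neg, hy]
      apply e.injective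
      ext i
      simp [hm]
  have hsurj : Function.Surjective q := by
    intro y
    choose m hm using fun i => ZMod.intCast_surjective (y i)
    refine ⟨e.symm m, ?_⟩
    ext i
    simp [q, hm]
  have h9 : q.ker.index = 9 := by
    rw [AddSubgroup.index_ker, AddMonoidHom.range_eq_top.2 hsurj, AddSubgroup.card_top]
    simp
  rw [hq, h9] at h1
  nlinarith

/-- The arithmetic of the ring of integers `O` of `ℚ(∛p, ζ₃)` for a prime `p ≡ 1 (mod 9)`: the
generators `s`, `t` of its automorphism group, a cube root `θ` of `p`, a primitive cube root of
unity `ζ`, the integer `β = (1 + θ + θ²) / 3`, and a cubic residue character `χ` modulo `p`. -/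
structure PureCubicRing (O : Type*) [CommRing O] (p : ℕ) [Fact p.Prime] where
  (s t : O ≃+* O)
  (θ ζ β : O)
  χ : MulChar (ZMod p) O
  s_s_s : ∀ x, s (s (s x)) = x
  t_t : ∀ x, t (t x) = x
  t_s : ∀ x, t (s x) = s (s (t x))
  p_mod : p % 9 = 1
  θ_pow : θ ^ 3 = p
  ζ_eq : ζ ^ 2 + ζ + 1 = 0
  s_θ : s θ = ζ * θ
  s_ζ : s ζ = ζ
  t_θ : t θ = θ
  t_ζ : t ζ = ζ ^ 2
  β_eq : 3 * β = 1 + θ + θ ^ 2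
  χ_pow : χ ^ 3 = 1
  χ_ne : χ ≠ 1
  fixed : ∀ x, s x = x → ∃ a b : ℤ, x = a + b * ζ
  pid : ∀ I : Ideal O, ∃ g ∈ I, s g = g ∧ ∀ x ∈ I, s x = x → ∃ y, x = g * y
  card_θ : Nat.card (O ⧸ Ideal.span {θ}) = p ^ 2

namespace PureCubicRing

set_option linter.unusedSectionVars false

variable {O : Type*} [CommRing O] [IsDedekindDomain O] [CharZero O]
  {p : ℕ} [hp : Fact p.Prime] (D : PureCubicRing O p)

include D

theorem ζ_pow : D.ζ ^ 3 = 1 := by linear_combination (D.ζ - 1) * D.ζ_eq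

theorem ζ_ne_one : D.ζ ≠ 1 := fun h => by
  have := D.ζ_eq
  rw [h] at this
  norm_num at this

theorem ζ_ne_zero : D.ζ ≠ 0 := fun h => by
  have := D.ζ_eq
  rw [h] at this
  norm_num at this

theorem p_ne_zero : (p : O) ≠ 0 := Nat.cast_ne_zero.2 hp.out.ne_zero

theorem θ_ne_zero : D.θ ≠ 0 := fun h => D.p_ne_zero (by rw [← D.θ_pow, h]; simp)

theorem t_s_s (x : O) : D.t (D.s (D.s x)) = D.s (D.t x) := by
  rw [D.t_s, D.t_s, D.s_s_s]

theorem isUnit_ζ : IsUnit D.ζ := IsUnit.of_pow_eq_one D.ζ_pow (by norm_num)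

theorem int_of_fixed {x : O} (hs : D.s x = x) (ht : D.t x = x) : ∃ a : ℤ, x = a := by
  obtain ⟨a, b, rfl⟩ := D.fixed x hs
  refine ⟨a, ?_⟩
  rw [map_add, map_mul, map_intCast, map_intCast, D.t_ζ] at ht
  have h : (b : O) * (D.ζ * (D.ζ - 1)) = 0 := by linear_combination ht
  rcases mul_eq_zero.1 h with h | h
  · rw [h]; ring
  · exact absurd h (mul_ne_zero D.ζ_ne_zero (sub_ne_zero.2 D.ζ_ne_one))

theorem int_mul_t {x : O} (hs : D.s x = x) : ∃ a : ℤ, x * D.t x = a := by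
  apply D.int_of_fixed
  · rw [map_mul, hs, ← D.t_s_s, hs, hs]
  · rw [map_mul, D.t_t, mul_comm]

theorem not_isUnit_p : ¬ IsUnit (p : O) := by
  rintro ⟨u, hu⟩
  have h1 : (p : O) * (↑u⁻¹ : O) = 1 := by rw [← hu, Units.mul_inv]
  have hfix : ∀ f : O ≃+* O, f (↑u⁻¹ : O) = (↑u⁻¹ : O) := fun f => by
    have h2 := congrArg f h1
    rw [map_mul, map_natCast, map_one, ← h1] at h2
    exact mul_left_cancel₀ D.p_ne_zero h2
  obtain ⟨a, ha⟩ := D.int_of_fixed (hfix D.s) (hfix D.t)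
  rw [ha] at h1
  have h3 : (p : ℤ) * a = 1 := by exact_mod_cast h1
  have := Int.isUnit_iff.1 (IsUnit.of_mul_eq_one a h3)
  have := hp.out.two_le
  omega

/-- The Jacobi sum of the cubic residue character. -/
def π : O := jacobiSum D.χ D.χ

theorem χ_apply_pow {x : ZMod p} (hx : x ≠ 0) : D.χ x ^ 3 = 1 := by
  have := congrFun (congrArg DFunLike.coe D.χ_pow) x
  rwa [MulChar.pow_apply' _ (by norm_num), MulChar.one_apply (isUnit_iff_ne_zero.2 hx)] at this

theorem χ_apply (x : ZMod p) :
    D.χ x = 0 ∨ D.χ x = 1 ∨ D.χ x = D.ζ ∨ D.χ x = D.ζ ^ 2 := by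
  by_cases hx : x = 0
  · left; rw [hx]; exact D.χ.map_zero
  · right
    have h := D.χ_apply_pow hx
    have : (D.χ x - 1) * ((D.χ x - D.ζ) * (D.χ x - D.ζ ^ 2)) = 0 := by
      linear_combination h + (D.χ x * (D.χ x - 1) * (- 1) + (D.χ x - 1) * (D.ζ - 1)) * D.ζ_eq
    rcases mul_eq_zero.1 this with h | h
    · left; exact sub_eq_zero.1 h
    · rcases mul_eq_zero.1 h with h | h
      · right; left; exact sub_eq_zero.1 h
      · right; right; exact sub_eq_zero.1 h

theorem s_χ (x : ZMod p) : D.s (D.χ x) = D.χ x := by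
  rcases D.χ_apply x with h | h | h | h <;> rw [h] <;> simp [D.s_ζ]

theorem t_χ (x : ZMod p) : D.t (D.χ x) = D.χ x ^ 2 := by
  rcases D.χ_apply x with h | h | h | h <;> rw [h] <;> simp [D.t_ζ]

theorem χ_inv : D.χ⁻¹ = D.χ ^ 2 := by
  rw [inv_eq_iff_mul_eq_one, ← pow_succ', D.χ_pow]

theorem t_χ' : D.χ.ringHomComp D.t.toRingHom = D.χ⁻¹ := by
  ext x
  rw [D.χ_inv, MulChar.pow_apply' _ (by norm_num)]
  exact D.t_χ x

theorem s_π : D.s D.π = D.π := by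
  simp [π, jacobiSum, D.s_χ]

theorem t_π : D.t D.π = jacobiSum D.χ⁻¹ D.χ⁻¹ := by
  rw [← D.t_χ', jacobiSum_ringHomComp]; rfl

theorem χ_mul_χ_ne : D.χ * D.χ ≠ 1 := fun h => D.χ_ne (by
  have := D.χ_pow
  rwa [pow_succ, pow_two, h, one_mul] at this)

theorem π_mul : D.π * D.t D.π = p := by
  let F := FractionRing O
  let f : O →+* F := algebraMap O F
  have hf : Function.Injective f := IsFractionRing.injective O F
  have : CharZero F := charZero_of_injective_algebraMap hf
  have h := jacobiSum_mul_jacobiSum_inv (F := ZMod p) (F' := F) (χ := D.χ.ringHomComp f)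
    (φ := D.χ.ringHomComp f) (by
      rw [ringChar.eq_zero, ZMod.ringChar_zmod_n]; exact hp.out.ne_zero.symm)
    ((MulChar.ringHomComp_ne_one_iff hf).2 D.χ_ne) ((MulChar.ringHomComp_ne_one_iff hf).2 D.χ_ne)
    (by
      rw [← MulChar.ringHomComp_mul]
      exact (MulChar.ringHomComp_ne_one_iff hf).2 D.χ_mul_χ_ne)
  rw [MulChar.ringHomComp_inv, jacobiSum_ringHomComp, jacobiSum_ringHomComp, ← D.t_π,
    ← map_mul, ZMod.card, ← map_natCast f] at h
  exact hf h

theorem π_ne_zero : D.π ≠ 0 := fun h => D.p_ne_zero (by rw [← D.π_mul, h, zero_mul])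

theorem exists_π_eq : ∃ a b : ℤ, D.π = a + b * D.ζ ∧ ¬ (p : ℤ) ∣ b := by
  obtain ⟨a, b, h⟩ := D.fixed _ D.s_π
  refine ⟨a, b, h, fun ⟨b', hb⟩ => ?_⟩
  have h2 : D.t D.π = a + b * D.ζ ^ 2 := by rw [h]; simp [D.t_ζ]
  have h3 : ((a ^ 2 - a * b + b ^ 2 : ℤ) : O) = (p : ℤ) := by
    push_cast
    rw [← D.π_mul, h2, h]
    linear_combination (-a * b + b ^ 2 * (1 - D.ζ)) * D.ζ_eq
  have h4 : a ^ 2 - a * b + b ^ 2 = (p : ℤ) := by exact_mod_cast h3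
  have h5 : (p : ℤ) ∣ a ^ 2 := ⟨1 + a * b' - p * b' ^ 2, by
    rw [hb] at h4; linear_combination h4⟩
  obtain ⟨a', ha⟩ := Int.Prime.dvd_pow' hp.out h5
  rw [ha, hb] at h4
  have h6 : (p : ℤ) * (p * (a' ^ 2 - a' * b' + b' ^ 2)) = p * 1 := by linear_combination h4
  have h7 := mul_left_cancel₀ (by exact_mod_cast hp.out.ne_zero) h6
  have := Int.isUnit_iff.1 (IsUnit.of_mul_eq_one _ h7)
  have := hp.out.two_le
  omega

theorem p_odd : ∃ k : ℕ, p = 18 * k + 1 := by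
  have h1 := D.p_mod
  have h2 := hp.out.eq_two_or_odd
  exact ⟨p / 18, by omega⟩

theorem not_p_dvd_three : ¬ (p : ℤ) ∣ 3 := fun h => by
  have := D.p_mod
  have h1 := Int.le_of_dvd (by norm_num) h
  have := hp.out.two_le
  omega

theorem span_π_t_π : Ideal.span {D.π, D.t D.π} = ⊤ := by
  obtain ⟨a, b, h, hb⟩ := D.exists_π_eq
  have h2 : D.t D.π = a + b * D.ζ ^ 2 := by rw [h]; simp [D.t_ζ]
  have hco : IsCoprime (p : ℤ) (3 * b ^ 2) := by
    rw [Prime.coprime_iff_not_dvd (Nat.prime_iff_prime_int.1 hp.out)]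
    intro hd
    rcases (Nat.prime_iff_prime_int.1 hp.out).dvd_or_dvd hd with hd | hd
    · exact D.not_p_dvd_three hd
    · exact hb (Int.Prime.dvd_pow' hp.out hd)
  obtain ⟨u, v, huv⟩ := hco
  have huv' : (u : O) * p + v * (3 * b ^ 2) = 1 := by exact_mod_cast congrArg (Int.cast (R := O)) huv
  rw [Ideal.eq_top_iff_one, Ideal.mem_span_pair]
  refine ⟨u * D.t D.π - v * (D.π - 2 * D.t D.π), - v * D.t D.π, ?_⟩
  rw [← huv', ← D.π_mul, h2, h]
  linear_combination (v * b ^ 2 * (- D.ζ ^ 2 + 3 * D.ζ - 3)) * D.ζ_eq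

/-- The prime of `O` above `p` containing the Jacobi sum. -/
def P : Ideal O := Ideal.span {D.π, D.θ}

/-- The conjugate prime of `O` above `p`. -/
def P' : Ideal O := Ideal.span {D.t D.π, D.θ}

theorem π_mem : D.π ∈ D.P := Ideal.subset_span (by simp)
theorem θ_mem : D.θ ∈ D.P := Ideal.subset_span (by simp)
theorem t_π_mem : D.t D.π ∈ D.P' := Ideal.subset_span (by simp)
theorem θ_mem' : D.θ ∈ D.P' := Ideal.subset_span (by simp)

theorem P_sup_P' : D.P ⊔ D.P' = ⊤ := by
  rw [eq_top_iff, ← D.span_π_t_π, Ideal.span_le, Set.insert_subset_iff, Set.singleton_subset_iff]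
  exact ⟨Ideal.mem_sup_left D.π_mem, Ideal.mem_sup_right D.t_π_mem⟩

theorem isCoprime_P_P' : IsCoprime D.P D.P' := Ideal.isCoprime_iff_sup_eq.2 D.P_sup_P'

theorem map_t_P : D.P.map D.t = D.P' := by
  rw [P, P', Ideal.map_span, Set.image_pair, D.t_θ]

theorem map_t_P' : D.P'.map D.t = D.P := by
  rw [P, P', Ideal.map_span, Set.image_pair, D.t_θ, D.t_t]

theorem map_s_P : D.P.map D.s = D.P := by
  rw [P, Ideal.map_span, Set.image_pair, D.s_π, D.s_θ, Ideal.span_insert,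
    Ideal.span_singleton_mul_left_unit D.isUnit_ζ, ← Ideal.span_insert]

theorem P_mul_P' : D.P * D.P' = Ideal.span {D.θ} := by
  rw [P, P', Ideal.span_pair_mul_span_pair, D.π_mul, ← D.θ_pow]
  apply le_antisymm
  · rw [Ideal.span_le]
    rintro x (rfl | rfl | rfl | rfl) <;> rw [SetLike.mem_coe, Ideal.mem_span_singleton]
    · exact dvd_pow_self _ (by norm_num)
    · exact dvd_mul_left _ _
    · exact dvd_mul_right _ _
    · exact dvd_mul_left _ _
  · rw [Ideal.span_singleton_le_iff_mem]
    have h1 : (1 : O) ∈ Ideal.span {D.π, D.t D.π} := by rw [D.span_π_t_π]; trivial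
    obtain ⟨u, v, huv⟩ := Ideal.mem_span_pair.1 h1
    have h2 : D.θ = u * (D.π * D.θ) + v * (D.θ * D.t D.π) := by linear_combination - D.θ * huv
    generalize hI : Ideal.span ({D.θ ^ 3, D.π * D.θ, D.θ * D.t D.π, D.θ * D.θ} : Set O) = I
    rw [h2, ← hI]
    exact Ideal.add_mem _ (Ideal.mul_mem_left _ _ (Ideal.subset_span (Or.inr (Or.inl rfl))))
      (Ideal.mul_mem_left _ _ (Ideal.subset_span (Or.inr (Or.inr (Or.inl rfl)))))

theorem P_pow : D.P ^ 3 = Ideal.span {D.π} := by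
  have h1 : (1 : O) ∈ Ideal.span {D.π, D.t D.π} := by rw [D.span_π_t_π]; trivial
  obtain ⟨u, v, huv⟩ := Ideal.mem_span_pair.1 h1
  apply le_antisymm
  · rw [P, pow_succ, pow_two, Ideal.span_pair_mul_span_pair, Ideal.span_mul_span', Ideal.span_le]
    rintro x ⟨a, ha, b, hb, rfl⟩
    rw [SetLike.mem_coe, Ideal.mem_span_singleton]
    rcases hb with rfl | rfl
    · exact dvd_mul_left _ _
    · rcases ha with rfl | rfl | rfl | rfl
      · exact ⟨D.π * D.θ, by ring⟩
      · exact ⟨D.θ * D.θ, by ring⟩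
      · exact ⟨D.θ * D.θ, by ring⟩
      · exact ⟨D.t D.π, by rw [D.π_mul, ← D.θ_pow]; ring⟩
  · rw [Ideal.span_singleton_le_iff_mem]
    have h2 : D.π ^ 3 ∈ D.P ^ 3 := Ideal.pow_mem_pow D.π_mem 3
    have h3 : D.θ ^ 3 ∈ D.P ^ 3 := Ideal.pow_mem_pow D.θ_mem 3
    rw [D.θ_pow, ← D.π_mul] at h3
    have h4 : D.π = (u ^ 2 ) * D.π ^ 3 +  (2 * u * D.π + v * D.t D.π) * v * (D.π * D.t D.π) := by
      linear_combination - D.π * (1 + u * D.π + v * D.t D.π) * huv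
    rw [h4]
    exact Ideal.add_mem _ (Ideal.mul_mem_left _ _ h2) (Ideal.mul_mem_left _ _ h3)

theorem P'_pow : D.P' ^ 3 = Ideal.span {D.t D.π} := by
  rw [← D.map_t_P, ← Ideal.map_pow, D.P_pow, Ideal.map_span, Set.image_singleton]

theorem P_ne_top : D.P ≠ ⊤ := fun h => by
  have h1 := D.P_pow
  have h2 := D.P'_pow
  rw [← D.map_t_P] at h2
  rw [h, Ideal.map_top] at h2
  rw [h] at h1
  simp only [Ideal.top_pow] at h1 h2
  have h1 := Ideal.span_singleton_eq_top.1 h1.symm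
  have h2 := Ideal.span_singleton_eq_top.1 h2.symm
  apply D.not_isUnit_p
  rw [← D.π_mul]
  exact h1.mul h2

theorem p_mem : (p : O) ∈ D.P := by
  rw [← D.π_mul]; exact Ideal.mul_mem_right _ _ D.π_mem

theorem intCast_mem_P {n : ℤ} : (n : O) ∈ D.P ↔ (p : ℤ) ∣ n := by
  constructor
  · intro h
    by_contra hn
    obtain ⟨u, v, huv⟩ := ((Nat.prime_iff_prime_int.1 hp.out).coprime_iff_not_dvd).2 hn
    apply D.P_ne_top
    rw [Ideal.eq_top_iff_one]
    have : (1 : O) = u * p + v * n := by exact_mod_cast (congrArg (Int.cast (R := O)) huv).symm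
    rw [this]
    exact Ideal.add_mem _ (Ideal.mul_mem_left _ _ D.p_mem) (Ideal.mul_mem_left _ _ h)
  · rintro ⟨a, rfl⟩
    push_cast
    exact Ideal.mul_mem_right _ _ D.p_mem

theorem card_quotient_P : Nat.card (O ⧸ D.P) = p := by
  have e1 := Ideal.quotientMulEquivQuotientProd D.P D.P' D.isCoprime_P_P'
  rw [D.P_mul_P'] at e1
  have e2 := Ideal.quotientEquiv D.P D.P' D.t D.map_t_P.symm
  have h := D.card_θ
  rw [Nat.card_congr e1.toEquiv, Nat.card_prod, ← Nat.card_congr e2.toEquiv, ← pow_two] at h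
  exact Nat.pow_left_injective (n := 2) (by norm_num) h

theorem residue (x : O) : ∃ n : ℤ, x - (n : O) ∈ D.P := by
  have hc := D.card_quotient_P
  have : Finite (O ⧸ D.P) := Nat.finite_of_card_ne_zero (hc.trans_ne hp.out.ne_zero)
  have : Nontrivial (O ⧸ D.P) := Ideal.Quotient.nontrivial_iff.2 D.P_ne_top
  have h1 : (Int.castAddHom (O ⧸ D.P)).range = ⊤ := by
    refine ((Int.castAddHom (O ⧸ D.P)).range.eq_bot_or_eq_top_of_prime_card
      (hp := ⟨hc.symm ▸ hp.out⟩)).resolve_left fun h => ?_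
    have h2 : (1 : O ⧸ D.P) ∈ (Int.castAddHom (O ⧸ D.P)).range := ⟨1, by simp⟩
    rw [h, AddSubgroup.mem_bot] at h2
    exact one_ne_zero h2
  obtain ⟨n, hn⟩ : Ideal.Quotient.mk D.P x ∈ (Int.castAddHom (O ⧸ D.P)).range := h1 ▸ trivial
  refine ⟨n, ?_⟩
  rw [← Ideal.Quotient.eq, map_intCast]
  exact hn.symm

instance P_prime : D.P.IsPrime := by
  refine ⟨D.P_ne_top, fun {x y} h => ?_⟩
  obtain ⟨n, hn⟩ := D.residue x
  obtain ⟨m, hm⟩ := D.residue y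
  change x - n ∈ D.P at hn
  change y - m ∈ D.P at hm
  have : ((n * m : ℤ) : O) ∈ D.P := by
    have e : ((n * m : ℤ) : O) = x * y - (x - n) * y - n * (y - m) := by push_cast; ring
    rw [e]
    exact Ideal.sub_mem _ (Ideal.sub_mem _ h (Ideal.mul_mem_right _ _ hn))
      (Ideal.mul_mem_left _ _ hm)
  rw [D.intCast_mem_P] at this
  rcases (Nat.prime_iff_prime_int.1 hp.out).dvd_or_dvd this with h | h
  · left
    have := Ideal.add_mem _ hn (D.intCast_mem_P.2 h)
    rwa [sub_add_cancel] at this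
  · right
    have := Ideal.add_mem _ hm (D.intCast_mem_P.2 h)
    rwa [sub_add_cancel] at this

theorem P_ne_bot : D.P ≠ ⊥ := fun h => D.π_ne_zero (by
  have := D.π_mem; rwa [h, Ideal.mem_bot] at this)

theorem P'_ne_bot : D.P' ≠ ⊥ := fun h => D.θ_ne_zero (by
  have := D.θ_mem'; rwa [h, Ideal.mem_bot] at this)

theorem prime_P : Prime D.P := Ideal.prime_of_isPrime D.P_ne_bot D.P_prime

instance P'_prime : D.P'.IsPrime := by
  rw [← D.map_t_P]; exact Ideal.map_isPrime_of_equiv _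

theorem prime_P' : Prime D.P' := Ideal.prime_of_isPrime D.P'_ne_bot D.P'_prime

theorem span_p : Ideal.span {(p : O)} = D.P ^ 3 * D.P' ^ 3 := by
  rw [← mul_pow, D.P_mul_P', Ideal.span_singleton_pow, D.θ_pow]

end PureCubicRing

namespace PureCubicRing

set_option linter.unusedSectionVars false

variable {O : Type*} [CommRing O] [IsDedekindDomain O] [CharZero O]
  {p : ℕ} [hp : Fact p.Prime] (D : PureCubicRing O p)

include D

/-- The norm to the subring of elements fixed by `s`. -/
def N (x : O) : O := x * D.s x * D.s (D.s x)

/-- The trace to the subring of elements fixed by `s`. -/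
def Tr (x : O) : O := x + D.s x + D.s (D.s x)

theorem s_N (x : O) : D.s (D.N x) = D.N x := by
  simp only [N, map_mul, D.s_s_s]; ring

theorem s_Tr (x : O) : D.s (D.Tr x) = D.Tr x := by
  simp only [Tr, map_add, D.s_s_s]; ring

theorem N_mul (x y : O) : D.N (x * y) = D.N x * D.N y := by
  simp only [N, map_mul]; ring

theorem N_s (x : O) : D.N (D.s x) = D.N x := by
  simp only [N, D.s_s_s]; ring

theorem N_t (x : O) : D.N (D.t x) = D.t (D.N x) := by
  simp only [N, map_mul, D.t_s_s, D.t_s]; ring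

theorem N_of_fixed {x : O} (h : D.s x = x) : D.N x = x ^ 3 := by
  simp only [N, h]; ring

theorem N_ne_zero {x : O} (h : x ≠ 0) : D.N x ≠ 0 :=
  mul_ne_zero (mul_ne_zero h (by simpa using h)) (by simpa using h)

theorem N_θ : D.N D.θ = p := by
  rw [← D.θ_pow]
  simp only [N, D.s_θ, map_mul, D.s_ζ]
  linear_combination D.θ ^ 3 * D.ζ_pow

theorem N_neg (x : O) : D.N (-x) = - D.N x := by
  simp only [N, map_neg]; ring

theorem β_relation : D.β ^ 2 + D.s D.β ^ 2 + D.s (D.s D.β) ^ 2 - (D.β * D.s D.β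
    + D.s D.β * D.s (D.s D.β) + D.s (D.s D.β) * D.β) = p := by
  have e0 := D.β_eq
  have e1 := congrArg D.s e0
  have e2 := congrArg D.s e1
  simp only [map_mul, map_add, map_pow, D.s_θ, D.s_ζ, map_one, map_ofNat] at e1 e2
  have h := D.ζ_eq
  have h9 : (9 : O) ≠ 0 := by norm_num
  apply mul_left_cancel₀ h9
  rw [← D.θ_pow]
  generalize D.s (D.s D.β) = b2 at *
  generalize D.s D.β = b1 at *
  generalize D.β = b0 at *
  generalize D.ζ = z at *
  generalize D.θ = w at *
  grind

theorem p_mul_eq (x : O) : (p : O) * x =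
    (D.β ^ 2 + D.s D.β ^ 2 + D.s (D.s D.β) ^ 2) * D.Tr x
    - D.β * D.Tr ((D.s D.β + D.s (D.s D.β)) * x) 
    - D.s D.β * D.Tr ((D.s (D.s D.β) + D.β) * x) 
    - D.s (D.s D.β) * D.Tr ((D.β + D.s D.β) * x)
    + D.Tr (D.s D.β * D.s (D.s D.β) * x) + D.Tr (D.s (D.s D.β) * D.β * x)
    + D.Tr (D.β * D.s D.β * x) := by
  simp only [Tr, map_add, map_mul, D.s_s_s]
  linear_combination - x * D.β_relation

theorem N_mem {I : Ideal O} {x : O} (h : x ∈ I) : D.N x ∈ I := by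
  rw [N, mul_assoc]; exact Ideal.mul_mem_right _ _ h

theorem s_mem {I : Ideal O} (hI : I.map D.s = I) {x : O} (h : x ∈ I) : D.s x ∈ I := by
  rw [← hI]; exact Ideal.mem_map_of_mem _ h

theorem exists_mul_eq_of_dvd_span_p {J : Ideal O} (h : J ∣ Ideal.span {(p : O)}) :
    ∃ a b, J = D.P ^ a * D.P' ^ b := by
  rw [D.span_p] at h
  obtain ⟨J1, J2, h1, h2, rfl⟩ := exists_dvd_and_dvd_of_dvd_mul h
  obtain ⟨a, -, ha⟩ := (dvd_prime_pow D.prime_P _).1 h1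
  obtain ⟨b, -, hb⟩ := (dvd_prime_pow D.prime_P' _).1 h2
  exact ⟨a, b, by rw [associated_iff_eq.1 ha, associated_iff_eq.1 hb]⟩

theorem exists_mul_eq_span {I : Ideal O} (h0 : I ≠ ⊥) (hI : I.map D.s = I) :
    ∃ g ≠ 0, D.s g = g ∧ ∃ a b, I * (D.P ^ a * D.P' ^ b) = Ideal.span {g} := by
  obtain ⟨g, hgI, hgs, hg⟩ := D.pid I
  obtain ⟨x, hx, hx0⟩ := Submodule.exists_mem_ne_zero_of_ne_bot h0
  obtain ⟨y, hy⟩ := hg _ (D.N_mem hx) (D.s_N x)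
  have hg0 : g ≠ 0 := by
    rintro rfl
    exact D.N_ne_zero hx0 (by rw [hy, zero_mul])
  refine ⟨g, hg0, hgs, ?_⟩
  have hTr : ∀ c, ∀ x ∈ I, D.Tr (c * x) ∈ Ideal.span {g} := fun c x hx => by
    have hm : c * x ∈ I := Ideal.mul_mem_left _ _ hx
    obtain ⟨y, hy⟩ := hg (D.Tr (c * x)) (Ideal.add_mem _ (Ideal.add_mem _ hm (D.s_mem hI hm))
      (D.s_mem hI (D.s_mem hI hm))) (D.s_Tr _)
    exact Ideal.mem_span_singleton.2 ⟨y, hy⟩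
  have hp : Ideal.span {(p : O)} * I ≤ Ideal.span {g} := by
    rw [Ideal.span_singleton_mul_le_iff]
    intro x hx
    rw [D.p_mul_eq x]
    have h1 := hTr 1 x hx
    rw [one_mul] at h1
    refine Ideal.add_mem _ (Ideal.add_mem _ (Ideal.add_mem _ (Ideal.sub_mem _ (Ideal.sub_mem _
      (Ideal.sub_mem _ (Ideal.mul_mem_left _ _ h1) ?_) ?_) ?_) (hTr _ _ hx)) (hTr _ _ hx))
      (hTr _ _ hx) <;> exact Ideal.mul_mem_left _ _ (hTr _ _ hx)
  obtain ⟨J, hJ⟩ := Ideal.dvd_iff_le.2 ((Ideal.span_singleton_le_iff_mem _).2 hgI)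
  rw [hJ, ← Ideal.dvd_iff_le, mul_comm I] at hp
  obtain ⟨a, b, rfl⟩ := D.exists_mul_eq_of_dvd_span_p ((mul_dvd_mul_iff_right h0).1 hp)
  exact ⟨a, b, hJ.symm⟩

/-- A fixed element in `P` is divisible by `π`. -/
theorem π_dvd_of_mem {g : O} (hg : D.s g = g) (h : g ∈ D.P) : ∃ g', D.s g' = g' ∧ g = D.π * g' := by
  have key : D.t D.π * g ∈ Ideal.span {(p : O)} := by
    obtain ⟨a, b, hab, hb⟩ := D.exists_π_eq
    obtain ⟨x, y, rfl⟩ := D.fixed g hg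
    have h1 : ((b * x - a * y : ℤ) : O) ∈ D.P := by
      have : ((b * x - a * y : ℤ) : O) = b * (x + y * D.ζ) - y * D.π := by
        rw [hab]; push_cast; ring
      rw [this]
      exact Ideal.sub_mem _ (Ideal.mul_mem_left _ _ h) (Ideal.mul_mem_left _ _ D.π_mem)
    obtain ⟨m, hm⟩ := D.intCast_mem_P.1 h1
    obtain ⟨u, v, huv⟩ := ((Nat.prime_iff_prime_int.1 hp.out).coprime_iff_not_dvd).2 hb
    have e1 : (b : O) * x - a * y = p * m := by exact_mod_cast congrArg (Int.cast (R := O)) hm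
    have e2 : (u : O) * p + v * b = 1 := by exact_mod_cast congrArg (Int.cast (R := O)) huv
    rw [Ideal.mem_span_singleton]
    have e3 : D.t D.π * (b * (x + y * D.ζ)) = p * (D.t D.π * m + y) := by
      linear_combination D.t D.π * e1 - D.t D.π * y * hab + y * D.π_mul
    refine ⟨D.t D.π * u * (x + y * D.ζ) + v * (D.t D.π * m + y), ?_⟩
    linear_combination v * e3 - D.t D.π * (x + y * D.ζ) * e2
  obtain ⟨g', hg'⟩ := Ideal.mem_span_singleton.1 key
  rw [← D.π_mul, mul_comm D.π, mul_assoc] at hg'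
  have e := mul_left_cancel₀ (by simpa using D.π_ne_zero) hg'
  refine ⟨g', ?_, e⟩
  rw [e, map_mul, D.s_π] at hg
  exact mul_left_cancel₀ D.π_ne_zero hg

theorem s_t_of_fixed {g : O} (hg : D.s g = g) : D.s (D.t g) = D.t g := by
  rw [← D.t_s_s, hg, hg]

theorem t_π_dvd_of_mem {g : O} (hg : D.s g = g) (h : g ∈ D.P') :
    ∃ g', D.s g' = g' ∧ g = D.t D.π * g' := by
  have h1 : D.t g ∈ D.P := by rw [← D.map_t_P']; exact Ideal.mem_map_of_mem _ h
  obtain ⟨g', h2, h3⟩ := D.π_dvd_of_mem (D.s_t_of_fixed hg) h1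
  exact ⟨D.t g', D.s_t_of_fixed h2, by rw [← D.t_t g, h3, map_mul]⟩

theorem t_π_not_mem : D.t D.π ∉ D.P := fun h => D.P_ne_top (by
  rw [eq_top_iff, ← D.span_π_t_π, Ideal.span_le, Set.insert_subset_iff, Set.singleton_subset_iff]
  exact ⟨D.π_mem, h⟩)

theorem t_π_ne_zero : D.t D.π ≠ 0 := by simpa using D.π_ne_zero

theorem s_t_π : D.s (D.t D.π) = D.t D.π := D.s_t_of_fixed D.s_π

theorem exists_eq_pow_mul {g : O} (h0 : g ≠ 0) (hg : D.s g = g) :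
    ∃ c d g', D.s g' = g' ∧ g' ∉ D.P ∧ g' ∉ D.P' ∧ g = D.π ^ c * D.t D.π ^ d * g' := by
  have hu : ¬ IsUnit D.π := fun h => D.P_ne_top (Ideal.eq_top_of_isUnit_mem _ D.π_mem h)
  have hu' : ¬ IsUnit (D.t D.π) := fun h =>
    D.P'_prime.ne_top (Ideal.eq_top_of_isUnit_mem _ D.t_π_mem h)
  obtain ⟨c, g1, h1, rfl⟩ := WfDvdMonoid.max_power_factor' h0 hu
  have hg1 : D.s g1 = g1 := by
    rw [map_mul, map_pow, D.s_π] at hg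
    exact mul_left_cancel₀ (pow_ne_zero _ D.π_ne_zero) hg
  obtain ⟨d, g2, h2, rfl⟩ := WfDvdMonoid.max_power_factor' (right_ne_zero_of_mul h0) hu'
  have hg2 : D.s g2 = g2 := by
    rw [map_mul, map_pow, D.s_t_π] at hg1
    exact mul_left_cancel₀ (pow_ne_zero _ D.t_π_ne_zero) hg1
  refine ⟨c, d, g2, hg2, fun h => h1 ?_, fun h => h2 ?_, by ring⟩
  · obtain ⟨y, -, hy⟩ := D.π_dvd_of_mem hg2 h
    exact ⟨D.t D.π ^ d * y, by rw [hy]; ring⟩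
  · obtain ⟨y, -, hy⟩ := D.t_π_dvd_of_mem hg2 h
    exact ⟨y, hy⟩

theorem map_s_P' : D.P'.map D.s = D.P' := by
  rw [P', Ideal.map_span, Set.image_pair, D.s_t_π, D.s_θ, Ideal.span_insert,
    Ideal.span_singleton_mul_left_unit D.isUnit_ζ, ← Ideal.span_insert]

theorem not_P_dvd_P' : ¬ D.P ∣ D.P' := fun h =>
  D.t_π_not_mem (Ideal.dvd_iff_le.1 h D.t_π_mem)

omit D in
theorem pow_mul_inj {M : Type*} [CommMonoidWithZero M] [IsCancelMulZero M] {q : M} (hq : Prime q)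
    {a b : ℕ} {x y : M} (hx : ¬ q ∣ x) (hy : ¬ q ∣ y) (h : q ^ a * x = q ^ b * y) :
    a = b ∧ x = y := by
  wlog hab : a ≤ b generalizing a b x y
  · obtain ⟨h1, h2⟩ := this hy hx h.symm (by omega)
    exact ⟨h1.symm, h2.symm⟩
  obtain ⟨c, rfl⟩ := Nat.exists_eq_add_of_le hab
  rw [pow_add, mul_assoc] at h
  have h1 := mul_left_cancel₀ (pow_ne_zero _ hq.ne_zero) h
  rcases c with _ | c
  · exact ⟨rfl, by simpa using h1⟩
  · exact absurd ⟨q ^ c * y, by rw [h1, pow_succ', mul_assoc]⟩ hx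

theorem span_pow_mul (c d : ℕ) (g : O) : Ideal.span {D.π ^ c * D.t D.π ^ d * g} =
    D.P ^ (3 * c) * (D.P' ^ (3 * d) * Ideal.span {g}) := by
  rw [pow_mul, pow_mul, D.P_pow, D.P'_pow, Ideal.span_singleton_pow, Ideal.span_singleton_pow,
    Ideal.span_singleton_mul_span_singleton, Ideal.span_singleton_mul_span_singleton, mul_assoc]

theorem not_P_dvd_mul {I : Ideal O} (hI : ¬ D.P ∣ I) (b : ℕ) : ¬ D.P ∣ D.P' ^ b * I := fun h => by
  rcases D.prime_P.dvd_or_dvd h with h | h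
  · exact D.not_P_dvd_P' (D.prime_P.dvd_of_dvd_pow h)
  · exact hI h

/-- Comparison of the exponents at `P`, `P'` of an ideal generated by a fixed element. -/
theorem exponents_of_eq_span {I : Ideal O} {a b : ℕ} {g : O} (hg0 : g ≠ 0) (hg : D.s g = g)
    (h : ¬ D.P ∣ I) (h' : ¬ D.P' ∣ I) (e : D.P ^ a * (D.P' ^ b * I) = Ideal.span {g}) :
    3 ∣ a ∧ 3 ∣ b ∧ ∃ g', D.s g' = g' ∧ I = Ideal.span {g'} := by
  obtain ⟨c, d, g', hs, h1, h2, rfl⟩ := D.exists_eq_pow_mul hg0 hg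
  rw [D.span_pow_mul] at e
  rw [← Ideal.dvd_span_singleton] at h1 h2
  obtain ⟨e1, e2⟩ := pow_mul_inj D.prime_P (D.not_P_dvd_mul h b) (D.not_P_dvd_mul h1 _) e
  obtain ⟨e3, e4⟩ := pow_mul_inj D.prime_P' h' h2 e2
  exact ⟨⟨c, e1⟩, ⟨d, e3⟩, g', hs, e4⟩

/-- Invariant ideals are products of powers of `P`, `P'` and of an ideal generated by a fixed
element. -/
theorem exists_eq_of_map_s {I : Ideal O} (h0 : I ≠ ⊥) (hI : I.map D.s = I) :
    ∃ a b, ∃ g ≠ 0, D.s g = g ∧ g ∉ D.P ∧ g ∉ D.P' ∧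
      I = D.P ^ a * (D.P' ^ b * Ideal.span {g}) := by
  obtain ⟨a, I1, h1, rfl⟩ := WfDvdMonoid.max_power_factor h0 D.prime_P.irreducible
  obtain ⟨b, I2, h2, rfl⟩ := WfDvdMonoid.max_power_factor (right_ne_zero_of_mul h0)
    D.prime_P'.irreducible
  have h3 : ¬ D.P ∣ I2 := fun h => h1 (h.mul_left _)
  have hI2 : I2.map D.s = I2 := by
    rw [Ideal.map_mul, Ideal.map_mul, Ideal.map_pow, Ideal.map_pow, D.map_s_P, D.map_s_P'] at hI
    exact mul_left_cancel₀ (pow_ne_zero _ D.P'_ne_bot)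
      (mul_left_cancel₀ (pow_ne_zero _ D.P_ne_bot) hI)
  have h4 : I2 ≠ ⊥ := right_ne_zero_of_mul (right_ne_zero_of_mul h0)
  obtain ⟨g, hg0, hg, c, d, e⟩ := D.exists_mul_eq_span h4 hI2
  obtain ⟨-, -, g', hg', rfl⟩ := D.exponents_of_eq_span hg0 hg h3 h2
    (a := c) (b := d) (by rw [← e]; ring)
  refine ⟨a, b, g', ?_, hg', ?_, ?_, rfl⟩
  · rintro rfl
    exact h4 (by simp)
  · rwa [← Ideal.dvd_span_singleton]
  · rwa [← Ideal.dvd_span_singleton]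

theorem map_s_s_s (I : Ideal O) : ((I.map D.s).map D.s).map D.s = I := by
  ext x
  simp [Ideal.mem_map_of_equiv, D.s_s_s]

theorem map_t_s (I : Ideal O) : (I.map D.s).map D.t = ((I.map D.t).map D.s).map D.s := by
  ext x
  simp [Ideal.mem_map_of_equiv, D.t_s]

theorem map_s_eq_P_iff {I : Ideal O} (h : I.map D.s = D.P) : I = D.P := by
  rw [← D.map_s_s_s I, h, D.map_s_P, D.map_s_P]

theorem map_s_eq_P'_iff {I : Ideal O} (h : I.map D.s = D.P') : I = D.P' := by
  rw [← D.map_s_s_s I, h, D.map_s_P', D.map_s_P']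

/-- The norm of an ideal, as an ideal of `O`. -/
def NI (I : Ideal O) : Ideal O := I * I.map D.s * (I.map D.s).map D.s

theorem NI_mul (I J : Ideal O) : D.NI (I * J) = D.NI I * D.NI J := by
  simp only [NI, Ideal.map_mul]; ring

theorem NI_span (x : O) : D.NI (Ideal.span {x}) = Ideal.span {D.N x} := by
  simp only [NI, Ideal.map_span, Set.image_singleton, Ideal.span_singleton_mul_span_singleton, N]

theorem map_s_NI (I : Ideal O) : (D.NI I).map D.s = D.NI I := by
  simp only [NI, Ideal.map_mul, D.map_s_s_s]; ring

theorem exists_NI_eq {I : Ideal O} (h0 : I ≠ ⊥) :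
    ∃ g ≠ 0, D.s g = g ∧ D.NI I = Ideal.span {g} := by
  induction I using UniqueFactorizationMonoid.induction_on_prime with
  | h₁ => exact absurd rfl h0
  | h₂ I hI =>
    rw [Ideal.isUnit_iff] at hI
    refine ⟨1, one_ne_zero, map_one _, ?_⟩
    rw [hI, NI, Ideal.map_top, Ideal.map_top, Ideal.span_singleton_one]
    simp
  | h₃ I Q hI hQ ih =>
    obtain ⟨g, hg0, hg, e⟩ := ih hI
    suffices ∃ g ≠ 0, D.s g = g ∧ D.NI Q = Ideal.span {g} by
      obtain ⟨f, hf0, hf, e'⟩ := this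
      exact ⟨f * g, mul_ne_zero hf0 hg0, by rw [map_mul, hf, hg], by
        rw [D.NI_mul, e, e', Ideal.span_singleton_mul_span_singleton]⟩
    by_cases h1 : Q = D.P
    · exact ⟨D.π, D.π_ne_zero, D.s_π, by
        rw [h1, NI, D.map_s_P, D.map_s_P, ← D.P_pow]; ring⟩
    by_cases h2 : Q = D.P'
    · exact ⟨D.t D.π, D.t_π_ne_zero, D.s_t_π, by
        rw [h2, NI, D.map_s_P', D.map_s_P', ← D.P'_pow]; ring⟩
    have hQ' : Q.IsPrime := Ideal.isPrime_of_prime hQ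
    have hs1 : Prime (Q.map D.s) := Ideal.prime_of_isPrime
      (fun h => hQ.ne_zero ((Ideal.map_eq_bot_iff_of_injective D.s.injective).1 h))
      (Ideal.map_isPrime_of_equiv _)
    have hs1' : (Q.map D.s).IsPrime := Ideal.isPrime_of_prime hs1
    have hs2 : Prime ((Q.map D.s).map D.s) := Ideal.prime_of_isPrime
      (fun h => hs1.ne_zero ((Ideal.map_eq_bot_iff_of_injective D.s.injective).1 h))
      (Ideal.map_isPrime_of_equiv _)
    have h3 : ∀ R : Ideal O, Prime R → R ∣ D.NI Q →
        R = Q ∨ R = Q.map D.s ∨ R = (Q.map D.s).map D.s := fun R hR h => by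
      rcases hR.dvd_or_dvd h with h | h
      · rcases hR.dvd_or_dvd h with h | h
        · exact Or.inl (associated_iff_eq.1 (hR.associated_of_dvd hQ h))
        · exact Or.inr (Or.inl (associated_iff_eq.1 (hR.associated_of_dvd hs1 h)))
      · exact Or.inr (Or.inr (associated_iff_eq.1 (hR.associated_of_dvd hs2 h)))
    have h4 : ¬ D.P ∣ D.NI Q := fun h => by
      rcases h3 _ D.prime_P h with h | h | h
      · exact h1 h.symm
      · exact h1 (D.map_s_eq_P_iff h.symm)
      · exact h1 (D.map_s_eq_P_iff (D.map_s_eq_P_iff h.symm))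
    have h5 : ¬ D.P' ∣ D.NI Q := fun h => by
      rcases h3 _ D.prime_P' h with h | h | h
      · exact h2 h.symm
      · exact h2 (D.map_s_eq_P'_iff h.symm)
      · exact h2 (D.map_s_eq_P'_iff (D.map_s_eq_P'_iff h.symm))
    have h6 : D.NI Q ≠ ⊥ := mul_ne_zero (mul_ne_zero hQ.ne_zero hs1.ne_zero) hs2.ne_zero
    obtain ⟨a, b, g, hg0, hg, h7, h8, e⟩ := D.exists_eq_of_map_s h6 (D.map_s_NI Q)
    have := pow_mul_inj D.prime_P (a := 0) h4
      (D.not_P_dvd_mul (by rwa [Ideal.dvd_span_singleton]) b) (by simpa using e)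
    have := pow_mul_inj D.prime_P' (a := 0) h5 (by rwa [Ideal.dvd_span_singleton])
      (by simpa using this.2)
    exact ⟨g, hg0, hg, this.2⟩

/-- Hilbert's theorem 90 for `s`. -/
theorem exists_of_N_eq {x y : O} (hy : y ≠ 0) (h : D.N x = D.N y) :
    ∃ α ≠ 0, x * D.s α = y * α := by
  let f : O → O := fun z => D.N y * z + x * D.s y * D.s (D.s y) * D.s z
    + x * D.s x * D.s (D.s y) * D.s (D.s z)
  have hf : ∀ z, x * D.s (f z) = y * f z := fun z => by
    simp only [f, N, map_add, map_mul, D.s_s_s] at h ⊢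
    linear_combination y * z * h
  by_contra! hc
  have h0 : ∀ z, f z = 0 := fun z => by
    by_contra h
    exact hc _ h (hf z)
  have h1 := h0 1
  have h2 := h0 D.θ
  have h3 := h0 (D.θ ^ 2)
  simp only [f, map_one, map_pow, map_mul, D.s_θ, D.s_ζ] at h1 h2 h3
  generalize x * D.s y * D.s (D.s y) = B at *
  generalize x * D.s x * D.s (D.s y) = C at *
  have e2 : D.θ * (D.N y + D.ζ * B + D.ζ ^ 2 * C) = 0 := by linear_combination h2
  have e3 : D.θ ^ 2 * (D.N y + D.ζ ^ 2 * B + D.ζ ^ 4 * C) = 0 := by linear_combination h3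
  have e2 := (mul_eq_zero.1 e2).resolve_left D.θ_ne_zero
  have e3 := (mul_eq_zero.1 e3).resolve_left (pow_ne_zero _ D.θ_ne_zero)
  have : 3 * D.N y = 0 := by
    linear_combination h1 + e2 + e3 - (B + (1 + D.ζ ^ 2 - D.ζ) * C) * D.ζ_eq
  exact D.N_ne_zero hy ((mul_eq_zero.1 this).resolve_left (by norm_num))

theorem map_s_ne_bot {I : Ideal O} (h : I ≠ ⊥) : I.map D.s ≠ ⊥ := fun h' =>
  h ((Ideal.map_eq_bot_iff_of_injective D.s.injective).1 h')

theorem map_t_ne_bot {I : Ideal O} (h : I ≠ ⊥) : I.map D.t ≠ ⊥ := fun h' =>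
  h ((Ideal.map_eq_bot_iff_of_injective D.t.injective).1 h')

theorem exists_mul_span_eq {I : Ideal O} (h0 : I ≠ ⊥) {x y : O} (hy : y ≠ 0) (h : D.N x = D.N y)
    (hI : I.map D.s * Ideal.span {y} = I * Ideal.span {x}) :
    ∃ α ≠ 0, x * D.s α = y * α ∧ ∃ a b, ∃ g ≠ 0, D.s g = g ∧ g ∉ D.P ∧ g ∉ D.P' ∧
      I * Ideal.span {α} = D.P ^ a * (D.P' ^ b * Ideal.span {g}) := by
  obtain ⟨α, hα, e⟩ := D.exists_of_N_eq hy h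
  refine ⟨α, hα, e, D.exists_eq_of_map_s (mul_ne_zero h0 (by simpa using hα)) ?_⟩
  have hy' : Ideal.span {y} ≠ 0 := by simpa using hy
  apply mul_right_cancel₀ hy'
  rw [Ideal.map_mul, Ideal.map_span, Set.image_singleton, mul_right_comm, hI, mul_assoc, mul_assoc,
    Ideal.span_singleton_mul_span_singleton, Ideal.span_singleton_mul_span_singleton, e, mul_comm y]

end PureCubicRing

namespace PureCubicRing

set_option linter.unusedSectionVars false

variable {O : Type*} [CommRing O] [IsDedekindDomain O] [CharZero O]
  {p : ℕ} [hp : Fact p.Prime] (D : PureCubicRing O p)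

include D

theorem mk_s (x : O) : Ideal.Quotient.mk D.P (D.s x) = Ideal.Quotient.mk D.P x := by
  obtain ⟨n, hn⟩ := D.residue x
  have h1 : x - n ∈ D.P := hn
  have h2 := D.s_mem D.map_s_P h1
  rw [map_sub, map_intCast] at h2
  rw [Ideal.Quotient.mk_eq_mk_iff_sub_mem]
  simpa using Ideal.sub_mem _ h2 h1

theorem mk_N (x : O) : Ideal.Quotient.mk D.P (D.N x) = Ideal.Quotient.mk D.P x ^ 3 := by
  simp only [N, map_mul, D.mk_s]; ring

theorem mk_pow {x : O} (h : x ∉ D.P) : Ideal.Quotient.mk D.P x ^ (p - 1) = 1 := by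
  obtain ⟨n, hn⟩ := D.residue x
  have h1 : x - n ∈ D.P := hn
  have h2 : ¬ (p : ℤ) ∣ n := fun h3 => h (by
    have := Ideal.add_mem _ h1 (D.intCast_mem_P.2 h3)
    rwa [sub_add_cancel] at this)
  rw [Ideal.Quotient.mk_eq_mk_iff_sub_mem _ _ |>.2 h1, ← map_pow, ← map_one (Ideal.Quotient.mk D.P),
    Ideal.Quotient.mk_eq_mk_iff_sub_mem]
  have h3 : n ^ (p - 1) ≡ 1 [ZMOD p] := Int.ModEq.pow_card_sub_one_eq_one hp.out
    (((Nat.prime_iff_prime_int.1 hp.out).coprime_iff_not_dvd).2 h2).symm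
  have h4 := D.intCast_mem_P.2 h3.symm.dvd
  push_cast at h4
  exact h4

theorem exists_mul_pow_eq {x : O} (h0 : x ≠ 0) :
    ∃ n, ∃ x' ∉ D.P, x * D.t D.π ^ n = D.θ ^ n * x' := by
  obtain ⟨n, I, h1, e⟩ := WfDvdMonoid.max_power_factor (a₀ := Ideal.span {x})
    (by simpa using h0) D.prime_P.irreducible
  have h0' : x ∈ D.P ^ n * I := by
    rw [← e]; exact Ideal.mem_span_singleton_self x
  have h2 : x * D.t D.π ^ n ∈ D.P ^ n * D.P' ^ n := Ideal.mul_mem_mul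
    (Ideal.mul_le_left h0') (Ideal.pow_mem_pow D.t_π_mem _)
  rw [← mul_pow, D.P_mul_P', Ideal.span_singleton_pow] at h2
  obtain ⟨x', hx'⟩ := Ideal.mem_span_singleton.1 h2
  refine ⟨n, x', fun h => h1 ?_, hx'⟩
  have h3 : D.P ^ n * D.P' ^ n * (Ideal.span {x'}) = D.P ^ n * D.P' ^ n * (D.P' ^ (2 * n) * I) := by
    rw [← mul_pow, D.P_mul_P', Ideal.span_singleton_pow, Ideal.span_singleton_mul_span_singleton,
      ← hx', ← Ideal.span_singleton_mul_span_singleton, ← Ideal.span_singleton_pow, e, ← D.P'_pow,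
      ← Ideal.span_singleton_pow, ← D.P_mul_P']
    rw [← pow_mul, (by ring : 3 * n = n + 2 * n), pow_add, mul_pow]
    ac_rfl
  have h4 := mul_left_cancel₀ (mul_ne_zero (pow_ne_zero n D.prime_P.ne_zero)
    (pow_ne_zero n D.prime_P'.ne_zero)) h3
  rw [← Ideal.dvd_span_singleton, h4] at h
  by_contra h5
  exact D.not_P_dvd_mul h5 _ h

/-- If `A / B` is a norm, then it is a cubic residue modulo `P`. -/
theorem mk_pow_eq_of_mul_N_eq {A B x y : O} (hA : A ∉ D.P) (hB : B ∉ D.P) (hx : x ≠ 0) (hy : y ≠ 0)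
    (h : A * D.N y = B * D.N x) :
    Ideal.Quotient.mk D.P A ^ ((p - 1) / 3) = Ideal.Quotient.mk D.P B ^ ((p - 1) / 3) := by
  have key : ∀ x n x', x * D.t D.π ^ n = D.θ ^ n * x' →
      D.N x * D.t D.π ^ (2 * n) = D.π ^ n * D.N x' := fun x n x' e => by
    have e1 := congrArg D.N e
    have h1 : ∀ z n, D.N (z ^ n) = D.N z ^ n := fun z n => by
      simp only [N, map_pow]; ring
    rw [D.N_mul, D.N_mul, h1, h1, D.N_of_fixed D.s_t_π, D.N_θ, ← D.π_mul] at e1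
    apply mul_right_cancel₀ (pow_ne_zero n D.t_π_ne_zero)
    linear_combination e1
  obtain ⟨n, x', hx', ex⟩ := D.exists_mul_pow_eq hx
  obtain ⟨m, y', hy', ey⟩ := D.exists_mul_pow_eq hy
  have ex' := key _ _ _ ex
  have ey' := key _ _ _ ey
  have hN : ∀ z ∉ D.P, D.N z ∉ D.P := fun z hz h => by
    rw [← Ideal.Quotient.eq_zero_iff_mem] at h hz
    rw [D.mk_N] at h
    exact hz (pow_eq_zero_iff (by norm_num) |>.1 h)
  have e : D.π ^ m * (A * D.N y' * D.t D.π ^ (2 * n)) =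
      D.π ^ n * (B * D.N x' * D.t D.π ^ (2 * m)) := by
    linear_combination - A * D.t D.π ^ (2 * n) * ey' + B * D.t D.π ^ (2 * m) * ex' +
      D.t D.π ^ (2 * n) * D.t D.π ^ (2 * m) * h
  have hm : ∀ {a b : O} , a ∉ D.P → b ∉ D.P → ∀ k, a * b * D.t D.π ^ k ∉ D.P := fun ha hb k => by
    intro hc
    rcases D.P_prime.mem_or_mem hc with hc | hc
    · rcases D.P_prime.mem_or_mem hc with hc | hc
      exacts [ha hc, hb hc]
    · exact D.t_π_not_mem (D.P_prime.mem_of_pow_mem _ hc)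
  have e1 := congrArg (fun z => Ideal.span {z}) e
  simp only [← Ideal.span_singleton_mul_span_singleton _ (_ * _), ← Ideal.span_singleton_pow] at e1
  rw [← D.P_pow, ← pow_mul, ← pow_mul] at e1
  have e2 := (pow_mul_inj D.prime_P
    (by rw [Ideal.dvd_span_singleton]; exact hm hA (hN _ hy') _)
    (by rw [Ideal.dvd_span_singleton]; exact hm hB (hN _ hx') _) e1).1
  have hmn : m = n := by omega
  rw [hmn] at e
  have e3 := mul_right_cancel₀ (pow_ne_zero _ D.t_π_ne_zero)
    (mul_left_cancel₀ (pow_ne_zero _ D.π_ne_zero) e)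
  have e4 := congrArg (fun z => Ideal.Quotient.mk D.P z ^ ((p - 1) / 3)) e3
  simp only [map_mul, D.mk_N, mul_pow, ← pow_mul] at e4
  have h3 : 3 * ((p - 1) / 3) = p - 1 := by
    have := D.p_mod
    omega
  rwa [h3, D.mk_pow hx', D.mk_pow hy', mul_one, mul_one] at e4

/-- The units fixed by `s` times the quotients `s v / v`. -/
def Λ : Subgroup Oˣ where
  carrier := {u | ∃ ε v : Oˣ, D.s ε = ε ∧ u * v = ε * Units.map (D.s : O →* O) v}
  one_mem' := ⟨1, 1, by simp, by simp⟩
  mul_mem' := by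
    rintro a b ⟨ε, v, h1, h2⟩ ⟨ε', v', h3, h4⟩
    exact ⟨ε * ε', v * v', by simp [h1, h3], by
      rw [map_mul, mul_mul_mul_comm, h2, h4, mul_mul_mul_comm]⟩
  inv_mem' := by
    rintro a ⟨ε, v, h1, h2⟩
    refine ⟨ε⁻¹, v⁻¹, ?_, ?_⟩
    · have := congrArg D.s (Units.mul_inv ε)
      rw [map_mul, map_one, h1, ← Units.mul_inv ε] at this
      exact mul_left_cancel₀ ε.ne_zero this
    · rw [map_inv, ← mul_inv, ← mul_inv, h2]

/-- The subgroup generated by the units fixed by `s` and the units fixed by a conjugate of `t`. -/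
def E₀ : Subgroup Oˣ := Subgroup.closure
  {u | D.s u = u ∨ D.t u = u ∨ (∃ w, D.t w = w ∧ (u : O) = D.s w) ∨
    ∃ w, D.t w = w ∧ (u : O) = D.s (D.s w)}

theorem mul_t_mem_E₀ (v : Oˣ) : v * Units.map (D.t : O →* O) v ∈ D.E₀ :=
  Subgroup.subset_closure (Or.inr (Or.inl (by simp [D.t_t, mul_comm])))

theorem Λ_le_E₀ : D.Λ ≤ D.E₀ := by
  rintro u ⟨ε, v, h1, h2⟩
  have h3 : ε ∈ D.E₀ := Subgroup.subset_closure (Or.inl h1)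
  have h4 : Units.map (D.s : O →* O) v * Units.map (D.t : O →* O) v ∈ D.E₀ := by
    refine Subgroup.subset_closure (Or.inr (Or.inr (Or.inr
      ⟨D.s (D.s v) * D.s (D.t v), ?_, ?_⟩)))
    · simp only [map_mul, D.t_s, D.s_s_s, D.t_t]; ring
    · simp [D.s_s_s]
  have h5 := D.mul_t_mem_E₀ v
  have h6 := D.E₀.mul_mem h3 (D.E₀.mul_mem h4 (D.E₀.inv_mem h5))
  convert h6 using 1
  rw [eq_mul_inv_of_mul_eq h2]
  group

theorem E₀_cases (h : D.Λ.index = 3) : D.E₀ = ⊤ ∨ D.E₀ = D.Λ := by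
  have h1 := Subgroup.relIndex_mul_index D.Λ_le_E₀
  rw [h] at h1
  rcases (Nat.dvd_prime Nat.prime_three).1 (Dvd.intro_left _ h1) with h2 | h2
  · left; exact Subgroup.index_eq_one.1 h2
  · right
    rw [h2] at h1
    exact le_antisymm (Subgroup.relIndex_eq_one.1 (by omega)) D.Λ_le_E₀

theorem index_E₀_eq_one_iff : D.E₀.index = 1 ↔ D.E₀ = ⊤ := Subgroup.index_eq_one

theorem index_E₀_eq_three_iff (h : D.Λ.index = 3) : D.E₀.index = 3 ↔ D.E₀ ≠ ⊤ := by
  constructor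
  · intro h1 h2
    rw [h2, Subgroup.index_top] at h1
    omega
  · intro h1
    rw [(D.E₀_cases h).resolve_left h1, h]

theorem cube_eq_one {ε : O} (h : ε ^ 3 = 1) : ε = 1 ∨ ε = D.ζ ∨ ε = D.ζ ^ 2 := by
  have : (ε - 1) * ((ε - D.ζ) * (ε - D.ζ ^ 2)) = 0 := by
    linear_combination h + (ε * (ε - 1) * (- 1) + (ε - 1) * (D.ζ - 1)) * D.ζ_eq
  rcases mul_eq_zero.1 this with h | h
  · left; exact sub_eq_zero.1 h
  · rcases mul_eq_zero.1 h with h | h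
    · right; left; exact sub_eq_zero.1 h
    · right; right; exact sub_eq_zero.1 h

theorem s_pow_θ (j : ℕ) : D.s (D.θ ^ j) = D.ζ ^ j * D.θ ^ j := by
  rw [map_pow, D.s_θ, mul_pow]

theorem span_θ_pow (j : ℕ) : Ideal.span {D.θ ^ j} = D.P ^ j * D.P' ^ j := by
  rw [← Ideal.span_singleton_pow, ← D.P_mul_P', mul_pow]

theorem one_not_dvd {Q : Ideal O} (hQ : Prime Q) : ¬ Q ∣ 1 := fun h => hQ.not_isUnit (isUnit_of_dvd_one h)

/-- A generator of `P` is not an eigenvector of `s`, even up to a unit of the form `s v / v`. -/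
theorem s_ne_of_span_eq_P {ρ ε : O} (h : Ideal.span {ρ} = D.P) (hε : D.s ε = ε) (he : D.s ρ = ε * ρ) :
    False := by
  have hρ : ρ ≠ 0 := by
    rintro rfl
    exact D.P_ne_bot (by rw [← h]; simp)
  have h3 : ε ^ 3 = 1 := by
    have := D.s_s_s ρ
    simp only [he, map_mul, hε] at this
    apply mul_right_cancel₀ hρ
    linear_combination this
  obtain ⟨j, hj⟩ : ∃ j : ℕ, ε * D.ζ ^ j = 1 := by
    rcases D.cube_eq_one h3 with h | h | h
    · exact ⟨0, by rw [h]; ring⟩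
    · exact ⟨2, by rw [h]; linear_combination D.ζ_pow⟩
    · exact ⟨1, by rw [h]; linear_combination D.ζ_pow⟩
  have h4 : D.s (ρ * D.θ ^ j) = ρ * D.θ ^ j := by
    rw [map_mul, he, D.s_pow_θ]; linear_combination ρ * D.θ ^ j * hj
  obtain ⟨h5, h6, -⟩ := D.exponents_of_eq_span (a := j + 1) (b := j) (I := 1)
    (mul_ne_zero hρ (pow_ne_zero _ D.θ_ne_zero)) h4 (D.one_not_dvd D.prime_P)
    (D.one_not_dvd D.prime_P') (by
      rw [← Ideal.span_singleton_mul_span_singleton, h, D.span_θ_pow]; ring)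
  omega

theorem E₀_eq_top_of_principal (hΛ : D.Λ.index = 3) {ρ : O} (h : Ideal.span {ρ} = D.P) :
    D.E₀ = ⊤ := by
  refine (D.E₀_cases hΛ).resolve_right fun hE => ?_
  have hρ : ρ ≠ 0 := by
    rintro rfl
    exact D.P_ne_bot (by rw [← h]; simp)
  have h1 : Ideal.span {ρ} = Ideal.span {D.s ρ} := by
    have := congrArg (Ideal.map D.s) h
    rwa [Ideal.map_span, Set.image_singleton, D.map_s_P, ← h, eq_comm] at this
  obtain ⟨y, hy⟩ := Ideal.span_singleton_eq_span_singleton.1 h1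
  have h2 : Ideal.span {D.θ} = Ideal.span {ρ * D.t ρ} := by
    have := congrArg (Ideal.map D.t) h
    rw [Ideal.map_span, Set.image_singleton, D.map_t_P] at this
    rw [← Ideal.span_singleton_mul_span_singleton, this, h, D.P_mul_P']
  obtain ⟨η, hη⟩ := Ideal.span_singleton_eq_span_singleton.1 h2
  have hy1 : y * Units.map (D.t : O →* O) y ∈ D.Λ := hE ▸ D.mul_t_mem_E₀ y
  have hy2 : Units.map (D.t : O →* O) y * y ^ 2 ∈ D.Λ := by
    have e1 := congrArg D.t hy
    have e2 := congrArg (fun z => D.s (D.s z)) hη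
    have e3 := congrArg D.s hy
    simp only [map_mul, D.t_s, D.s_θ, D.s_ζ] at e1 e2 e3
    have e4 : (η : O) * y * D.s y * D.t y = D.ζ ^ 2 * D.s (D.s η) := by
      apply mul_left_cancel₀ D.θ_ne_zero
      linear_combination y * D.s y * D.t y * hη + ρ * y * D.s y * e1 + D.s y * D.s (D.s (D.t ρ)) * hy
        + D.s (D.s (D.t ρ)) * e3 - e2
    refine ⟨D.isUnit_ζ.unit ^ 2, Units.map (D.s : O →* O) η * η * Units.map (D.s : O →* O) y
      * Units.map (D.s : O →* O) (Units.map (D.s : O →* O) y), by simp [D.s_ζ], ?_⟩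
    ext
    simp only [Units.val_mul, Units.val_pow_eq_pow_val, Units.coe_map, MonoidHom.coe_coe, map_mul,
      D.s_s_s, IsUnit.unit_spec]
    linear_combination (y : O) * D.s (D.s y) * D.s η * e4
  have hy3 : y ∈ D.Λ := by
    have := D.Λ.mul_mem hy2 (D.Λ.inv_mem hy1)
    convert this using 1
    rw [eq_mul_inv_iff_mul_eq]
    rw [pow_two]
    ac_rfl
  obtain ⟨ε, v, hε, hv⟩ := hy3
  refine D.s_ne_of_span_eq_P (ρ := ρ * (v⁻¹ : Oˣ)) (ε := ε) ?_ hε ?_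
  · rw [Ideal.span_singleton_mul_right_unit v⁻¹.isUnit, h]
  · rw [map_mul, ← hy]
    have e := congrArg (Units.val) hv
    simp only [Units.val_mul, Units.coe_map, MonoidHom.coe_coe] at e
    have e2 : D.s v * D.s (v⁻¹ : Oˣ) = 1 := by rw [← map_mul, Units.mul_inv, map_one]
    have e3 := Units.mul_inv v
    linear_combination D.s (v⁻¹ : Oˣ) * ρ * (v⁻¹ : Oˣ) * e - ρ * y * D.s (v⁻¹ : Oˣ) * e3 + ε * ρ * (v⁻¹ : Oˣ) * e2

theorem E₀_le {S : Subgroup Oˣ} (h1 : ∀ u : Oˣ, D.s u = u → u ∈ S) (h2 : ∀ u : Oˣ, D.t u = u → u ∈ S)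
    (h3 : ∀ u : Oˣ, u ∈ S → Units.map (D.s : O →* O) u ∈ S) : D.E₀ ≤ S := by
  have hu : ∀ (f : O ≃+* O) (w : O) (u : Oˣ), (u : O) = f w → ∃ w' : Oˣ, (w' : O) = w :=
    fun f w u h => by
      have : IsUnit w := by
        have h4 := u.isUnit.map f.symm
        rwa [h, RingEquiv.symm_apply_apply] at h4
      exact this
  rw [E₀, Subgroup.closure_le]
  rintro u (h | h | ⟨w, hw, h⟩ | ⟨w, hw, h⟩)
  · exact h1 u h
  · exact h2 u h
  · obtain ⟨w, rfl⟩ := hu D.s w u h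
    have e : u = Units.map (D.s : O →* O) w := Units.ext h
    exact e ▸ h3 _ (h2 w hw)
  · obtain ⟨w, rfl⟩ := hu (D.s.trans D.s) w u h
    have e : u = Units.map (D.s : O →* O) (Units.map (D.s : O →* O) w) := Units.ext h
    exact e ▸ h3 _ (h3 _ (h2 w hw))

theorem isUnit_intCast {a : ℤ} (h : IsUnit (a : O)) : a = 1 ∨ a = -1 := by
  obtain ⟨u, hu⟩ := h
  have h1 : (a : O) * (↑u⁻¹ : O) = 1 := by rw [← hu, Units.mul_inv]
  have ha0 : (a : O) ≠ 0 := left_ne_zero_of_mul_eq_one h1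
  have hfix : ∀ f : O ≃+* O, f (↑u⁻¹ : O) = (↑u⁻¹ : O) := fun f => by
    have h2 := congrArg f h1
    rw [map_mul, map_intCast, map_one, ← h1] at h2
    exact mul_left_cancel₀ ha0 h2
  obtain ⟨b, hb⟩ := D.int_of_fixed (hfix D.s) (hfix D.t)
  rw [hb] at h1
  have h3 : a * b = 1 := by exact_mod_cast h1
  exact Int.isUnit_iff.1 (IsUnit.of_mul_eq_one b h3)

theorem fixed_unit_cube {u : O} (hu : IsUnit u) (h : D.s u = u) : u ^ 3 = 1 ∨ u ^ 3 = -1 := by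
  obtain ⟨a, b, rfl⟩ := D.fixed u h
  have h1 : (a + b * D.ζ) * D.t (a + b * D.ζ) = ((a ^ 2 - a * b + b ^ 2 : ℤ) : O) := by
    simp only [map_add, map_mul, map_intCast, D.t_ζ]
    push_cast
    linear_combination (a * b + b ^ 2 * (D.ζ - 1)) * D.ζ_eq
  have h2 := D.isUnit_intCast (h1 ▸ hu.mul (hu.map D.t))
  have h3 : a ^ 2 - a * b + b ^ 2 = 1 := by
    rcases h2 with h2 | h2
    · exact h2
    · nlinarith [sq_nonneg (2 * a - b), sq_nonneg b]
  have hb : b ^ 2 ≤ 1 := by nlinarith [sq_nonneg (2 * a - b)]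
  have ha : a ^ 2 ≤ 1 := by nlinarith [sq_nonneg (2 * b - a)]
  have hb1 : -1 ≤ b ∧ b ≤ 1 := ⟨by nlinarith, by nlinarith⟩
  have ha1 : -1 ≤ a ∧ a ≤ 1 := ⟨by nlinarith, by nlinarith⟩
  obtain ⟨ha1, ha2⟩ := ha1
  obtain ⟨hb1, hb2⟩ := hb1
  have hζ := D.ζ_eq
  clear h1 h2 ha hb h hu
  generalize D.ζ = z at *
  interval_cases a <;> interval_cases b <;> norm_num at h3 <;> norm_num <;> grind

/-- The units whose norm is `1` or `-1`. -/
def normOne : Subgroup Oˣ where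
  carrier := {u | D.N u = 1 ∨ D.N u = -1}
  one_mem' := by simp [N]
  mul_mem' := by
    rintro a b (h | h) (h' | h') <;> simp [D.N_mul, h, h']
  inv_mem' := by
    rintro a h
    have h1 : D.N a * D.N (a⁻¹ : Oˣ) = 1 := by
      rw [← D.N_mul, Units.mul_inv]; simp [N]
    rcases h with h | h <;> rw [h] at h1
    · left; simpa using h1
    · right; linear_combination -h1

theorem mem_normOne {u : Oˣ} : u ∈ D.normOne ↔ D.N u = 1 ∨ D.N u = -1 := Iff.rfl

theorem isUnit_N (u : Oˣ) : IsUnit (D.N u) := by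
  simp only [N]
  exact (u.isUnit.mul (u.isUnit.map D.s)).mul ((u.isUnit.map D.s).map D.s)

theorem E₀_le_normOne : D.E₀ ≤ D.normOne := by
  refine D.E₀_le (fun u h => ?_) (fun u h => ?_) (fun u h => ?_)
  · rw [mem_normOne, D.N_of_fixed h]; exact D.fixed_unit_cube u.isUnit h
  · have h1 : D.t (D.N u) = D.N u := by rw [← D.N_t, h]
    obtain ⟨a, ha⟩ := D.int_of_fixed (D.s_N u) h1
    rw [mem_normOne, ha]
    rcases D.isUnit_intCast (ha ▸ D.isUnit_N u) with h | h <;> simp [h]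
  · rw [mem_normOne] at h ⊢
    rwa [Units.coe_map, MonoidHom.coe_coe, D.N_s]

/-- The class of the prime `P`. -/
noncomputable def cP : ClassGroup O := ClassGroup.mk0 ⟨D.P, mem_nonZeroDivisors_of_ne_zero D.P_ne_bot⟩

/-- The class of the prime `P'`. -/
noncomputable def cP' : ClassGroup O := ClassGroup.mk0 ⟨D.P', mem_nonZeroDivisors_of_ne_zero D.P'_ne_bot⟩

omit D in
theorem mk0_span {x : O} (hx : x ≠ 0) : ClassGroup.mk0 (⟨Ideal.span {x},
    mem_nonZeroDivisors_of_ne_zero (by simpa using hx)⟩ : nonZeroDivisors (Ideal O)) = 1 := by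
  rw [ClassGroup.mk0_eq_one_iff]
  exact ⟨⟨x, rfl⟩⟩

theorem cP_pow : D.cP ^ 3 = 1 := by
  rw [cP, ← map_pow, ← mk0_span D.π_ne_zero]
  congr 1
  exact Subtype.ext D.P_pow

theorem cP_mul_cP' : D.cP * D.cP' = 1 := by
  rw [cP, cP', ← map_mul, ← mk0_span D.θ_ne_zero]
  congr 1
  exact Subtype.ext D.P_mul_P'

theorem cP_eq_one_iff : D.cP = 1 ↔ ∃ ρ, Ideal.span {ρ} = D.P := by
  rw [cP, ClassGroup.mk0_eq_one_iff]
  constructor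
  · rintro ⟨ρ, h⟩
    exact ⟨ρ, h.symm⟩
  · rintro ⟨ρ, h⟩
    exact ⟨⟨ρ, h.symm⟩⟩

theorem class_eq {I : nonZeroDivisors (Ideal O)} {α g : O} (hα : α ≠ 0) (hg : g ≠ 0) {a b : ℕ}
    (h : (I : Ideal O) * Ideal.span {α} = D.P ^ a * (D.P' ^ b * Ideal.span {g})) :
    ClassGroup.mk0 I = D.cP ^ a * D.cP' ^ b := by
  have h1 : ClassGroup.mk0 I * 1 = D.cP ^ a * (D.cP' ^ b * 1) := by
    nth_rw 1 [← mk0_span hα]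
    rw [← mk0_span hg, cP, cP', ← map_pow, ← map_pow, ← map_mul, ← map_mul, ← map_mul]
    congr 1
    exact Subtype.ext h
  simpa using h1

theorem cP_pow_mul (a b : ℕ) : D.cP ^ a * D.cP' ^ b = D.cP ^ (a + 2 * b) := by
  have h : D.cP' = D.cP ^ 2 := by
    rw [← mul_right_inj D.cP, D.cP_mul_cP', ← pow_succ', D.cP_pow]
  rw [h, ← pow_mul, ← pow_add]

theorem principal_of_N (hΛ : D.Λ.index = 3) (hN : ∀ u : Oˣ, u ∈ D.normOne) : D.cP = 1 := by
  obtain ⟨u, hu⟩ : ∃ u, u ∉ D.Λ := by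
    by_contra! h
    rw [(Subgroup.eq_top_iff' _).2 h, Subgroup.index_top] at hΛ
    omega
  wlog hN1 : D.N u = 1 generalizing u
  · refine this (-u) (fun h => hu ?_) ?_
    · have : (-1 : Oˣ) ∈ D.Λ := ⟨-1, 1, by simp, by simp⟩
      simpa using D.Λ.mul_mem this h
    · rw [Units.val_neg, D.N_neg, (hN u).resolve_left hN1, neg_neg]
  obtain ⟨α, hα, e, a, b, g, hg0, hg, -, -, h⟩ := D.exists_mul_span_eq (I := 1) (x := u) (y := 1)
    one_ne_zero one_ne_zero (by rw [hN1]; simp [N]) (by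
      rw [Ideal.one_eq_top, Ideal.map_top, Ideal.span_singleton_one, Ideal.span_singleton_eq_top.2 u.isUnit])
  have h1 := D.class_eq (I := 1) hα hg0 h
  rw [map_one, D.cP_pow_mul] at h1
  by_cases h3 : 3 ∣ a + 2 * b
  · exfalso
    apply hu
    have h4 : ∃ β, β ≠ 0 ∧ (∃ j : ℕ, D.s β = D.ζ ^ j * β) ∧ Ideal.span {β} = Ideal.span {α} := by
      rw [one_mul] at h
      rw [h]
      rcases le_total a b with hab | hab
      · obtain ⟨c, rfl⟩ := Nat.exists_eq_add_of_le hab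
        obtain ⟨c, rfl⟩ : 3 ∣ c := by omega
        refine ⟨D.θ ^ a * (D.t D.π ^ c * g), ?_, ⟨a, ?_⟩, ?_⟩
        · simp [D.θ_ne_zero, D.t_π_ne_zero, hg0, D.π_ne_zero]
        · simp only [map_mul, map_pow, D.s_t_π, hg, D.s_θ]; ring
        · rw [← Ideal.span_singleton_mul_span_singleton, D.span_θ_pow,
            ← Ideal.span_singleton_mul_span_singleton, ← Ideal.span_singleton_pow, ← D.P'_pow,
            ← pow_mul, pow_add]
          ring
      · obtain ⟨c, rfl⟩ := Nat.exists_eq_add_of_le hab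
        obtain ⟨c, rfl⟩ : 3 ∣ c := by omega
        refine ⟨D.θ ^ b * (D.π ^ c * g), ?_, ⟨b, ?_⟩, ?_⟩
        · simp [D.θ_ne_zero, hg0, D.π_ne_zero]
        · simp only [map_mul, map_pow, D.s_π, hg, D.s_θ]; ring
        · rw [← Ideal.span_singleton_mul_span_singleton, D.span_θ_pow,
            ← Ideal.span_singleton_mul_span_singleton, ← Ideal.span_singleton_pow, ← D.P_pow,
            ← pow_mul, pow_add]
          ring
    obtain ⟨β, hβ, ⟨j, hj⟩, hβα⟩ := h4
    obtain ⟨v, hv⟩ := Ideal.span_singleton_eq_span_singleton.1 hβα.symm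
    refine ⟨D.isUnit_ζ.unit ^ (2 * j), v, by simp [D.s_ζ], ?_⟩
    ext
    have e1 := congrArg D.s hv
    rw [map_mul, hj, ← hv] at e1
    simp only [Units.val_mul, Units.val_pow_eq_pow_val, Units.coe_map, MonoidHom.coe_coe,
      IsUnit.unit_spec]
    have e4 : D.s α ≠ 0 := by simpa using hα
    apply mul_left_cancel₀ e4
    have e5 : D.ζ ^ (2 * j) * D.ζ ^ j = 1 := by
      rw [← pow_add, (by ring : 2 * j + j = 3 * j), pow_mul, D.ζ_pow, one_pow]
    linear_combination v * e - D.ζ ^ (2 * j) * e1 - α * v * e5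
  · have h5 := D.cP_pow
    have h6 : Nat.Coprime 3 (a + 2 * b) := (Nat.prime_three.coprime_iff_not_dvd).2 h3
    rw [eq_comm, ← orderOf_dvd_iff_pow_eq_one] at h1
    rw [← orderOf_dvd_iff_pow_eq_one] at h5
    exact orderOf_eq_one_iff.1 (Nat.eq_one_of_dvd_coprimes h6 h5 h1)

theorem normOne_eq_top_iff (hΛ : D.Λ.index = 3) : (∀ u : Oˣ, u ∈ D.normOne) ↔ D.cP = 1 := by
  refine ⟨D.principal_of_N hΛ, fun h u => D.E₀_le_normOne ?_⟩
  obtain ⟨ρ, hρ⟩ := D.cP_eq_one_iff.1 h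
  rw [D.E₀_eq_top_of_principal hΛ hρ]
  trivial

theorem E₀_eq_top_iff (hΛ : D.Λ.index = 3) : D.E₀ = ⊤ ↔ D.cP = 1 := by
  constructor
  · intro h
    refine (D.normOne_eq_top_iff hΛ).1 fun u => D.E₀_le_normOne ?_
    rw [h]
    trivial
  · intro h
    obtain ⟨ρ, hρ⟩ := D.cP_eq_one_iff.1 h
    exact D.E₀_eq_top_of_principal hΛ hρ

theorem cube_cases {ε : O} (h : ε ^ 3 = 1 ∨ ε ^ 3 = -1) :
    ∃ i : ℕ, ε = D.ζ ^ i ∨ ε = - D.ζ ^ i := by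
  rcases h with h | h
  · rcases D.cube_eq_one h with h | h | h
    · exact ⟨0, Or.inl (by simp [h])⟩
    · exact ⟨1, Or.inl (by simp [h])⟩
    · exact ⟨2, Or.inl h⟩
  · have h' : (-ε) ^ 3 = 1 := by linear_combination -h
    rcases D.cube_eq_one h' with h | h | h
    · exact ⟨0, Or.inr (by simp [← h])⟩
    · exact ⟨1, Or.inr (by simp [← h])⟩
    · exact ⟨2, Or.inr (by simp [← h])⟩

theorem exists_unit_N_eq_ζ (hΛ : D.Λ.index = 3) (h : D.cP ≠ 1) : ∃ v : Oˣ, D.N v = D.ζ := by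
  rw [Ne, ← D.normOne_eq_top_iff hΛ] at h
  push Not at h
  obtain ⟨u, hu⟩ := h
  rw [mem_normOne] at hu
  push Not at hu
  have h1 := D.fixed_unit_cube (D.isUnit_N u) (D.s_N u)
  wlog h2 : D.N u ^ 3 = 1 generalizing u
  · refine this (-u) ?_ ?_ ?_
    · rw [Units.val_neg, D.N_neg]
      exact ⟨fun h => hu.2 (by linear_combination -h), fun h => hu.1 (by linear_combination -h)⟩
    · left
      rw [Units.val_neg, D.N_neg]
      linear_combination -(h1.resolve_left h2)
    · rw [Units.val_neg, D.N_neg]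
      linear_combination -(h1.resolve_left h2)
  rcases D.cube_eq_one h2 with h | h | h
  · exact absurd h hu.1
  · exact ⟨u, h⟩
  · refine ⟨u * u, ?_⟩
    rw [Units.val_mul, D.N_mul, h]
    linear_combination D.ζ * D.ζ_pow

end PureCubicRing

theorem AddMonoidHom.index_range_sub_id {A : Type*} [AddCommGroup A] (e : A ≃+ (Fin 2 → ℤ))
    (s : A →+ A) (hs : ∀ x, s (s (s x)) = x) (hN : ∀ x, x + s x + s (s x) = 0) :
    (s - AddMonoidHom.id A).range.index = 3 := by
  refine index_range_of_comp_self_eq e _ s (fun x => ⟨s (s x), hs x⟩) (fun x => ?_)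
    (fun x y h => by rw [← hs x, h, hs])
  have := hN x
  simp only [AddMonoidHom.sub_apply, AddMonoidHom.id_apply, map_sub]
  rw [eq_neg_iff_add_eq_zero, ← this]
  abel

theorem MonoidHom.index_eq_three {A : Type*} [CommGroup A] (e : Additive A ≃+ (Fin 2 → ℤ))
    (s : A →* A) (hs : ∀ x, s (s (s x)) = x) (hN : ∀ x, x * s x * s (s x) = 1)
    {H : Subgroup A} (hH : ∀ y, y ∈ H ↔ ∃ x, s x = y * x) : H.index = 3 := by
  have h : H = (s / MonoidHom.id A).range := by
    ext y
    rw [hH, MonoidHom.mem_range]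
    simp only [MonoidHom.div_apply, MonoidHom.id_apply, div_eq_iff_eq_mul]
  rw [h]
  exact AddMonoidHom.index_range_sub_id e s.toAdditive hs hN

namespace PureCubicRing

set_option linter.unusedSectionVars false

variable {O : Type*} [CommRing O] [IsDedekindDomain O] [CharZero O]
  {p : ℕ} [hp : Fact p.Prime] (D : PureCubicRing O p)

include D

theorem index_Λ_eq_three {T : Subgroup Oˣ} (hT : ∀ u, u ∈ T ↔ D.s u = u)
    (e : Additive (Oˣ ⧸ T) ≃+ (Fin 2 → ℤ)) : D.Λ.index = 3 := by
  set S : Oˣ →* Oˣ := Units.map (D.s : O →* O) with hS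
  have hS3 : ∀ u, S (S (S u)) = u := fun u => Units.ext (D.s_s_s u)
  have hTS : T ≤ T.comap S := fun u hu => by
    rw [Subgroup.mem_comap, hT] at *
    exact congrArg D.s hu
  let σ : Oˣ ⧸ T →* Oˣ ⧸ T := QuotientGroup.map T T S hTS
  have hσ : ∀ u : Oˣ, σ u = S u := fun u => rfl
  have hσ3 : ∀ x, σ (σ (σ x)) = x := fun x => by
    obtain ⟨u, rfl⟩ := QuotientGroup.mk_surjective x
    rw [hσ, hσ, hσ, hS3]
  have hσN : ∀ x, x * σ x * σ (σ x) = 1 := fun x => by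
    obtain ⟨u, rfl⟩ := QuotientGroup.mk_surjective x
    rw [hσ, hσ, ← QuotientGroup.mk_mul, ← QuotientGroup.mk_mul, QuotientGroup.eq_one_iff, hT]
    exact D.s_N u
  have hker : (QuotientGroup.mk' T).ker ≤ D.Λ := by
    rw [QuotientGroup.ker_mk']
    exact fun u hu => ⟨u, 1, (hT u).1 hu, by simp⟩
  rw [← Subgroup.index_map_eq _ (QuotientGroup.mk'_surjective T) hker]
  refine MonoidHom.index_eq_three (A := Oˣ ⧸ T) e σ hσ3 hσN fun y => ?_
  rw [Subgroup.mem_map]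
  constructor
  · rintro ⟨u, ⟨ε, v, h1, h2⟩, rfl⟩
    refine ⟨v, ?_⟩
    change σ v = (u : Oˣ ⧸ T) * v
    rw [hσ, ← QuotientGroup.mk_mul, h2, QuotientGroup.mk_mul,
      (QuotientGroup.eq_one_iff ε).2 ((hT ε).2 h1)]
    exact (one_mul (S v : Oˣ ⧸ T)).symm
  · rintro ⟨x, hx⟩
    obtain ⟨v, rfl⟩ := QuotientGroup.mk_surjective x
    obtain ⟨u, rfl⟩ := QuotientGroup.mk_surjective y
    rw [hσ, ← QuotientGroup.mk_mul, QuotientGroup.eq, hT] at hx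
    exact ⟨u, ⟨(S v)⁻¹ * (u * v), v, hx, by rw [mul_right_comm, inv_mul_cancel, one_mul]⟩, rfl⟩

end PureCubicRing

namespace PureCubicRing

set_option linter.unusedSectionVars false

variable {O : Type*} [CommRing O] [IsDedekindDomain O] [CharZero O]
  {p : ℕ} [hp : Fact p.Prime] (D : PureCubicRing O p)

include D

theorem exists_span_eq {x : O} (hx : x ≠ 0) {u : O} (hu : IsUnit u) (hs : D.s x = u * x) :
    ∃ a b, ∃ g ≠ 0, D.s g = g ∧ g ∉ D.P ∧ g ∉ D.P' ∧
      Ideal.span {x} = D.P ^ a * (D.P' ^ b * Ideal.span {g}) := by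
  refine D.exists_eq_of_map_s (by simpa using hx) ?_
  rw [Ideal.map_span, Set.image_singleton, hs, Ideal.span_singleton_eq_span_singleton]
  exact (associated_isUnit_mul_left_iff hu).2 (Associated.refl _) 

theorem not_P_dvd_span {g : O} (h : g ∉ D.P) : ¬ D.P ∣ Ideal.span {g} := fun h' =>
  h (Ideal.dvd_span_singleton.1 h')

theorem three_dvd_of_pow {e : ℕ} {k m : ℤ} (hk : k ≠ 0) {u : O} (hu : IsUnit u)
    (h : D.θ ^ e * k = m * u) : 3 ∣ e := by
  have hk' : (k : O) ≠ 0 := Int.cast_ne_zero.2 hk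
  have hm : (m : O) ≠ 0 := fun h0 => mul_ne_zero (pow_ne_zero e D.θ_ne_zero) hk' (by
    rw [h, h0, zero_mul])
  have h1 : (p : O) ^ e * k ^ 3 = m ^ 3 * u ^ 3 := by
    rw [← mul_pow, ← h, ← D.θ_pow]; ring
  have hfix (f : O ≃+* O) : f (u ^ 3) = u ^ 3 := by
    have h2 := congrArg f h1
    rw [map_mul, map_mul, map_pow, map_pow, map_pow, map_natCast, map_intCast, map_intCast, h1] at h2
    exact (mul_left_cancel₀ (pow_ne_zero 3 hm) h2).symm
  obtain ⟨c, hc⟩ := D.int_of_fixed (hfix D.s) (hfix D.t)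
  have hc1 : c = 1 ∨ c = -1 := D.isUnit_intCast (by rw [← hc]; exact hu.pow 3)
  rw [hc] at h1
  have h2 : (p : ℤ) ^ e * k ^ 3 = m ^ 3 * c := by exact_mod_cast h1
  have hm0 : m ≠ 0 := by rintro rfl; exact hm (by simp)
  have h3 : p ^ e * k.natAbs ^ 3 = m.natAbs ^ 3 := by
    have := congrArg Int.natAbs h2
    rcases hc1 with rfl | rfl <;> simpa [Int.natAbs_mul, Int.natAbs_pow] using this
  have h4 := congrArg (padicValNat p) h3
  rw [padicValNat.mul (pow_ne_zero _ hp.out.ne_zero) (pow_ne_zero _ (Int.natAbs_ne_zero.2 hk)),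
    padicValNat.prime_pow, padicValNat.pow, padicValNat.pow] at h4
  omega

theorem mem_P'_of_t {g : O} (h : D.t g ∈ D.P) : g ∈ D.P' := by
  rw [← D.t_t g, ← D.map_t_P]
  exact Ideal.mem_map_of_mem _ h

theorem t_fixed_of_mul {x y z : O} (hy : y ≠ 0) (h : x = y * z) (hx : D.t x = x) (hy' : D.t y = y) :
    D.t z = z := by
  rw [h, map_mul, hy'] at hx
  exact mul_left_cancel₀ hy hx

theorem exists_of_s_t {x : O} (hx : x ≠ 0) {u : O} (hu : IsUnit u) (hs : D.s x = u * x)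
    (ht : D.t x = x) : ∃ a : ℕ, ∃ r : ℤ, ∃ v : Oˣ, x = D.θ ^ a * r * v ∧ D.t v = v := by
  obtain ⟨a, b, g, hg0, hsg, hgP, hgP', e⟩ := D.exists_span_eq hx hu hs
  have e' := congrArg (Ideal.map D.t) e
  rw [Ideal.map_span, Set.image_singleton, ht, Ideal.map_mul, Ideal.map_mul, Ideal.map_pow,
    Ideal.map_pow, D.map_t_P, D.map_t_P', Ideal.map_span, Set.image_singleton, e,
    mul_left_comm (D.P' ^ a)] at e'
  obtain ⟨rfl, -⟩ := pow_mul_inj D.prime_P (D.not_P_dvd_mul (D.not_P_dvd_span hgP) _)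
    (D.not_P_dvd_mul (D.not_P_dvd_span (fun h => hgP' (D.mem_P'_of_t h))) _) e'
  rw [← mul_assoc, ← mul_pow, D.P_mul_P', Ideal.span_singleton_pow,
    Ideal.span_singleton_mul_span_singleton, Ideal.span_singleton_eq_span_singleton] at e
  obtain ⟨w, hw⟩ := e.symm
  have hθ0 := pow_ne_zero a D.θ_ne_zero
  set y := g * w with hy
  have hxy : x = D.θ ^ a * y := by rw [← hw, hy, mul_assoc]
  have hty : D.t y = y := D.t_fixed_of_mul hθ0 hxy ht (by rw [map_pow, D.t_θ])
  -- normalise `g`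
  have hε : D.t g * D.t w = g * w := by rw [← map_mul]; exact hty
  obtain ⟨ε, hεu, htg⟩ : ∃ ε, IsUnit ε ∧ D.t g = ε * g := by
    obtain ⟨w', hw'⟩ := w.isUnit.map D.t
    refine ⟨w * ↑w'⁻¹, w.isUnit.mul (Units.isUnit _), ?_⟩
    have : (w' : O) * (↑w'⁻¹ : O) = 1 := Units.mul_inv w'
    rw [← hw'] at hε
    linear_combination (↑w'⁻¹ : O) * hε - D.t g * this
  have hsε : D.s ε = ε := by
    have h1 : D.s (D.t g) = D.t g := by
      rw [← D.t_s_s, hsg, hsg]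
    rw [htg, map_mul, hsg] at h1
    exact mul_right_cancel₀ hg0 h1
  have key : ∃ v : Oˣ, ∃ g', D.s g' = g' ∧ (D.t g' = g' ∨ D.t g' = -g') ∧ y = g' * v := by
    obtain ⟨z, hz⟩ := D.isUnit_ζ
    have hz3 : (z : O) ^ 3 = 1 := by rw [hz, D.ζ_pow]
    obtain ⟨i, hi⟩ := D.cube_cases (D.fixed_unit_cube hεu hsε)
    have hz3i : ((z : O) ^ i) ^ 3 = 1 := by rw [← pow_mul, mul_comm, pow_mul, hz3, one_pow]
    refine ⟨w * z ^ i, g * (z ^ i) ^ 2, ?_, ?_, ?_⟩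
    · rw [hz]; simp only [map_mul, map_pow, hsg, D.s_ζ]
    · simp only [map_mul, map_pow, htg, hz, D.t_ζ] at hi ⊢
      rw [← hz] at hi ⊢
      rw [← pow_mul _ 2 i, mul_comm 2 i, pow_mul]
      generalize (z : O) ^ i = q at *
      refine hi.imp (fun h => ?_) (fun h => ?_) <;> rw [h]
      · linear_combination q ^ 2 * g * hz3i
      · linear_combination -q ^ 2 * g * hz3i
    · rw [hy]; push_cast
      linear_combination (-g * w) * hz3i
  obtain ⟨v, g', hs', ht' | ht', hyv⟩ := key
  · obtain ⟨r, hr⟩ := D.int_of_fixed hs' ht'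
    refine ⟨a, r, v, by rw [hxy, hyv, hr, mul_assoc], ?_⟩
    refine D.t_fixed_of_mul ?_ hyv hty ht'
    rintro rfl
    exact hx (by rw [hxy, hyv, zero_mul, mul_zero])
  · exfalso
    have hg' : g' ≠ 0 := by
      rintro rfl
      exact hx (by rw [hxy, hyv, zero_mul, mul_zero])
    set δ : O := 1 + 2 * D.ζ with hδ
    have hsδ : D.s δ = δ := by simp only [hδ, map_add, map_mul, map_one, map_ofNat, D.s_ζ]
    have htδ : D.t δ = -δ := by
      simp only [hδ, map_add, map_mul, map_one, map_ofNat, D.t_ζ]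
      linear_combination 2 * D.ζ_eq
    have hδ2 : δ ^ 2 = -3 := by rw [hδ]; linear_combination 4 * D.ζ_eq
    have hδ0 : δ ≠ 0 := by
      intro h
      rw [h] at hδ2
      norm_num at hδ2
    obtain ⟨m, hm⟩ := D.int_of_fixed (x := δ * g') (by rw [map_mul, hsδ, hs'])
      (by rw [map_mul, htδ, ht', neg_mul_neg])
    obtain ⟨n, hn⟩ := D.int_of_fixed (D.s_N y) (by rw [← D.N_t, hty])
    have h1 : D.N y = g' ^ 3 * D.N v := by rw [hyv, D.N_mul, D.N_of_fixed hs']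
    obtain ⟨c, hc, hc0⟩ : ∃ c : ℤ, D.N v ^ 3 = c ∧ c ≠ 0 := by
      rcases D.fixed_unit_cube (D.isUnit_N v) (D.s_N v) with h | h
      · exact ⟨1, by rw [h]; simp, by norm_num⟩
      · exact ⟨-1, by rw [h]; simp, by norm_num⟩
    have h2 : δ ^ 9 * n ^ 3 = m ^ 9 * c := by
      rw [← hn, h1, ← hm, ← hc]; ring
    have h3 := congrArg D.t h2
    simp only [map_mul, map_pow, htδ, map_intCast] at h3
    have h4 : (m : O) ^ 9 * c = 0 := by
      have : (2 : O) * (m ^ 9 * c) = 0 := by linear_combination -h2 - h3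
      exact (mul_eq_zero.1 this).resolve_left two_ne_zero
    rw [← hm] at h4
    exact mul_ne_zero (pow_ne_zero 9 (mul_ne_zero hδ0 hg')) (Int.cast_ne_zero.2 hc0) h4

theorem exists_span_eq_of_norm {x : O} (hx : x ≠ 0) {u : O} (hu : IsUnit u) (hs : D.s x = u * x)
    {m n : ℤ} {v : O} (hm : m ≠ 0) (hv : IsUnit v) (h : (m : O) * (x * D.t x) = n * v) :
    ∃ a b c, a + b = 3 * c ∧ ∃ g ≠ 0, D.s g = g ∧
      Ideal.span {x} = D.P ^ a * (D.P' ^ b * Ideal.span {g}) := by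
  obtain ⟨a, b, g, hg0, hsg, -, -, e⟩ := D.exists_span_eq hx hu hs
  have e' := congrArg (Ideal.map D.t) e
  rw [Ideal.map_span, Set.image_singleton, Ideal.map_mul, Ideal.map_mul, Ideal.map_pow,
    Ideal.map_pow, D.map_t_P, D.map_t_P', Ideal.map_span, Set.image_singleton] at e'
  have e₂ : Ideal.span {x * D.t x} = Ideal.span {D.θ ^ (a + b) * (g * D.t g)} := by
    rw [← Ideal.span_singleton_mul_span_singleton, e, e', ← Ideal.span_singleton_mul_span_singleton,
      ← Ideal.span_singleton_mul_span_singleton, ← Ideal.span_singleton_pow, ← D.P_mul_P']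
    ring
  obtain ⟨k, hk⟩ := D.int_mul_t hsg
  have hk0 : k ≠ 0 := by
    rintro rfl
    rw [Int.cast_zero] at hk
    exact mul_ne_zero hg0 (by simpa using hg0) hk
  rw [Ideal.span_singleton_eq_span_singleton, hk] at e₂
  obtain ⟨w, hw⟩ := e₂
  obtain ⟨c, hc⟩ := D.three_dvd_of_pow (e := a + b) (k := m * k) (m := n) (u := v * w)
    (mul_ne_zero hm hk0) (hv.mul w.isUnit) (by
      push_cast
      linear_combination -(m : O) * hw + w * h)
  exact ⟨a, b, c, hc, g, hg0, hsg, e⟩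

theorem exists_fixed_of_cP_ne {x : O} (hx : x ≠ 0) {u : O} (hu : IsUnit u) (hs : D.s x = u * x)
    {m n : ℤ} {v : O} (hm : m ≠ 0) (hv : IsUnit v) (h : (m : O) * (x * D.t x) = n * v)
    (hP : D.cP ≠ 1) : ∃ y ≠ 0, D.s y = y ∧ ∃ w : Oˣ, x = y * w := by
  obtain ⟨a, b, c, hc, g, hg0, hsg, e⟩ := D.exists_span_eq_of_norm hx hu hs hm hv h
  have h1 : D.cP ^ a * D.cP' ^ b = 1 := by
    have h2 : ClassGroup.mk0 (⟨Ideal.span {x}, mem_nonZeroDivisors_of_ne_zero (by simpa using hx)⟩ :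
        nonZeroDivisors (Ideal O)) = D.cP ^ a * (D.cP' ^ b * ClassGroup.mk0 ⟨Ideal.span {g},
        mem_nonZeroDivisors_of_ne_zero (by simpa using hg0)⟩) := by
      rw [cP, cP', ← map_pow, ← map_pow, ← map_mul, ← map_mul]
      congr 1
      exact Subtype.ext e
    rw [mk0_span hx, mk0_span hg0, mul_one] at h2
    exact h2.symm
  rw [D.cP_pow_mul] at h1
  have h2 : 3 ∣ a + 2 * b := by
    rw [← orderOf_eq_prime D.cP_pow hP]
    exact orderOf_dvd_of_pow_eq_one h1
  obtain ⟨i, rfl⟩ : 3 ∣ a := by omega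
  obtain ⟨j, rfl⟩ : 3 ∣ b := by omega
  rw [← D.span_pow_mul, Ideal.span_singleton_eq_span_singleton] at e
  obtain ⟨w, hw⟩ := e.symm
  exact ⟨_, mul_ne_zero (mul_ne_zero (pow_ne_zero _ D.π_ne_zero) (pow_ne_zero _ D.t_π_ne_zero)) hg0,
    by simp only [map_mul, map_pow, D.s_π, D.s_t_π, hsg], w, hw.symm⟩

theorem span_t_eq_P' {ρ : O} (hρ : Ideal.span {ρ} = D.P) : Ideal.span {D.t ρ} = D.P' := by
  rw [← D.map_t_P, ← hρ, Ideal.map_span, Set.image_singleton]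

theorem exists_fixed_of_span_eq_P {x : O} (hx : x ≠ 0) {u : O} (hu : IsUnit u)
    (hs : D.s x = u * x)
    {m n : ℤ} {v : O} (hm : m ≠ 0) (hv : IsUnit v) (h : (m : O) * (x * D.t x) = n * v)
    {ρ : O} (hρ : Ideal.span {ρ} = D.P) :
    ∃ a : ℕ, ∃ y ≠ 0, D.s y = y ∧ ∃ w : Oˣ, x * D.t ρ ^ a = ρ ^ a * (y * w) := by
  obtain ⟨a, b, c, hc, g, hg0, hsg, e⟩ := D.exists_span_eq_of_norm hx hu hs hm hv h
  have h1 : Ideal.span {x * D.t ρ ^ a} = Ideal.span {ρ ^ a * (D.t D.π ^ c * g)} := by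
    simp only [← Ideal.span_singleton_mul_span_singleton, ← Ideal.span_singleton_pow, hρ,
      D.span_t_eq_P' hρ, ← D.P'_pow, ← pow_mul, e, ← hc, pow_add]
    ring
  rw [Ideal.span_singleton_eq_span_singleton] at h1
  obtain ⟨w, hw⟩ := h1.symm
  exact ⟨a, _, mul_ne_zero (pow_ne_zero c D.t_π_ne_zero) hg0,
    by simp only [map_mul, map_pow, D.s_t_π, hsg], w, by rw [← hw]; ring⟩

theorem ρ_mul_ne {ρ : O} (hρ : Ideal.span {ρ} = D.P) {n : ℤ} (hn : n ≠ 0) {y : O}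
    (hy : D.s y = y) (w : Oˣ) : ρ * n ≠ D.t ρ * (y * w) := by
  intro e
  have hρ0 : ρ ≠ 0 := by
    intro h0
    rw [h0] at hρ
    exact D.P_ne_bot (by rw [← hρ]; simp)
  have hn0 : (n : O) ≠ 0 := Int.cast_ne_zero.2 hn
  have hy0 : y ≠ 0 := by
    intro h0
    rw [h0, zero_mul, mul_zero] at e
    exact mul_ne_zero hρ0 hn0 e
  obtain ⟨c, d, g, -, h1, h1', h⟩ := D.exists_eq_pow_mul hn0 (map_intCast D.s n)
  obtain ⟨c', d', g', -, h2, h2', h'⟩ := D.exists_eq_pow_mul hy0 hy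
  have h3 : D.P * Ideal.span {(n : O)} = D.P' * Ideal.span {y} := by
    rw [← hρ, ← D.span_t_eq_P' hρ, Ideal.span_singleton_mul_span_singleton,
      Ideal.span_singleton_mul_span_singleton, e, Ideal.span_singleton_eq_span_singleton,
      ← mul_assoc]
    exact associated_mul_unit_left _ _ w.isUnit
  rw [h, h', D.span_pow_mul, D.span_pow_mul] at h3
  have h4 : ¬ D.P ∣ D.P' ^ (3 * d' + 1) * Ideal.span {g'} :=
    D.not_P_dvd_mul (D.not_P_dvd_span h2) _
  have h5 : D.P ^ (3 * c + 1) * (D.P' ^ (3 * d) * Ideal.span {g}) =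
      D.P ^ (3 * c') * (D.P' ^ (3 * d' + 1) * Ideal.span {g'}) := by
    rw [pow_succ', mul_assoc, h3, pow_succ', mul_left_comm, mul_assoc]
  have h6 := (pow_mul_inj D.prime_P (D.not_P_dvd_mul (D.not_P_dvd_span h1) _) h4 h5).1
  clear * - h6
  omega

theorem s_ρ {ρ : O} (hρ : Ideal.span {ρ} = D.P) : ∃ u : Oˣ, D.s ρ = u * ρ := by
  have h : Ideal.span {D.s ρ} = Ideal.span {ρ} := by
    conv_rhs => rw [hρ, ← D.map_s_P, ← hρ, Ideal.map_span, Set.image_singleton]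
  rw [Ideal.span_singleton_eq_span_singleton] at h
  obtain ⟨u, hu⟩ := h.symm
  exact ⟨u, by rw [← hu, mul_comm]⟩

theorem ρ_pow {ρ : O} (hρ : Ideal.span {ρ} = D.P) : ∃ u : Oˣ, ρ ^ 3 = u * D.π := by
  have h : Ideal.span {ρ ^ 3} = Ideal.span {D.π} := by
    rw [← Ideal.span_singleton_pow, hρ, D.P_pow]
  rw [Ideal.span_singleton_eq_span_singleton] at h
  obtain ⟨u, hu⟩ := h.symm
  exact ⟨u, by rw [← hu, mul_comm]⟩

end PureCubicRing

open scoped nonZeroDivisors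

section ClassMap

variable {A B C : Type*} [CommRing A] [IsDedekindDomain A] [CommRing B] [IsDedekindDomain B]
  [CommRing C] [IsDedekindDomain C]

open Classical in
/-- The class of an ideal, with the zero ideal sent to the trivial class. -/
noncomputable def idealClass (I : Ideal A) : ClassGroup A :=
  if h : I = ⊥ then 1 else ClassGroup.mk0 ⟨I, mem_nonZeroDivisors_of_ne_zero h⟩

theorem idealClass_of_ne_bot {I : Ideal A} (h : I ≠ ⊥) :
    idealClass I = ClassGroup.mk0 ⟨I, mem_nonZeroDivisors_of_ne_zero h⟩ := dif_neg h

theorem exists_idealClass_eq (c : ClassGroup A) : ∃ I ≠ ⊥, idealClass I = c := by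
  obtain ⟨I, rfl⟩ := ClassGroup.mk0_surjective c
  have h : (I : Ideal A) ≠ ⊥ := nonZeroDivisors.ne_zero I.2
  exact ⟨I, h, idealClass_of_ne_bot h⟩

theorem idealClass_mul {I J : Ideal A} (hI : I ≠ ⊥) (hJ : J ≠ ⊥) :
    idealClass (I * J) = idealClass I * idealClass J := by
  rw [idealClass_of_ne_bot hI, idealClass_of_ne_bot hJ, idealClass_of_ne_bot (mul_ne_zero hI hJ),
    ← map_mul]
  rfl

theorem idealClass_one : idealClass (1 : Ideal A) = 1 := by
  rw [idealClass_of_ne_bot one_ne_zero]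
  exact map_one ClassGroup.mk0

theorem idealClass_pow {I : Ideal A} (hI : I ≠ ⊥) (n : ℕ) :
    idealClass (I ^ n) = idealClass I ^ n := by
  induction n with
  | zero => rw [pow_zero, pow_zero, idealClass_one]
  | succ n ih => rw [pow_succ, idealClass_mul (pow_ne_zero _ hI) hI, ih, pow_succ]

theorem idealClass_eq_one_iff {I : Ideal A} (hI : I ≠ ⊥) :
    idealClass I = 1 ↔ ∃ x, I = Ideal.span {x} := by
  rw [idealClass_of_ne_bot hI, ClassGroup.mk0_eq_one_iff]
  exact ⟨fun h => h.principal, fun h => ⟨h⟩⟩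

theorem idealClass_span {x : A} (hx : x ≠ 0) : idealClass (Ideal.span {x}) = 1 :=
  (idealClass_eq_one_iff (by simpa using hx)).2 ⟨x, rfl⟩

theorem idealClass_eq_iff {I J : Ideal A} (hI : I ≠ ⊥) (hJ : J ≠ ⊥) :
    idealClass I = idealClass J ↔
      ∃ x ≠ 0, ∃ y ≠ 0, I * Ideal.span {x} = J * Ideal.span {y} := by
  rw [idealClass_of_ne_bot hI, idealClass_of_ne_bot hJ, ClassGroup.mk0_eq_mk0_iff]
  constructor
  · rintro ⟨x, y, hx, hy, h⟩
    exact ⟨x, hx, y, hy, by rw [mul_comm, mul_comm J]; exact h⟩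
  · rintro ⟨x, hx, y, hy, h⟩
    exact ⟨x, y, hx, hy, by rw [mul_comm I, mul_comm J] at h; exact h⟩

/-- The homomorphism of class groups induced by an injective ring homomorphism. -/
noncomputable def classMap (f : A →+* B) (hf : Function.Injective f) :
    ClassGroup A →* ClassGroup B :=
  letI := f.toAlgebra
  have : Module.IsTorsionFree A B := Module.isTorsionFree_iff_algebraMap_injective.2 hf
  ClassGroup.extendedHom A B

theorem classMap_idealClass {f : A →+* B} (hf : Function.Injective f) (I : Ideal A) :
    classMap f hf (idealClass I) = idealClass (I.map f) := by
  by_cases h : I = ⊥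
  · rw [h, Ideal.map_bot, idealClass, idealClass, dif_pos rfl, dif_pos rfl, map_one]
  · letI := f.toAlgebra
    have : Module.IsTorsionFree A B := Module.isTorsionFree_iff_algebraMap_injective.2 hf
    rw [idealClass_of_ne_bot h,
      idealClass_of_ne_bot (fun h' => h ((Ideal.map_eq_bot_iff_of_injective hf).1 h'))]
    exact ClassGroup.extendedHom_mk0 A B _

end ClassMap

namespace PureCubicRing

set_option linter.unusedSectionVars false

variable {O : Type*} [CommRing O] [IsDedekindDomain O] [CharZero O]
  {p : ℕ} [hp : Fact p.Prime] (D : PureCubicRing O p)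

include D

/-- The action of `s` on ideal classes. -/
noncomputable def sC : ClassGroup O →* ClassGroup O := classMap (D.s : O →+* O) D.s.injective

/-- The action of `t` on ideal classes. -/
noncomputable def tC : ClassGroup O →* ClassGroup O := classMap (D.t : O →+* O) D.t.injective

theorem sC_idealClass (I : Ideal O) : D.sC (idealClass I) = idealClass (I.map D.s) :=
  classMap_idealClass _ _

theorem tC_idealClass (I : Ideal O) : D.tC (idealClass I) = idealClass (I.map D.t) :=
  classMap_idealClass _ _

theorem tC_sC (c : ClassGroup O) : D.tC (D.sC c) = D.sC (D.sC (D.tC c)) := by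
  obtain ⟨I, hI, rfl⟩ := exists_idealClass_eq c
  rw [sC_idealClass, tC_idealClass, tC_idealClass, sC_idealClass, sC_idealClass, D.map_t_s]

theorem NI_ne_bot {I : Ideal O} (hI : I ≠ ⊥) : D.NI I ≠ ⊥ :=
  mul_ne_zero (mul_ne_zero hI (D.map_s_ne_bot hI)) (D.map_s_ne_bot (D.map_s_ne_bot hI))

theorem NI_map_s (I : Ideal O) : D.NI (I.map D.s) = D.NI I := by
  simp only [NI, D.map_s_s_s]; ring

theorem mul_sC_mul_sC (c : ClassGroup O) : c * D.sC c * D.sC (D.sC c) = 1 := by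
  obtain ⟨I, hI, rfl⟩ := exists_idealClass_eq c
  obtain ⟨g, hg, -, e⟩ := D.exists_NI_eq hI
  rw [sC_idealClass, sC_idealClass, ← idealClass_mul hI (D.map_s_ne_bot hI),
    ← idealClass_mul (mul_ne_zero hI (D.map_s_ne_bot hI)) (D.map_s_ne_bot (D.map_s_ne_bot hI))]
  change idealClass (D.NI I) = 1
  rw [e, idealClass_span hg]

theorem idealClass_P : idealClass D.P = D.cP := idealClass_of_ne_bot D.P_ne_bot

theorem idealClass_P' : idealClass D.P' = D.cP' := idealClass_of_ne_bot D.P'_ne_bot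

theorem tC_cP : D.tC D.cP = D.cP' := by
  rw [← idealClass_P, tC_idealClass, D.map_t_P, idealClass_P']

/-- The unit `ζ ^ i` measuring by how much a fixed ideal class fails to be generated by an
invariant ideal. -/
def Amb (c : ClassGroup O) (i : ℕ) : Prop :=
  ∃ I ≠ ⊥, ∃ x ≠ 0, ∃ y ≠ 0, idealClass I = c ∧
    I.map D.s * Ideal.span {y} = I * Ideal.span {x} ∧ D.N x = D.ζ ^ i * D.N y

/-- Fixed generators of the same ideal differ by a sixth root of unity. -/
theorem exists_eq_of_span_eq {A B : O} (hA : D.s A = A) (hB : D.s B = B) (h0 : B ≠ 0)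
    (h : Ideal.span {A} = Ideal.span {B}) : ∃ i, A = D.ζ ^ i * B ∨ A = - (D.ζ ^ i * B) := by
  obtain ⟨u, hu⟩ := Ideal.span_singleton_eq_span_singleton.1 h.symm
  have hs : D.s u = u := by
    have := congrArg D.s hu
    rw [map_mul, hA, hB, ← hu] at this
    exact mul_left_cancel₀ h0 this
  obtain ⟨i, h | h⟩ := D.cube_cases (D.fixed_unit_cube u.isUnit hs)
  · exact ⟨i, Or.inl (by rw [← hu, h, mul_comm])⟩
  · exact ⟨i, Or.inr (by rw [← hu, h]; ring)⟩

theorem exists_Amb {c : ClassGroup O} (hc : D.sC c = c) : ∃ i, D.Amb c i := by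
  obtain ⟨I, hI, rfl⟩ := exists_idealClass_eq c
  rw [sC_idealClass, idealClass_eq_iff (D.map_s_ne_bot hI) hI] at hc
  obtain ⟨y, hy, x, hx, h⟩ := hc
  have h1 := congrArg D.NI h
  rw [D.NI_mul, D.NI_mul, D.NI_map_s, D.NI_span, D.NI_span] at h1
  have h2 := mul_left_cancel₀ (D.NI_ne_bot hI) h1
  obtain ⟨i, h3 | h3⟩ := D.exists_eq_of_span_eq (D.s_N x) (D.s_N y) (D.N_ne_zero hy) h2.symm
  · exact ⟨i, I, hI, x, hx, y, hy, rfl, h, h3⟩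
  · refine ⟨i, I, hI, -x, neg_ne_zero.2 hx, y, hy, rfl, ?_, ?_⟩
    · rw [Ideal.span_singleton_neg, h]
    · rw [D.N_neg, h3, neg_neg]

variable {D}

theorem Amb.mul {c c' : ClassGroup O} {i j : ℕ} (h : D.Amb c i) (h' : D.Amb c' j) :
    D.Amb (c * c') (i + j) := by
  obtain ⟨I, hI, x, hx, y, hy, rfl, e, hN⟩ := h
  obtain ⟨J, hJ, a, ha, b, hb, rfl, e', hN'⟩ := h'
  refine ⟨I * J, mul_ne_zero hI hJ, x * a, mul_ne_zero hx ha, y * b, mul_ne_zero hy hb,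
    idealClass_mul hI hJ, ?_, ?_⟩
  · rw [Ideal.map_mul, ← Ideal.span_singleton_mul_span_singleton,
      ← Ideal.span_singleton_mul_span_singleton, mul_mul_mul_comm, e, e', mul_mul_mul_comm]
  · rw [D.N_mul, D.N_mul, hN, hN']; ring

theorem Amb.pow {c : ClassGroup O} {i : ℕ} (h : D.Amb c i) (n : ℕ) :
    D.Amb (c ^ (n + 1)) (i * (n + 1)) := by
  induction n with
  | zero => simpa using h
  | succ n ih => rw [pow_succ, mul_add_one]; exact ih.mul h

theorem Amb.tC {c : ClassGroup O} {i : ℕ} (h : D.Amb c i) : D.Amb (D.tC c) i := by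
  obtain ⟨I, hI, x, hx, y, hy, rfl, e, hN⟩ := h
  refine ⟨I.map D.t, D.map_t_ne_bot hI, D.s (D.t y), by simpa using hy, D.s (D.t x),
    by simpa using hx, (D.tC_idealClass I).symm, ?_, ?_⟩
  · have := congrArg (fun J => (J.map D.t).map D.s) e
    simp only [Ideal.map_mul, Ideal.map_span, Set.image_singleton] at this
    rw [D.map_t_s, D.map_s_s_s] at this
    exact this.symm
  · rw [D.N_s, D.N_s, D.N_t, D.N_t, hN, map_mul, map_pow, D.t_ζ]
    linear_combination (-D.t (D.N y)) * congrArg (· ^ i) D.ζ_pow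

theorem Amb.congr {c : ClassGroup O} {i j : ℕ} (h : D.Amb c i) (hij : D.ζ ^ i = D.ζ ^ j) :
    D.Amb c j := by
  rwa [Amb, hij] at h

theorem Amb.mem_zpowers {c : ClassGroup O} (h : D.Amb c 0) : ∃ k : ℕ, c = D.cP ^ k := by
  obtain ⟨I, hI, x, hx, y, hy, rfl, e, hN⟩ := h
  rw [pow_zero, one_mul] at hN
  obtain ⟨α, hα, -, a, b, g, hg, -, -, -, h⟩ := D.exists_mul_span_eq hI hy hN e
  refine ⟨a + 2 * b, ?_⟩
  rw [idealClass_of_ne_bot hI, ← D.cP_pow_mul]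
  exact D.class_eq (I := ⟨I, mem_nonZeroDivisors_of_ne_zero hI⟩) hα hg h

theorem Amb.zero_of_unit {c : ClassGroup O} {i : ℕ} (h : D.Amb c i) {v : Oˣ}
    (hv : D.N v = D.ζ) : D.Amb c 0 := by
  obtain ⟨I, hI, x, hx, y, hy, rfl, e, hN⟩ := h
  refine ⟨I, hI, x, hx, y * ((v ^ i : Oˣ) : O), mul_ne_zero hy (v ^ i).ne_zero, rfl, ?_, ?_⟩
  · rw [Ideal.span_singleton_mul_right_unit (v ^ i).isUnit, e]
  · rw [hN, D.N_mul]
    have : ∀ i : ℕ, D.N ((v ^ i : Oˣ) : O) = D.ζ ^ i := fun i => by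
      rw [Units.val_pow_eq_pow_val]
      simp only [N, map_pow] at hv ⊢
      rw [← hv]; ring
    rw [this]; ring

variable (D)

/-- A class of the form `s d / d` has norms which are cubic residues modulo `P`. -/
theorem mk_pow_eq_one_of_sC {d : ClassGroup O} {J : Ideal O} {A : O} (hJ : J ≠ ⊥)
    (h : idealClass J * d = D.sC d) (hN : D.NI J = Ideal.span {A}) (hs : D.s A = A) (hA : A ∉ D.P) :
    Ideal.Quotient.mk D.P A ^ ((p - 1) / 3) = 1 := by
  obtain ⟨I, hI, rfl⟩ := exists_idealClass_eq d
  rw [sC_idealClass, ← idealClass_mul hJ hI, idealClass_eq_iff (mul_ne_zero hJ hI)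
    (D.map_s_ne_bot hI)] at h
  obtain ⟨x, hx, y, hy, h⟩ := h
  have hA0 : A ≠ 0 := fun h => hA (h ▸ D.P.zero_mem)
  have h1 := congrArg D.NI h
  rw [D.NI_mul, D.NI_mul, D.NI_mul, D.NI_map_s, D.NI_span, D.NI_span, hN, mul_right_comm,
    mul_comm] at h1
  have h2 := mul_left_cancel₀ (D.NI_ne_bot hI) h1
  rw [Ideal.span_singleton_mul_span_singleton] at h2
  obtain ⟨k, hk⟩ := D.p_odd
  have hk' : (p - 1) / 3 = 6 * k := by omega
  rw [hk']
  obtain ⟨i, h3⟩ := D.exists_eq_of_span_eq (D.s_N y)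
    (by rw [map_mul, hs, D.s_N]) (mul_ne_zero hA0 (D.N_ne_zero hx)) h2.symm
  have key : ∀ u : O, u ^ 6 = 1 → D.N y = u * (A * D.N x) →
      Ideal.Quotient.mk D.P A ^ (6 * k) = 1 := fun u hu h => by
    have huA : u * A ∉ D.P := fun h => hA (by
      have := D.P.mul_mem_left (u ^ 5) h
      rwa [← mul_assoc, ← pow_succ, hu, one_mul] at this)
    have := D.mk_pow_eq_of_mul_N_eq huA (B := 1)
      (fun h => D.P_ne_top ((Ideal.eq_top_iff_one _).2 h)) (x := y) (y := x) hy hx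
      (by rw [h]; ring)
    rwa [hk', map_one, one_pow, map_mul, mul_pow, pow_mul, ← map_pow, hu, map_one, one_pow,
      one_mul] at this
  have hζ : (D.ζ ^ i) ^ 6 = 1 := by
    rw [← pow_mul, mul_comm, show 6 = 3 * 2 from rfl, mul_assoc, pow_mul, D.ζ_pow, one_pow]
  rcases h3 with h3 | h3
  · exact key _ hζ h3
  · refine key (-(D.ζ ^ i)) (by rw [neg_pow, hζ]; norm_num) (by rw [h3]; ring)

end PureCubicRing

section PrimaryMap

variable {A B : Type*} [CommGroup A] [CommGroup B] (p : ℕ)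

/-- The restriction of a homomorphism to primary components. -/
def primaryMap (f : A →* B) : CommGroup.primaryComponent A p →* CommGroup.primaryComponent B p :=
  (f.comp (CommGroup.primaryComponent A p).subtype).codRestrict _ fun x => by
    obtain ⟨k, hk⟩ := x.2
    exact ⟨k, by simp [← map_pow, hk]⟩

theorem primaryMap_coe (f : A →* B) (x : CommGroup.primaryComponent A p) :
    (primaryMap p f x : B) = f x := rfl

end PrimaryMap

theorem exists_prime_noncube {p : ℕ} [hp : Fact p.Prime] (h9 : p % 9 = 1) :
    ∃ q : ℕ, q.Prime ∧ q % 3 = 2 ∧ (q : ZMod p) ^ ((p - 1) / 3) ≠ 1 := by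
  obtain ⟨g, hg⟩ := IsCyclic.exists_generator (α := (ZMod p)ˣ)
  have hcard : orderOf g = p - 1 := by
    rw [orderOf_eq_card_of_forall_mem_zpowers hg, Nat.card_eq_fintype_card, ZMod.card_units]
  have hp2 := hp.out.two_le
  have hco : Nat.Coprime 3 p := by
    rw [Nat.coprime_primes Nat.prime_three hp.out]; rintro rfl; omega
  obtain ⟨n, hn3, hnp⟩ := Nat.chineseRemainder hco 2 (g : ZMod p).val
  have hnp' : (n : ZMod p) = g := by
    have := (ZMod.natCast_eq_natCast_iff _ _ _).2 hnp
    rwa [ZMod.natCast_zmod_val] at this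
  have h3 : Nat.Coprime n 3 := by
    rw [Nat.coprime_comm, Nat.Prime.coprime_iff_not_dvd Nat.prime_three]
    have : n % 3 = 2 % 3 := hn3
    omega
  have hp' : Nat.Coprime n p := by
    rw [← ZMod.isUnit_iff_coprime, hnp']; exact g.isUnit
  have : NeZero (3 * p) := ⟨by positivity⟩
  obtain ⟨q, -, hq, e⟩ := Nat.forall_exists_prime_gt_and_eq_mod
    ((ZMod.isUnit_iff_coprime n (3 * p)).2 (Nat.Coprime.mul_right h3 hp')) 0
  have e' := (ZMod.natCast_eq_natCast_iff _ _ _).1 e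
  have e3 : q % 3 = n % 3 := e'.of_mul_right _
  have ep : (q : ZMod p) = n := (ZMod.natCast_eq_natCast_iff _ _ _).2 (e'.of_mul_left _)
  refine ⟨q, hq, by have : n % 3 = 2 % 3 := hn3; omega, fun h => ?_⟩
  rw [ep, hnp', ← Units.val_pow_eq_pow_val, Units.val_eq_one] at h
  have := Nat.le_of_dvd (by omega) (orderOf_dvd_of_pow_eq_one h)
  omega

theorem span_mul_span_mul_span_eq {R : Type*} [CommRing R] {q a b c m u v : R}
    (h : a * b * c = q * m) (huv : u * (a * b + b * c + c * a) + v * q ^ 2 = 1) :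
    Ideal.span {q, a} * Ideal.span {q, b} * Ideal.span {q, c} = Ideal.span {q} := by
  have hA : ∀ x : R, q ∈ Ideal.span {q, x} := fun x => Ideal.subset_span (by simp)
  have hB : ∀ x : R, x ∈ Ideal.span {q, x} := fun x => Ideal.subset_span (by simp)
  have hM : ∀ {x y z : R}, x ∈ Ideal.span {q, a} → y ∈ Ideal.span {q, b} → z ∈ Ideal.span {q, c} →
      x * y * z ∈ Ideal.span {q, a} * Ideal.span {q, b} * Ideal.span {q, c} := fun hx hy hz =>
    Ideal.mul_mem_mul (Ideal.mul_mem_mul hx hy) hz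
  apply le_antisymm
  · rw [Ideal.span_pair_mul_span_pair, Ideal.span_mul_span', Ideal.span_le]
    rintro _ ⟨x, hx, y, hy, rfl⟩
    simp only [Set.mem_insert_iff, Set.mem_singleton_iff] at hx hy
    rw [SetLike.mem_coe, Ideal.mem_span_singleton]
    rcases hy with rfl | rfl
    · exact Dvd.intro_left _ rfl
    · rcases hx with rfl | rfl | rfl | rfl
      · exact ⟨q * y, by ring⟩
      · exact ⟨b * y, by ring⟩
      · exact ⟨a * y, by ring⟩
      · exact ⟨m, h⟩
  · rw [Ideal.span_singleton_le_iff_mem]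
    have e : q = u * (a * b * q + q * b * c + a * q * c) + v * (q * q * q) := by
      linear_combination (-q) * huv
    have h0 := Ideal.add_mem _ (Ideal.mul_mem_left _ u (Ideal.add_mem _ (Ideal.add_mem _
      (hM (hB a) (hB b) (hA c)) (hM (hA a) (hB b) (hB c))) (hM (hB a) (hA b) (hB c))))
      (Ideal.mul_mem_left _ v (hM (hA a) (hA b) (hA c)))
    rwa [← e] at h0

namespace PureCubicRing

set_option linter.unusedSectionVars false

variable {O : Type*} [CommRing O] [IsDedekindDomain O] [CharZero O]
  {p : ℕ} [hp : Fact p.Prime] (D : PureCubicRing O p)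

include D

/-- A prime `q` inert in the quadratic subfield has an ideal of norm `q` fixed by `t`. -/
theorem exists_ideal_NI_eq {q : ℕ} (hq : q.Prime) (h2 : q % 3 = 2) (hqp : q ≠ p) :
    ∃ I : Ideal O, I ≠ ⊥ ∧ I.map D.t = I ∧ D.NI I = Ideal.span {(q : O)} := by
  obtain ⟨j, rfl⟩ : ∃ j, q = 3 * j + 2 := ⟨q / 3, by omega⟩
  set q := 3 * j + 2 with hqdef
  have : Fact q.Prime := ⟨hq⟩
  set r := p ^ (2 * j + 1) with hr
  have hpq : (p : ZMod q) ≠ 0 := by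
    rw [Ne, ZMod.natCast_eq_zero_iff, Nat.prime_dvd_prime_iff_eq hq hp.out]
    exact hqp
  have hr0 : (r : ZMod q) ≠ 0 := by rw [hr, Nat.cast_pow]; exact pow_ne_zero _ hpq
  have hr3 : (r : ZMod q) ^ 3 = p := by
    rw [hr, Nat.cast_pow, ← pow_mul,
      show (2 * j + 1) * 3 = (q - 1) * 2 + 1 by omega, pow_add, pow_mul, ZMod.pow_card_sub_one_eq_one hpq]
    simp
  obtain ⟨m, hm⟩ : (q : ℤ) ∣ (r : ℤ) ^ 3 - p := by
    rw [← ZMod.intCast_zmod_eq_zero_iff_dvd]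
    push_cast
    rw [hr3, sub_self]
  have hco : IsCoprime (3 * (r : ℤ) ^ 2) ((q : ℤ) ^ 2) := by
    apply IsCoprime.pow_right
    rw [isCoprime_comm, Prime.coprime_iff_not_dvd (Nat.prime_iff_prime_int.1 hq)]
    intro h
    rw [← ZMod.intCast_zmod_eq_zero_iff_dvd] at h
    push_cast at h
    rcases mul_eq_zero.1 h with h | h
    · have h : ((3 : ℕ) : ZMod q) = 0 := by exact_mod_cast h
      rw [ZMod.natCast_eq_zero_iff, Nat.prime_dvd_prime_iff_eq hq Nat.prime_three] at h
      omega
    · exact hr0 (pow_eq_zero_iff (by norm_num) |>.1 h)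
  obtain ⟨u, v, huv⟩ := hco
  have hm' : (r : O) ^ 3 - p = q * m := by exact_mod_cast congrArg (Int.cast : ℤ → O) hm
  have huv' : (u : O) * (3 * (r : O) ^ 2) + v * (q : O) ^ 2 = 1 := by
    exact_mod_cast congrArg (Int.cast : ℤ → O) huv
  have hq0 : (q : O) ≠ 0 := Nat.cast_ne_zero.2 hq.ne_zero
  refine ⟨Ideal.span {(q : O), D.θ - r}, ?_, ?_, ?_⟩
  · intro h
    rw [Ideal.span_eq_bot] at h
    exact hq0 (h _ (by simp))
  · simp [Ideal.map_span, Set.image_pair, D.t_θ]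
  · have hi : (Ideal.span {(q : O), D.θ - r}).map D.s = Ideal.span {(q : O), D.ζ * D.θ - r} := by
      simp [Ideal.map_span, Set.image_pair, D.s_θ]
    have hii : (Ideal.span {(q : O), D.ζ * D.θ - r}).map D.s =
        Ideal.span {(q : O), D.ζ * (D.ζ * D.θ) - r} := by
      simp [Ideal.map_span, Set.image_pair, D.s_θ, D.s_ζ]
    rw [NI, hi, hii]
    generalize ha : D.θ - r = a
    generalize hb : D.ζ * D.θ - r = b
    generalize hc : D.ζ * (D.ζ * D.θ) - r = c
    have habc : a * b * c = q * (-m) := by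
      rw [← ha, ← hb, ← hc]
      have h1 := D.θ_pow
      have h2 := D.ζ_eq
      grind
    have hs : a * b + b * c + c * a = 3 * (r : O) ^ 2 := by
      rw [← ha, ← hb, ← hc]
      have h1 := D.θ_pow
      have h2 := D.ζ_eq
      grind
    exact span_mul_span_mul_span_eq habc (by rw [hs]; exact huv')

theorem mk_natCast_pow_eq_one_iff {n e : ℕ} :
    Ideal.Quotient.mk D.P (n : O) ^ e = 1 ↔ (n : ZMod p) ^ e = 1 := by
  rw [← map_pow, ← map_one (Ideal.Quotient.mk D.P), Ideal.Quotient.mk_eq_mk_iff_sub_mem]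
  have h : ((n : O) ^ e - 1) = ((n ^ e - 1 : ℤ) : O) := by push_cast; rfl
  rw [h, intCast_mem_P, ← ZMod.intCast_zmod_eq_zero_iff_dvd]
  push_cast
  rw [sub_eq_zero]

theorem eq_one_of_zpowers_cP {k : ℕ} (h : D.tC (D.cP ^ k) = D.cP ^ k) : D.cP ^ k = 1 := by
  rw [map_pow, tC_cP] at h
  have h1 : D.cP ^ k * D.cP ^ k = 1 := by
    nth_rw 2 [← h]; rw [← mul_pow, cP_mul_cP', one_pow]
  have h2 : D.cP ^ k * D.cP ^ k * D.cP ^ k = 1 := by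
    rw [← mul_pow, ← mul_pow, ← pow_two, ← pow_succ, cP_pow, one_pow]
  rwa [h1, one_mul] at h2

theorem exists_eq_cP_pow (hΛ : D.Λ.index = 3) (h : D.cP ≠ 1) {c : ClassGroup O}
    (hc : D.sC c = c) : ∃ k : ℕ, c = D.cP ^ k := by
  obtain ⟨i, hi⟩ := D.exists_Amb hc
  obtain ⟨v, hv⟩ := D.exists_unit_N_eq_ζ hΛ h
  exact (hi.zero_of_unit hv).mem_zpowers

theorem Amb_unique (h : D.cP = 1) {c c' : ClassGroup O} {i j : ℕ}
    (hc : D.Amb c i) (hc' : D.Amb c' j) (hij : i % 3 = j % 3) : c = c' := by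
  have key : ∀ {c : ClassGroup O} {i : ℕ}, D.Amb c i → i % 3 = 0 → c = 1 := fun {c i} h0 hi => by
    have h1 := h0.congr (j := 0) (by
      obtain ⟨k, rfl⟩ : ∃ k, i = 3 * k := ⟨i / 3, by omega⟩
      rw [pow_mul, D.ζ_pow, one_pow, pow_zero])
    obtain ⟨k, hk⟩ := h1.mem_zpowers
    rw [hk, h, one_pow]
  have h1 := key (hc.mul (hc'.pow 1)) (by omega)
  have h2 := key (hc'.pow 2) (by omega)
  calc c = c * (c' ^ (2 + 1)) := by rw [h2, mul_one]
    _ = c * c' ^ (1 + 1) * c' := by rw [pow_succ c' 2, mul_assoc]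
    _ = c' := by rw [h1, one_mul]

theorem card_fixed_le (hΛ : D.Λ.index = 3) :
    ∃ f : {c : ClassGroup O // D.sC c = c} → Fin 3, Function.Injective f := by
  by_cases h : D.cP = 1
  · choose i hi using fun c : {c : ClassGroup O // D.sC c = c} => D.exists_Amb c.2
    refine ⟨fun c => ⟨i c % 3, Nat.mod_lt _ (by norm_num)⟩, fun c c' hcc => ?_⟩
    exact Subtype.ext (D.Amb_unique h (hi c) (hi c') (by simpa using hcc))
  · choose i hi using fun c : {c : ClassGroup O // D.sC c = c} => D.exists_eq_cP_pow hΛ h c.2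
    refine ⟨fun c => ⟨i c % 3, Nat.mod_lt _ (by norm_num)⟩, fun c c' hcc => ?_⟩
    apply Subtype.ext
    rw [hi c, hi c', ← Nat.div_add_mod (i c) 3, ← Nat.div_add_mod (i c') 3, pow_add, pow_add,
      pow_mul, pow_mul, cP_pow, one_pow, one_pow, show i c % 3 = i c' % 3 by simpa using hcc]

theorem tC_eq_of_sC_eq (h : D.cP = 1) {c : ClassGroup O} (hc : D.sC c = c) : D.tC c = c := by
  obtain ⟨i, hi⟩ := D.exists_Amb hc
  exact D.Amb_unique h hi.tC hi rfl

/-- The structure of the `3`-primary component of the class group; the last condition on ideals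
with trivial cubic residue norm excludes the elementary group of order nine. -/
theorem classGroup_structure [Finite (ClassGroup O)] (hΛ : D.Λ.index = 3)
    (hd : D.cP ≠ 1 → ∃ I : Ideal O, I ≠ ⊥ ∧ D.sC (idealClass I) * D.cP = idealClass I ∧ ∃ A,
      D.s A = A ∧ A ∉ D.P ∧ D.NI I = Ideal.span {A} ∧
      Ideal.Quotient.mk D.P A ^ ((p - 1) / 3) = 1) :
    ∃ w j : ℕ, 1 ≤ w ∧ (j = w ∨ j + 1 = w) ∧
      Nonempty (CommGroup.primaryComponent (ClassGroup O) 3 ≃*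
        Multiplicative (ZMod (3 ^ w)) × Multiplicative (ZMod (3 ^ j))) ∧
      (∃ c : CommGroup.primaryComponent (ClassGroup O) 3, orderOf c = 3 ^ w ∧
        ∀ x, primaryMap 3 D.tC x = x ↔ x ∈ Subgroup.zpowers c) ∧
      (j = w ↔ D.cP ≠ 1) ∧ (j = w → 2 ≤ w) := by
  obtain ⟨q, hq, hq2, hqp⟩ := exists_prime_noncube D.p_mod
  have hqp' : q ≠ p := by rintro rfl; have := D.p_mod; omega
  obtain ⟨Q, hQ, hQt, hQN⟩ := D.exists_ideal_NI_eq hq hq2 hqp'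
  obtain ⟨n, m, hm, hnm⟩ := Nat.exists_eq_pow_mul_and_not_dvd
    (Nat.card_pos (α := ClassGroup O)).ne' 3 (by norm_num)
  have hpow : ∀ c : ClassGroup O, (c ^ m) ^ 3 ^ n = 1 := fun c => by
    rw [← pow_mul, mul_comm, ← hnm, pow_card_eq_one']
  set G := CommGroup.primaryComponent (ClassGroup O) 3 with hG
  have hGpow : ∀ x : G, x ^ 3 ^ n = 1 := fun x => by
    obtain ⟨k, hk⟩ := x.2
    apply Subtype.ext
    have h1 : (x : ClassGroup O) ^ (3 ^ n * m) = 1 := by rw [← hnm, pow_card_eq_one']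
    have h2 := orderOf_dvd_of_pow_eq_one h1
    have h3 := orderOf_dvd_of_pow_eq_one hk
    have h4 : Nat.Coprime (orderOf (x : ClassGroup O)) m :=
      Nat.Coprime.coprime_dvd_left h3
        (Nat.Coprime.pow_left _ ((Nat.Prime.coprime_iff_not_dvd Nat.prime_three).2 hm))
    exact orderOf_dvd_iff_pow_eq_one.1 (h4.dvd_of_dvd_mul_right h2)
  let s : G →* G := primaryMap 3 D.sC
  let t : G →* G := primaryMap 3 D.tC
  let c0 : G := ⟨idealClass Q ^ m, n, hpow _⟩
  have hz : ∀ k : ℕ, D.cP ^ k ∈ G := fun k =>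
    ⟨1, by rw [pow_one, ← pow_mul, mul_comm, pow_mul, cP_pow, one_pow]⟩
  have hres : ∀ e : ℕ, Ideal.Quotient.mk D.P (q : O) ^ ((p - 1) / 3 * e) = 1 → 3 ∣ e := fun e he => by
    rw [mk_natCast_pow_eq_one_iff, pow_mul] at he
    by_contra h3
    have hq0 : (q : ZMod p) ≠ 0 := by
      rw [Ne, ZMod.natCast_eq_zero_iff, Nat.prime_dvd_prime_iff_eq hp.out hq]
      exact hqp'.symm
    have h1 : ((q : ZMod p) ^ ((p - 1) / 3)) ^ 3 = 1 := by
      obtain ⟨k, hk⟩ := D.p_odd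
      rw [← pow_mul, show (p - 1) / 3 * 3 = p - 1 by omega, ZMod.pow_card_sub_one_eq_one hq0]
    have h2 := Nat.dvd_gcd (orderOf_dvd_of_pow_eq_one h1) (orderOf_dvd_of_pow_eq_one he)
    rw [Nat.Coprime.gcd_eq_one ((Nat.Prime.coprime_iff_not_dvd Nat.prime_three).2 h3),
      Nat.dvd_one, orderOf_eq_one_iff] at h2
    exact hqp h2
  have hqP : (q : O) ∉ D.P := fun h => by
    have : ((q : ℤ) : O) ∈ D.P := by exact_mod_cast h
    rw [intCast_mem_P, Int.natCast_dvd_natCast, Nat.prime_dvd_prime_iff_eq hp.out hq] at this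
    exact hqp' this.symm
  have hNIpow : ∀ {I : Ideal O} {A : O} (k : ℕ), D.NI I = Ideal.span {A} →
      D.NI (I ^ k) = Ideal.span {A ^ k} := fun {I A} k h => by
    have : D.NI (I ^ k) = D.NI I ^ k := by
      simp only [NI, Ideal.map_pow]; ring
    rw [this, h, Ideal.span_singleton_pow]
  have hcl : ∀ x : G, s x ≠ c0 * x := fun x hx => by
    have h1 := congrArg Subtype.val hx
    change D.sC x = idealClass Q ^ m * x at h1
    rw [← idealClass_pow hQ] at h1
    have h2 := D.mk_pow_eq_one_of_sC (pow_ne_zero m hQ) h1.symm (hNIpow m hQN)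
      (by rw [map_pow, map_natCast]) (fun h => hqP (D.P_prime.mem_of_pow_mem _ h))
    rw [map_pow, ← pow_mul, mul_comm] at h2
    exact hm (hres _ h2)
  have hsN : ∀ x : G, x * s x * s (s x) = 1 := fun x => Subtype.ext (D.mul_sC_mul_sC x)
  have hfix : Nat.card {x : Additive G // s.toAdditive x = x} ≤ 3 := by
    obtain ⟨f, hf⟩ := D.card_fixed_le hΛ
    have := Nat.card_le_card_of_injective
      (fun x : {x : Additive G // s.toAdditive x = x} =>
        f ⟨(x.1.toMul : ClassGroup O), congrArg Subtype.val x.2⟩) (fun x y hxy => by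
        have h := congrArg Subtype.val (hf hxy)
        exact Subtype.ext (Subtype.ext h))
    simpa using this
  obtain ⟨w, j, hw, hj, hord, ⟨e⟩, ht, hjw⟩ := dihedral_decomposition s.toAdditive t.toAdditive
    (Additive.ofMul c0) n (fun x => hGpow x.toMul) (fun x => hsN x.toMul)
    (fun x => Subtype.ext (D.tC_sC (x.toMul : ClassGroup O)))
    (Subtype.ext (by
      change D.tC (idealClass Q ^ m) = idealClass Q ^ m
      rw [map_pow, tC_idealClass, hQt]))
    (fun x hx => hcl x.toMul (sub_eq_iff_eq_add.1 hx)) hfix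
  have hjw' : j = w ↔ D.cP ≠ 1 := by
    rw [hjw]
    constructor
    · intro h h1
      have hinj : Function.Injective (s.toAdditive - AddMonoidHom.id (Additive G)) := by
        rw [injective_iff_map_eq_zero]
        intro x hx
        have hx' : s.toAdditive x = x := sub_eq_zero.1 hx
        refine h x hx' (Subtype.ext ?_)
        exact D.tC_eq_of_sC_eq h1 (congrArg Subtype.val hx')
      obtain ⟨x, hx⟩ := Finite.surjective_of_injective hinj (Additive.ofMul c0)
      exact hcl x.toMul (sub_eq_iff_eq_add.1 hx)
    · intro h x hs ht
      obtain ⟨k, hk⟩ := D.exists_eq_cP_pow hΛ h (c := (x.toMul : ClassGroup O))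
        (congrArg Subtype.val hs)
      have ht' : D.tC (x.toMul : ClassGroup O) = x.toMul := congrArg Subtype.val ht
      rw [hk] at ht'
      exact Subtype.ext (hk.trans (D.eq_one_of_zpowers_cP ht'))
  refine ⟨w, j, hw, hj, ⟨?_⟩, ⟨c0, ?_, fun x => ?_⟩, hjw', ?_⟩
  · exact
      { toFun := fun x => (Multiplicative.ofAdd (e (Additive.ofMul x)).1,
          Multiplicative.ofAdd (e (Additive.ofMul x)).2)
        invFun := fun y => (e.symm (y.1.toAdd, y.2.toAdd)).toMul
        left_inv := fun x => by simp
        right_inv := fun y => by simp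
        map_mul' := fun x y => by simp }
  · rw [← addOrderOf_ofMul_eq_orderOf]; exact hord
  · exact ht (Additive.ofMul x)
  · intro hjw1
    by_contra hw2
    obtain rfl : w = 1 := by omega
    subst hjw1
    obtain ⟨I, hI, hIs, A, hA, hAP, hAN, hAr⟩ := hd (hjw'.1 rfl)
    have hG3 : ∀ x : G, x ^ 3 = 1 := fun x => by
      have h1 : e (3 • Additive.ofMul x) = 0 := by
        rw [map_nsmul]
        generalize e (Additive.ofMul x) = y
        revert y; decide
      exact (AddEquiv.map_eq_zero_iff e).1 h1
    have hcard : Nat.card G = 9 := by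
      have h1 : Nat.card G = Nat.card (ZMod (3 ^ 1) × ZMod (3 ^ 1)) :=
        Nat.card_congr (Additive.ofMul.trans e.toEquiv)
      rw [h1, Nat.card_prod, Nat.card_zmod]; norm_num
    let l : G →* G := s / MonoidHom.id G
    have hl : ∀ x, l x = s x / x := fun x => rfl
    have hker : Nat.card l.ker ≤ 3 := by
      refine le_trans (Nat.card_le_card_of_injective (fun x : l.ker =>
        (⟨Additive.ofMul x.1, ?_⟩ : {x : Additive G // s.toAdditive x = x})) ?_) hfix
      · exact (div_eq_one (G := G)).1 x.2
      · intro x y hxy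
        exact Subtype.ext (Subtype.mk.inj hxy)
    have hc0 : c0 ∉ l.range := by
      rintro ⟨x, hx⟩
      exact hcl x (div_eq_iff_eq_mul.1 hx)
    have hidx : l.range.index = 3 := by
      have h1 := l.range.index_mul_card
      have h2 := Subgroup.card_eq_card_quotient_mul_card_subgroup l.ker
      rw [Nat.card_congr (QuotientGroup.quotientKerEquivRange l).toEquiv] at h2
      have h3 : l.range.index ≠ 1 := fun h => hc0 (by
        rw [Subgroup.index_eq_one.1 h]; trivial)
      rw [hcard] at h1 h2
      have h4 : l.range.index ∣ 3 ^ 2 := Dvd.intro _ h1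
      obtain ⟨i, hi, h5⟩ := (Nat.dvd_prime_pow Nat.prime_three).1 h4
      rw [h5] at h1 h3 ⊢
      interval_cases i
      · simp at h3
      · norm_num
      · nlinarith
    let c : G := ⟨idealClass I ^ m, n, hpow _⟩
    have h3p : Fact (Nat.Prime 3) := ⟨Nat.prime_three⟩
    obtain ⟨k, hk⟩ := mem_powers_of_prime_card (p := 3) (G := G ⧸ l.range) (g := QuotientGroup.mk c0)
      (g' := QuotientGroup.mk c) hidx
      (fun h => hc0 ((QuotientGroup.eq_one_iff _).1 h))
    obtain ⟨y, hy⟩ : c0 ^ (2 * k) * c ∈ l.range := by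
      rw [← QuotientGroup.eq_one_iff, QuotientGroup.mk_mul, ← hk]
      change ((c0 ^ (2 * k) * c0 ^ k : G) : G ⧸ l.range) = 1
      rw [← pow_add, show 2 * k + k = 3 * k by ring, pow_mul, hG3, one_pow]
      rfl
    rw [hl, div_eq_iff_eq_mul] at hy
    have hy' := congrArg Subtype.val hy
    change D.sC y = (idealClass Q ^ m) ^ (2 * k) * idealClass I ^ m * y at hy'
    have hJ : Q ^ (m * (2 * k)) * I ^ m ≠ ⊥ := mul_ne_zero (pow_ne_zero _ hQ) (pow_ne_zero _ hI)
    have hr := D.mk_pow_eq_one_of_sC (d := y) (A := (q : O) ^ (m * (2 * k)) * A ^ m) hJ (by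
      rw [hy', idealClass_mul (pow_ne_zero _ hQ) (pow_ne_zero _ hI), idealClass_pow hQ,
        idealClass_pow hI, pow_mul])
      (by rw [NI_mul, hNIpow _ hQN, hNIpow _ hAN, Ideal.span_singleton_mul_span_singleton])
      (by rw [map_mul, map_pow, map_pow, hA, map_natCast])
      (fun h => (D.P_prime.mem_or_mem h).elim (fun h => hqP (D.P_prime.mem_of_pow_mem _ h))
        fun h => hAP (D.P_prime.mem_of_pow_mem _ h))
    rw [map_mul, map_pow, map_pow, mul_pow, ← pow_mul (Ideal.Quotient.mk D.P A), mul_comm m ((p - 1) / 3),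
      pow_mul _ ((p - 1) / 3), hAr, one_pow, mul_one, ← pow_mul, mul_comm] at hr
    have h3k : 3 ∣ k := by
      have h1 := hres _ hr
      rw [Nat.Prime.dvd_mul Nat.prime_three] at h1
      have := h1.resolve_left hm
      omega
    obtain ⟨k, rfl⟩ := h3k
    have hy2 : s y = c * y := by
      rw [hy, show 2 * (3 * k) = 3 * (2 * k) by ring, pow_mul, hG3, one_pow, one_mul]
    have hy3 := congrArg Subtype.val hy2
    change D.sC y = idealClass I ^ m * y at hy3
    have hy4 := congrArg D.sC hy3
    rw [map_mul, map_pow] at hy4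
    have h5 := congrArg (· ^ m) hIs
    simp only [mul_pow] at h5
    have h6 := D.mul_sC_mul_sC (y : ClassGroup O)
    have h7 : (D.sC (y : ClassGroup O)) ^ 3 = 1 := by
      have := congrArg Subtype.val (hG3 (s y))
      exact this
    have h8 : D.cP ^ m = 1 := by
      have e1 : D.sC (D.sC y) * D.cP ^ m * y = D.sC y * D.sC y := by
        rw [hy4, mul_right_comm (D.sC (idealClass I) ^ m), h5]
        rw [mul_right_comm, ← hy3]
      calc D.cP ^ m = (y * D.sC y * D.sC (D.sC y)) * D.cP ^ m := by rw [h6, one_mul]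
        _ = D.sC (D.sC y) * D.cP ^ m * y * D.sC y := by
            simp only [mul_comm, mul_left_comm]
        _ = 1 := by rw [e1, ← h7, pow_succ, pow_two]
    have h9 := Nat.dvd_gcd (orderOf_dvd_of_pow_eq_one h8) (orderOf_dvd_of_pow_eq_one D.cP_pow)
    rw [Nat.gcd_comm, Nat.Coprime.gcd_eq_one ((Nat.Prime.coprime_iff_not_dvd Nat.prime_three).2 hm),
      Nat.dvd_one, orderOf_eq_one_iff] at h9
    exact hjw'.1 rfl h9

end PureCubicRing

section Quadratic

variable {R O : Type*} [CommRing R] [IsDedekindDomain R] [CommRing O] [IsDedekindDomain O]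
  {f : R →+* O} {t : O ≃+* O}

omit [IsDedekindDomain O] in
theorem Ideal.map_map_of_involutive (ht : ∀ x, t (t x) = x) (I : Ideal O) :
    (I.map t).map t = I := by
  change (I.map (t : O →+* O)).map (t : O →+* O) = _
  rw [Ideal.map_map]
  convert Ideal.map_id I
  ext x
  exact ht x

omit [IsDedekindDomain R] [IsDedekindDomain O] in
theorem Ideal.map_map_of_fixed (hf : ∀ r, t (f r) = f r) (I : Ideal R) :
    (I.map f).map t = I.map f := by
  change (I.map f).map (t : O →+* O) = _
  rw [Ideal.map_map]
  congr 1
  ext x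
  exact hf x

theorem classMap_sq_eq_one (hf : Function.Injective f) (hfi : f.IsIntegral)
    (ht : ∀ x, t (t x) = x) (hfix : ∀ x, t x = x ↔ ∃ r, f r = x) {c : ClassGroup R}
    (hc : classMap f hf c = 1) : c ^ 2 = 1 := by
  obtain ⟨I, hI, rfl⟩ := exists_idealClass_eq c
  have hI' : I.map f ≠ ⊥ := fun h => hI ((Ideal.map_eq_bot_iff_of_injective hf).1 h)
  rw [classMap_idealClass, idealClass_eq_one_iff hI'] at hc
  obtain ⟨x, hx⟩ := hc
  have hx0 : x ≠ 0 := by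
    rintro rfl
    exact hI' (by rw [hx]; simp)
  have htx : I.map f = Ideal.span {t x} := by
    rw [← Ideal.map_map_of_fixed (t := t) (fun r => (hfix _).2 ⟨r, rfl⟩) I, hx, Ideal.map_span,
      Set.image_singleton]
  obtain ⟨y, hy⟩ := (hfix (x * t x)).1 (by rw [map_mul, ht, mul_comm])
  have hy0 : f y ≠ 0 := by
    rw [hy]
    exact mul_ne_zero hx0 (by simpa using hx0)
  have e : (I ^ 2).map f = Ideal.span {f y} := by
    rw [Ideal.map_pow, pow_two, hy, ← Ideal.span_singleton_mul_span_singleton, ← hx, ← htx]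
  have hle : I ^ 2 ≤ Ideal.span {y} := by
    intro a ha
    have h1 : f a ∈ Ideal.span {f y} := e ▸ Ideal.mem_map_of_mem f ha
    obtain ⟨b, hb⟩ := Ideal.mem_span_singleton'.1 h1
    obtain ⟨r, rfl⟩ := (hfix b).1 (by
      have h2 := congrArg t hb
      rw [map_mul, (hfix (f y)).2 ⟨y, rfl⟩, (hfix (f a)).2 ⟨a, rfl⟩, ← hb] at h2
      exact mul_right_cancel₀ hy0 h2)
    exact Ideal.mem_span_singleton'.2 ⟨r, hf (by rw [map_mul, hb])⟩
  obtain ⟨J, hJ⟩ := Ideal.dvd_iff_le.2 hle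
  have hJ1 : J = ⊤ := by
    rw [← Ideal.map_eq_top_iff f hf hfi]
    rw [hJ, Ideal.map_mul, Ideal.map_span, Set.image_singleton] at e
    exact mul_left_cancel₀ (a := Ideal.span {f y}) (by simpa using hy0)
      (e.trans (Ideal.mul_top _).symm)
  rw [← idealClass_pow hI, idealClass_eq_one_iff (pow_ne_zero 2 hI)]
  exact ⟨y, by rw [hJ, hJ1, Ideal.mul_top]⟩

omit [IsDedekindDomain R] in
theorem exists_map_eq_mul_map (ht : ∀ x, t (t x) = x) (hfix : ∀ x, t x = x ↔ ∃ r, f r = x)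
    {I : Ideal O} (hI : I ≠ ⊥) : ∃ J : Ideal R, J.map f = I * I.map t := by
  set J : Ideal R := Ideal.span {r | ∃ x ∈ I, f r = x * t x} with hJ
  refine ⟨J, ?_⟩
  have hle : J.map f ≤ I * I.map t := by
    rw [hJ, Ideal.map_span, Ideal.span_le]
    rintro _ ⟨r, ⟨x, hx, h⟩, rfl⟩
    rw [h]
    exact Ideal.mul_mem_mul hx (Ideal.mem_map_of_mem t hx)
  have htI : ∀ {I : Ideal O}, I ≠ ⊥ → I.map t ≠ ⊥ := fun h h' =>
    h ((Ideal.map_eq_bot_iff_of_injective t.injective).1 h')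
  obtain ⟨B, hB⟩ := Ideal.dvd_iff_le.2 hle
  suffices hB1 : B = ⊤ by rw [hB, hB1, Ideal.mul_top]
  by_contra hB1
  obtain ⟨Q, hQ, hBQ⟩ := Ideal.exists_le_maximal B hB1
  by_cases hQ0 : Q = ⊥
  · have hB0 : B = ⊥ := le_bot_iff.1 (hQ0 ▸ hBQ)
    obtain ⟨x, hxI, hx0⟩ := Submodule.exists_mem_ne_zero_of_ne_bot hI
    obtain ⟨r, hr⟩ := (hfix (x * t x)).1 (by rw [map_mul, ht, mul_comm])
    have hrJ : f r ∈ J.map f := Ideal.mem_map_of_mem f (Ideal.subset_span ⟨x, hxI, hr⟩)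
    rw [hB, hB0, Ideal.mul_bot, Ideal.mem_bot, hr] at hrJ
    exact mul_ne_zero hx0 (by simpa using hx0) hrJ
  have hQp := hQ.isPrime
  obtain ⟨x, hx⟩ := IsDedekindDomain.exists_sup_span_eq (I := I * (Q * Q.map t)) (J := I)
    Ideal.mul_le_left (mul_ne_zero hI (mul_ne_zero hQ0 (htI hQ0)))
  have hxI : x ∈ I := by
    rw [← hx]
    exact Ideal.mem_sup_right (Ideal.mem_span_singleton_self x)
  obtain ⟨A, hA⟩ := Ideal.dvd_span_singleton.2 hxI
  rw [hA, ← Ideal.mul_sup] at hx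
  have hcop : Q * Q.map t ⊔ A = ⊤ := mul_left_cancel₀ hI (hx.trans (Ideal.mul_top I).symm)
  obtain ⟨r, hr⟩ := (hfix (x * t x)).1 (by rw [map_mul, ht, mul_comm])
  have hrJ : f r ∈ I * I.map t * B := by
    rw [← hB]
    exact Ideal.mem_map_of_mem f (Ideal.subset_span ⟨x, hxI, hr⟩)
  have h1 : I * I.map t * B ∣ I * I.map t * (A * A.map t) := by
    have h2 : Ideal.span {f r} = I * I.map t * (A * A.map t) := by
      have h3 : Ideal.span {t x} = I.map t * A.map t := by
        rw [← Ideal.map_mul, ← hA, Ideal.map_span, Set.image_singleton]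
      rw [hr, ← Ideal.span_singleton_mul_span_singleton, hA, h3, mul_mul_mul_comm]
    rw [← h2]
    exact Ideal.dvd_span_singleton.2 hrJ
  have h2 : A * A.map t ≤ Q :=
    (Ideal.le_of_dvd ((mul_dvd_mul_iff_left (mul_ne_zero hI (htI hI))).1 h1)).trans hBQ
  rcases hQp.mul_le.1 h2 with h | h
  · refine hQ.ne_top (top_le_iff.1 ?_)
    rw [← hcop]
    exact sup_le Ideal.mul_le_left h
  · have h3 : A ≤ Q.map t := by
      rw [← Ideal.map_map_of_involutive ht A]
      exact Ideal.map_mono h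
    have h4 : Q.map t = ⊤ := by
      rw [← top_le_iff, ← hcop]
      exact sup_le Ideal.mul_le_right h3
    refine hQ.ne_top ?_
    rw [← Ideal.map_map_of_involutive ht Q, h4, Ideal.map_top]

theorem exists_classMap_eq_sq (hf : Function.Injective f)
    (ht : ∀ x, t (t x) = x) (hfix : ∀ x, t x = x ↔ ∃ r, f r = x) {c : ClassGroup O}
    (hc : classMap (t : O →+* O) t.injective c = c) : ∃ b, classMap f hf b = c ^ 2 := by
  obtain ⟨I, hI, rfl⟩ := exists_idealClass_eq c
  obtain ⟨J, hJ⟩ := exists_map_eq_mul_map ht hfix hI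
  refine ⟨idealClass J, ?_⟩
  have hI' : I.map t ≠ ⊥ := fun h => hI ((Ideal.map_eq_bot_iff_of_injective t.injective).1 h)
  have hc' : idealClass (I.map t) = idealClass I :=
    (classMap_idealClass (f := (t : O →+* O)) _ I).symm.trans hc
  rw [classMap_idealClass, hJ, idealClass_mul hI hI', pow_two, hc']

theorem classMap_classMap_of_fixed (hf : Function.Injective f)
    (hfix : ∀ x, t x = x ↔ ∃ r, f r = x) (b : ClassGroup R) :
    classMap (t : O →+* O) t.injective (classMap f hf b) = classMap f hf b := by
  obtain ⟨I, hI, rfl⟩ := exists_idealClass_eq b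
  rw [classMap_idealClass]
  refine (classMap_idealClass (f := (t : O →+* O)) _ _).trans (congrArg idealClass ?_)
  exact Ideal.map_map_of_fixed (fun r => (hfix _).2 ⟨r, rfl⟩) I

end Quadratic

theorem primaryComponent_isCyclic_of_fixed {A B : Type*} [CommGroup A] [CommGroup B] [Finite A]
    (φ : A →* B) (T : B →* B) (h1 : ∀ a, φ a = 1 → a ^ 2 = 1) (h2 : ∀ a, T (φ a) = φ a)
    (h3 : ∀ c, T c = c → ∃ a, φ a = c ^ 2) (c : CommGroup.primaryComponent B 3)
    (hc : ∀ x, primaryMap 3 T x = x ↔ x ∈ Subgroup.zpowers c) :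
    IsCyclic (CommGroup.primaryComponent A 3) ∧
      Nat.card (CommGroup.primaryComponent A 3) = orderOf c := by
  have hinj : Function.Injective (primaryMap 3 φ) := by
    rw [injective_iff_map_eq_one]
    intro a ha
    have h4 : (a : A) ^ 2 = 1 := h1 _ (congrArg Subtype.val ha)
    obtain ⟨k, hk⟩ := a.2
    have h5 : (a : A) ^ 3 ^ k = 1 := hk
    refine Subtype.ext ?_
    have hcop : Nat.Coprime 2 (3 ^ k) := Nat.Coprime.pow_right k (by norm_num)
    have := pow_gcd_eq_one.2 ⟨h4, h5⟩
    rwa [hcop.gcd_eq_one, pow_one] at this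
  have hrange : (primaryMap 3 φ).range = Subgroup.zpowers c := by
    ext x
    rw [← hc]
    constructor
    · rintro ⟨a, rfl⟩
      exact Subtype.ext (h2 a)
    · intro hx
      obtain ⟨b, hb⟩ := h3 x (congrArg Subtype.val hx)
      obtain ⟨k, m, hm, hkm⟩ := Nat.exists_eq_pow_mul_and_not_dvd (orderOf_pos b).ne' 3 (by norm_num)
      obtain ⟨n, hn⟩ := x.2
      have hcop : Nat.Coprime (2 * m) (3 ^ n) := by
        refine Nat.Coprime.pow_right n (Nat.Coprime.mul_left (by norm_num) ?_)
        exact ((Nat.Prime.coprime_iff_not_dvd Nat.prime_three).2 hm).symm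
      obtain ⟨j, hj⟩ := exists_pow_eq_self_of_coprime (x := (x : B)) (n := 2 * m) 
        (Nat.Coprime.coprime_dvd_right (orderOf_dvd_of_pow_eq_one hn) hcop)
      have hbm : b ^ m ∈ CommGroup.primaryComponent A 3 := by
        exact ⟨k, by rw [← pow_mul, mul_comm, ← hkm, pow_orderOf_eq_one]⟩
      refine ⟨⟨b ^ m, hbm⟩ ^ j, Subtype.ext ?_⟩
      rw [primaryMap_coe, SubmonoidClass.coe_pow, map_pow, map_pow, hb, ← pow_mul (x : B) 2 m, hj]
  have e := MonoidHom.ofInjective hinj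
  rw [hrange] at e
  exact ⟨e.symm.isCyclic.1 inferInstance, by rw [Nat.card_congr e.toEquiv, Nat.card_zpowers]⟩

namespace PureCubicRing

set_option linter.unusedSectionVars false

/-- The elements of an integral extension `B` of `O` which describe the unramified cubic extension
generated by a cubic Gauss sum: `M` is its ring of integers and `S` generates its Galois group. -/
structure GenusData {O : Type*} [CommRing O] [IsDedekindDomain O] [CharZero O]
    {p : ℕ} [hp : Fact p.Prime] (D : PureCubicRing O p) (B : Type*) [CommRing B] where
  f : O →+* B
  f_inj : Function.Injective f
  exists_of_mul : ∀ (x : B) (a b : O), b ≠ 0 → x * f b = f a → ∃ c, f c = x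
  S : B ≃+* B
  σ : B ≃+* B
  M : Subring B
  ρ : B
  ρ' : B
  η : B
  e : B
  Q : Ideal B
  c : ℤ
  S_f : ∀ a, S (f a) = f a
  σ_f : ∀ a, σ (f a) = f (D.s a)
  f_mem : ∀ a, f a ∈ M
  S_mem : ∀ x ∈ M, S x ∈ M
  S_S_S : ∀ x ∈ M, S (S (S x)) = x
  exists_of_S_eq : ∀ x ∈ M, S x = x → ∃ a, f a = x
  ρ_mem : ρ ∈ M
  ρ'_mem : ρ' ∈ M
  η_mem : η ∈ M
  e_mem : e ∈ M
  ρ_pow : ρ ^ 3 = f D.π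
  ρ_mul : ρ * ρ' = f D.θ
  ρ'_pow : ρ' ^ 3 = f (D.t D.π)
  S_ρ : S ρ = f D.ζ * ρ
  S_ρ' : S ρ' = f D.ζ ^ 2 * ρ'
  η_add : η + S η + S (S η) = -1
  η_mul : 3 * (η * S η + S η * S (S η) + S (S η) * η) = 1 - p
  e_mul : e * S e * S (S e) = 1
  σ_e : σ e = f D.ζ ^ 2 * e
  σ_S_e : σ (S e) = f D.ζ ^ 2 * S e
  σ_S_S_e : σ (S (S e)) = f D.ζ ^ 2 * S (S e)
  Q_f : ∀ a, f a ∈ Q → a ∈ D.P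
  c_dvd : (p : ℤ) ∣ c ^ 2 + c + 1
  S_e_sub : S e - c * e ∈ Q
  S_S_e_sub : S (S e) - c * S e ∈ Q
  e_sub : e - c * S (S e) ∈ Q

namespace GenusData

variable {O : Type*} [CommRing O] [IsDedekindDomain O] [CharZero O]
  {p : ℕ} [hp : Fact p.Prime] {D : PureCubicRing O p} {B : Type*} [CommRing B] [IsDomain B] [CharZero B]
  (G : GenusData D B)

include G

theorem comap_map {I : Ideal O} (hI : I ≠ ⊥) : (I.map G.f).comap G.f = I := by
  apply le_antisymm _ Ideal.le_comap_map
  intro x hx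
  obtain ⟨a, ha, ha0⟩ := Submodule.exists_mem_ne_zero_of_ne_bot hI
  obtain ⟨J, hJ⟩ := Ideal.dvd_span_singleton.2 ha
  have hJ0 : J ≠ ⊥ := fun h => by
    rw [h, Ideal.mul_bot, Ideal.span_singleton_eq_bot] at hJ
    exact ha0 hJ
  rw [← Ideal.span_singleton_le_iff_mem, ← Ideal.dvd_iff_le]
  apply (mul_dvd_mul_iff_right (c := J) hJ0).1
  rw [← hJ, Ideal.dvd_iff_le, Ideal.span_singleton_mul_le_iff]
  intro j hj
  have h1 : G.f (x * j) ∈ (I.map G.f) * (J.map G.f) := by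
    rw [map_mul]
    exact Ideal.mul_mem_mul hx (Ideal.mem_map_of_mem _ hj)
  rw [← Ideal.map_mul, ← hJ, Ideal.map_span, Set.image_singleton, Ideal.mem_span_singleton] at h1
  obtain ⟨b, hb⟩ := h1
  obtain ⟨b, rfl⟩ := G.exists_of_mul b (x * j) a ha0 (by rw [hb, mul_comm])
  rw [← map_mul] at hb
  rw [Ideal.mem_span_singleton]
  exact ⟨b, G.f_inj hb⟩

theorem map_inj {I J : Ideal O} (hI : I ≠ ⊥) (hJ : J ≠ ⊥) (h : I.map G.f = J.map G.f) : I = J := by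
  rw [← G.comap_map hI, h, G.comap_map hJ]

theorem map_map_s (I : Ideal O) : (I.map D.s).map G.f = (I.map G.f).map G.σ := by
  have h1 := Ideal.map_map (I := I) (D.s : O →+* O) G.f
  have h2 := Ideal.map_map (I := I) G.f (G.σ : B →+* B)
  have h3 : (G.σ : B →+* B).comp G.f = G.f.comp (D.s : O →+* O) := RingHom.ext fun x => G.σ_f x
  rw [h3, ← h1] at h2
  exact h2.symm

theorem exists_trace {x : B} (hx : x ∈ G.M) : ∃ a, G.f a = x + G.S x + G.S (G.S x) := by
  apply G.exists_of_S_eq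
  · exact G.M.add_mem (G.M.add_mem hx (G.S_mem _ hx)) (G.S_mem _ (G.S_mem _ hx))
  · rw [map_add, map_add, G.S_S_S x hx]; ring

theorem ζ_eq : G.f D.ζ ^ 2 + G.f D.ζ + 1 = 0 := by
  simpa using congrArg G.f D.ζ_eq

theorem ζ_pow : G.f D.ζ ^ 3 = 1 := by
  simpa using congrArg G.f D.ζ_pow

/-- The solution of Hilbert's theorem 90 for the unit `e`. -/
def w : B := 1 + G.S G.e + G.e * G.S G.e

theorem w_mem : G.w ∈ G.M :=
  G.M.add_mem (G.M.add_mem G.M.one_mem (G.S_mem _ G.e_mem)) (G.M.mul_mem G.e_mem (G.S_mem _ G.e_mem))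

theorem S_w : G.S G.w = G.S (G.S G.e) * G.w := by
  simp only [w, map_add, map_one, map_mul]
  linear_combination -G.e_mul

/-- The ideal of `O` which becomes principal, generated by `w`. -/
def I : Ideal O := (Ideal.span {G.w}).comap G.f

theorem exists_trace_mem {x : B} (hx : x ∈ G.M) : ∃ a ∈ G.I,
    G.f a = x * G.w + G.S (x * G.w) + G.S (G.S (x * G.w)) := by
  obtain ⟨a, ha⟩ := G.exists_trace (G.M.mul_mem hx G.w_mem)
  refine ⟨a, ?_, ha⟩
  rw [I, Ideal.mem_comap, ha, Ideal.mem_span_singleton]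
  simp only [map_mul, G.S_w, G.S_S_S _ G.e_mem]
  exact ⟨x + G.S x * G.S (G.S G.e) + G.S (G.S x) * (G.e * G.S (G.S G.e)), by ring⟩

theorem map_I : G.I.map G.f = Ideal.span {G.w} := by
  apply le_antisymm Ideal.map_comap_le
  rw [Ideal.span_singleton_le_iff_mem]
  have key : ∀ x ∈ G.M, x * G.w + G.S (x * G.w) + G.S (G.S (x * G.w)) ∈ G.I.map G.f := fun x hx => by
    obtain ⟨a, ha, h⟩ := G.exists_trace_mem hx
    rw [← h]; exact Ideal.mem_map_of_mem _ ha
  have h1 := key 1 G.M.one_mem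
  have hζ := G.ζ_eq
  have hz := G.ζ_pow
  have hπ : 3 * G.f D.π * G.w ∈ G.I.map G.f := by
    have h2 := key G.ρ G.ρ_mem
    have h3 := key (G.ρ ^ 2) (G.M.pow_mem G.ρ_mem 2)
    have h4 := Ideal.add_mem _ (Ideal.add_mem _ (Ideal.mul_mem_left _ (G.f D.π) h1)
      (Ideal.mul_mem_left _ (G.ρ ^ 2) h2)) (Ideal.mul_mem_left _ G.ρ h3)
    convert h4 using 1
    simp only [map_mul, map_pow, G.S_ρ, G.S_f, one_mul, ← G.ρ_pow]
    generalize G.S (G.S G.w) = b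
    generalize G.S G.w = a
    generalize G.f D.ζ = z at *
    linear_combination (-(G.ρ ^ 3 * (a + b))) * hζ - G.ρ ^ 3 * b * z * hz
  have hπ' : 3 * G.f (D.t D.π) * G.w ∈ G.I.map G.f := by
    have h2 := key G.ρ' G.ρ'_mem
    have h3 := key (G.ρ' ^ 2) (G.M.pow_mem G.ρ'_mem 2)
    have h4 := Ideal.add_mem _ (Ideal.add_mem _ (Ideal.mul_mem_left _ (G.f (D.t D.π)) h1)
      (Ideal.mul_mem_left _ (G.ρ' ^ 2) h2)) (Ideal.mul_mem_left _ G.ρ' h3)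
    convert h4 using 1
    simp only [map_mul, map_pow, G.S_ρ', G.S_f, one_mul, ← G.ρ'_pow]
    generalize G.S (G.S G.w) = b
    generalize G.S G.w = a
    generalize G.f D.ζ = z at *
    linear_combination (-(G.ρ' ^ 3 * (a + b))) * hζ
      - G.ρ' ^ 3 * (a * z + b * z + b * z ^ 2 * (z ^ 3 + 1)) * hz
  have hp1 : (p : B) * G.w ∈ G.I.map G.f := by
    have hη0 := key G.η G.η_mem
    have hη1 := key _ (G.S_mem _ G.η_mem)
    have hη2 := key _ (G.S_mem _ (G.S_mem _ G.η_mem))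
    obtain ⟨k, hk⟩ := D.p_odd
    have hpk : (p : B) = 18 * k + 1 := by rw [hk]; push_cast; rfl
    have h4 := Ideal.add_mem _ (Ideal.add_mem _ (Ideal.add_mem _ (Ideal.mul_mem_left _ G.η hη0)
      (Ideal.mul_mem_left _ (G.S G.η) hη1)) (Ideal.mul_mem_left _ (G.S (G.S G.η)) hη2))
      (Ideal.mul_mem_left _ (6 * (k : B)) h1)
    have h5 : G.η * G.S G.η + G.S G.η * G.S (G.S G.η) + G.S (G.S G.η) * G.η = - (6 * k) := by
      have := G.η_mul
      rw [hpk] at this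
      have h3 : (3 : B) ≠ 0 := by norm_num
      apply mul_left_cancel₀ h3
      linear_combination this
    have h6 := G.η_add
    convert h4 using 1
    simp only [map_mul, one_mul, G.S_S_S _ G.η_mem]
    rw [hpk]
    generalize G.S (G.S G.w) = b
    generalize G.S G.w = a
    generalize G.S (G.S G.η) = y2 at *
    generalize G.S G.η = y1 at *
    generalize G.η = y0 at *
    linear_combination (2 * G.w - a - b) * h5 + G.w * (1 - y0 - y1 - y2) * h6
  have h3 : ∃ u v : O, u * D.π + v * D.t D.π = 1 := by
    have := D.span_π_t_π
    rw [Ideal.eq_top_iff_one, Ideal.mem_span_pair] at this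
    exact this
  obtain ⟨u, v, huv⟩ := h3
  obtain ⟨k, hk⟩ := D.p_odd
  have hpk : (p : B) = 18 * k + 1 := by rw [hk]; push_cast; rfl
  have huv' : G.f u * G.f D.π + G.f v * G.f (D.t D.π) = 1 := by
    simpa using congrArg G.f huv
  have := Ideal.sub_mem _ hp1 (Ideal.mul_mem_left _ (6 * (k : B))
    (Ideal.add_mem _ (Ideal.mul_mem_left _ (G.f u) hπ) (Ideal.mul_mem_left _ (G.f v) hπ')))
  have e : G.w = p * G.w - 6 * (k : B) * (G.f u * (3 * G.f D.π * G.w) +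
      G.f v * (3 * G.f (D.t D.π) * G.w)) := by
    rw [hpk]
    linear_combination (18 * k * G.w) * huv'
  show G.w ∈ G.I.map G.f
  rw [e]
  exact this

/-- The invariant element generating the norm of `I`. -/
def nw : B := G.e * G.S (G.S G.e) ^ 2 + G.S G.e ^ 2 * G.S (G.S G.e) + G.e ^ 2 * G.S G.e - 3

theorem exists_nw : ∃ A, G.f A = G.nw := by
  have h1 := G.S_mem _ G.e_mem
  have h2 := G.S_mem _ h1
  apply G.exists_of_S_eq
  · exact G.M.sub_mem (G.M.add_mem (G.M.add_mem (G.M.mul_mem G.e_mem (G.M.pow_mem h2 2))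
      (G.M.mul_mem (G.M.pow_mem h1 2) h2)) (G.M.mul_mem (G.M.pow_mem G.e_mem 2) h1))
      (by exact_mod_cast natCast_mem G.M 3)
  · simp only [nw, map_sub, map_add, map_mul, map_pow, G.S_S_S _ G.e_mem, map_ofNat]; ring

theorem σ_w : G.σ G.w = 1 + G.f D.ζ ^ 2 * G.S G.e + G.f D.ζ * (G.e * G.S G.e) := by
  simp only [w, map_add, map_one, map_mul, G.σ_e, G.σ_S_e]
  linear_combination G.f D.ζ * (G.e * G.S G.e) * G.ζ_pow

theorem σ_σ_w : G.σ (G.σ G.w) = 1 + G.f D.ζ * G.S G.e + G.f D.ζ ^ 2 * (G.e * G.S G.e) := by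
  simp only [σ_w, map_add, map_one, map_mul, map_pow, G.σ_e, G.σ_S_e, G.σ_f, D.s_ζ]
  linear_combination (G.f D.ζ * G.S G.e + G.f D.ζ ^ 2 * (G.e * G.S G.e)) * G.ζ_pow

theorem w_norm : G.w * G.σ G.w * G.σ (G.σ G.w) = G.e * G.S G.e ^ 2 * G.nw := by
  rw [σ_σ_w, σ_w, w, nw]
  have h1 := G.ζ_eq
  have h2 := G.e_mul
  generalize G.f D.ζ = z at *
  generalize G.S (G.S G.e) = e2 at *
  generalize G.S G.e = e1 at *
  generalize G.e = e0 at *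
  grind

theorem S_σ_w : G.S (G.σ G.w) = G.f D.ζ ^ 2 * G.S (G.S G.e) * G.σ G.w := by
  simp only [σ_w, map_add, map_one, map_mul, map_pow, G.S_f]
  have h1 := G.ζ_pow
  have h2 := G.e_mul
  generalize G.f D.ζ = z at *
  generalize G.S (G.S G.e) = e2 at *
  generalize G.S G.e = e1 at *
  generalize G.e = e0 at *
  grind

theorem map_P : D.P.map G.f = Ideal.span {G.ρ} := by
  rw [P, Ideal.map_span, Set.image_pair]
  apply le_antisymm
  · rw [Ideal.span_le]
    rintro x (rfl | rfl)
    · exact Ideal.mem_span_singleton.2 ⟨G.ρ ^ 2, by rw [← G.ρ_pow]; ring⟩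
    · exact Ideal.mem_span_singleton.2 ⟨G.ρ', G.ρ_mul.symm⟩
  · rw [Ideal.span_singleton_le_iff_mem, Ideal.mem_span_pair]
    have := D.span_π_t_π
    rw [Ideal.eq_top_iff_one, Ideal.mem_span_pair] at this
    obtain ⟨u, v, huv⟩ := this
    have huv' : G.f u * G.f D.π + G.f v * G.f (D.t D.π) = 1 := by
      simpa using congrArg G.f huv
    refine ⟨G.f u * G.ρ, G.f v * G.ρ' ^ 2, ?_⟩
    rw [← G.ρ_mul]
    rw [← G.ρ'_pow] at huv'
    linear_combination G.ρ * huv'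

theorem nw_sub_mem : G.nw - (3 * (G.c - 1) : ℤ) ∈ G.Q := by
  have h1 := Ideal.mul_mem_left _ (G.e * G.S (G.S G.e)) G.S_S_e_sub
  have h2 := Ideal.mul_mem_left _ (G.S G.e * G.S (G.S G.e)) G.S_e_sub
  have h3 := Ideal.mul_mem_left _ (G.e * G.S G.e) G.e_sub
  have := Ideal.add_mem _ (Ideal.add_mem _ h1 h2) h3
  convert this using 1
  have h := G.e_mul
  rw [nw]; push_cast
  linear_combination (3 * (G.c : B)) * h

/-- The ideal needed to exclude a class group of type `(3, 3)`. -/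
theorem exists_ideal : ∃ I : Ideal O, I ≠ ⊥ ∧ D.sC (idealClass I) * D.cP = idealClass I ∧
    ∃ A, D.s A = A ∧ A ∉ D.P ∧ D.NI I = Ideal.span {A} ∧
      Ideal.Quotient.mk D.P A ^ ((p - 1) / 3) = 1 := by
  obtain ⟨A, hA⟩ := G.exists_nw
  have hres : A - (3 * (G.c - 1) : ℤ) ∈ D.P := G.Q_f _ (by
    rw [map_sub, hA, map_intCast]; exact G.nw_sub_mem)
  have hz3 : (3 : ZMod p) ≠ 0 := fun h => D.not_p_dvd_three (by
    rw [← ZMod.intCast_zmod_eq_zero_iff_dvd]; exact_mod_cast h)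
  have hc : (G.c : ZMod p) ^ 2 + G.c + 1 = 0 := by
    have := (ZMod.intCast_zmod_eq_zero_iff_dvd _ _).2 G.c_dvd
    exact_mod_cast this
  have hc1 : (G.c : ZMod p) - 1 ≠ 0 := fun h => by
    rw [sub_eq_zero.1 h] at hc
    exact hz3 (by linear_combination hc)
  have hAP : A ∉ D.P := fun h => by
    have h1 := Ideal.sub_mem _ h hres
    rw [sub_sub_cancel, D.intCast_mem_P, ← ZMod.intCast_zmod_eq_zero_iff_dvd] at h1
    push_cast at h1
    exact mul_ne_zero hz3 hc1 h1
  have hpow : Ideal.Quotient.mk D.P A ^ ((p - 1) / 3) = 1 := by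
    obtain ⟨k, hk⟩ := D.p_odd
    have h1 : (p - 1) / 3 = 6 * k := by omega
    have h2 : (3 * ((G.c : ZMod p) - 1)) ^ (6 * k) = 1 := by
      have e : 3 * ((G.c : ZMod p) - 1) = - G.c ^ 2 * (G.c - 1) ^ 3 := by
        linear_combination (3 * (G.c : ZMod p) - 3 - ((G.c : ZMod p) - 1) * (G.c - 1) * 0) * 0
          + ((G.c : ZMod p) ^ 3 - 4 * G.c ^ 2 + 6 * G.c - 3) * hc
      have hc3 : (G.c : ZMod p) ^ 3 = 1 := by linear_combination ((G.c : ZMod p) - 1) * hc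
      have h4 := ZMod.pow_card_sub_one_eq_one hc1
      rw [show p - 1 = 3 * (6 * k) by omega, pow_mul] at h4
      rw [e, mul_pow, h4, mul_one, show 6 * k = 2 * (3 * k) by ring, pow_mul, neg_sq, ← pow_mul,
        ← pow_mul, show 2 * (2 * (3 * k)) = 3 * (4 * k) by ring, pow_mul, hc3, one_pow]
    have h3 : Ideal.Quotient.mk D.P A = Ideal.Quotient.mk D.P ((3 * (G.c - 1) : ℤ) : O) :=
      Ideal.Quotient.eq.2 hres
    rw [h1, h3, ← map_pow, ← map_one (Ideal.Quotient.mk D.P), Ideal.Quotient.eq]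
    have h5 : (p : ℤ) ∣ (3 * (G.c - 1)) ^ (6 * k) - 1 := by
      rw [← ZMod.intCast_zmod_eq_zero_iff_dvd]
      push_cast
      rw [h2, sub_self]
    exact_mod_cast D.intCast_mem_P.2 h5
  have hA0 : A ≠ 0 := fun h => hAP (by rw [h]; exact D.P.zero_mem)
  have hnw0 : G.nw ≠ 0 := by
    rw [← hA]; exact fun h => hA0 (G.f_inj (by rw [h, map_zero]))
  have hw0 : G.w * G.σ G.w * G.σ (G.σ G.w) ≠ 0 := by
    rw [G.w_norm]
    have h := G.e_mul
    refine mul_ne_zero (mul_ne_zero (fun h' => ?_) (pow_ne_zero _ fun h' => ?_)) hnw0 <;>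
      simp [h'] at h
  have hI0 : G.I ≠ ⊥ := fun h => by
    have := G.map_I
    rw [h, Ideal.map_bot, eq_comm, Ideal.span_singleton_eq_bot] at this
    simp [this] at hw0
  have hσI : (G.I.map D.s).map G.f = Ideal.span {G.σ G.w} := by
    rw [G.map_map_s, G.map_I, Ideal.map_span, Set.image_singleton]
  have hσσI : ((G.I.map D.s).map D.s).map G.f = Ideal.span {G.σ (G.σ G.w)} := by
    rw [G.map_map_s, hσI, Ideal.map_span, Set.image_singleton]
  refine ⟨G.I, hI0, ?_, A, ?_, hAP, ?_, hpow⟩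
  · obtain ⟨a, ha⟩ : ∃ a, G.f a = G.w * G.S G.w * G.S (G.S G.w) := by
      have h0 := G.w_mem
      have h1 := G.S_mem _ h0
      have h2 := G.S_mem _ h1
      apply G.exists_of_S_eq _ (G.M.mul_mem (G.M.mul_mem h0 h1) h2)
      rw [map_mul, map_mul, G.S_S_S _ h0]; ring
    obtain ⟨b, hb⟩ : ∃ b, G.f b = G.σ G.w * G.ρ * G.S G.w * G.S (G.S G.w) := by
      have h0 := G.w_mem
      have h1 := G.S_mem _ h0
      have h2 := G.S_mem _ h1
      have h3 : G.σ G.w ∈ G.M := by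
        rw [G.σ_w]
        have := G.S_mem _ G.e_mem
        exact G.M.add_mem (G.M.add_mem G.M.one_mem (G.M.mul_mem (G.M.pow_mem (G.f_mem _) 2) this))
          (G.M.mul_mem (G.f_mem _) (G.M.mul_mem G.e_mem this))
      apply G.exists_of_S_eq _ (G.M.mul_mem (G.M.mul_mem (G.M.mul_mem h3 G.ρ_mem) h1) h2)
      rw [map_mul, map_mul, map_mul, G.S_S_S _ h0, G.S_σ_w, G.S_ρ]
      have h4 := G.S_w
      have h5 := G.ζ_pow
      generalize G.σ G.w = y at *
      rw [h4]
      linear_combination y * G.S (G.S G.e) * G.ρ * G.w * G.S (G.S (G.S G.e) * G.w) * h5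
    have hS0 : ∀ x, x ≠ 0 → G.S x ≠ 0 := fun x hx => by simpa using hx
    have hw := left_ne_zero_of_mul (left_ne_zero_of_mul hw0)
    have hσw := right_ne_zero_of_mul (left_ne_zero_of_mul hw0)
    have hρ : G.ρ ≠ 0 := fun h => by
      have h1 := G.ρ_mul
      rw [h, zero_mul, eq_comm, ← map_zero G.f] at h1
      exact D.θ_ne_zero (G.f_inj h1)
    have ha0 : a ≠ 0 := fun h => by
      rw [h, map_zero, eq_comm] at ha
      exact mul_ne_zero (mul_ne_zero hw (hS0 _ hw)) (hS0 _ (hS0 _ hw)) ha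
    have hb0 : b ≠ 0 := fun h => by
      rw [h, map_zero, eq_comm] at hb
      exact mul_ne_zero (mul_ne_zero (mul_ne_zero hσw hρ) (hS0 _ hw)) (hS0 _ (hS0 _ hw)) hb
    have hsI : G.I.map D.s ≠ ⊥ := D.map_s_ne_bot hI0
    rw [sC_idealClass, ← idealClass_P, ← idealClass_mul hsI D.P_ne_bot,
      idealClass_eq_iff (mul_ne_zero hsI D.P_ne_bot) hI0]
    refine ⟨a, ha0, b, hb0, ?_⟩
    refine G.map_inj (mul_ne_zero (mul_ne_zero hsI D.P_ne_bot) (by simpa using ha0))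
      (mul_ne_zero hI0 (by simpa using hb0)) ?_
    rw [Ideal.map_mul, Ideal.map_mul, Ideal.map_mul, hσI, G.map_P, G.map_I, Ideal.map_span,
      Ideal.map_span, Set.image_singleton, Set.image_singleton, ha, hb,
      Ideal.span_singleton_mul_span_singleton, Ideal.span_singleton_mul_span_singleton,
      Ideal.span_singleton_mul_span_singleton]
    congr 2
    ring
  · apply G.f_inj
    rw [← G.σ_f, hA]
    simp only [nw, map_sub, map_add, map_mul, map_pow, G.σ_e, G.σ_S_e, G.σ_S_S_e, map_ofNat]
    have h1 := G.ζ_pow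
    generalize G.f D.ζ = z at *
    linear_combination ((z ^ 3 + 1) * (G.e * G.S (G.S G.e) ^ 2 + G.S G.e ^ 2 * G.S (G.S G.e) + G.e ^ 2 * G.S G.e)) * h1
  · have hN0 : D.NI G.I ≠ ⊥ := D.NI_ne_bot hI0
    refine G.map_inj hN0 (by simpa using hA0) ?_
    rw [NI, Ideal.map_mul, Ideal.map_mul, G.map_I, hσI, hσσI, Ideal.span_singleton_mul_span_singleton,
      Ideal.span_singleton_mul_span_singleton, G.w_norm, Ideal.map_span, Set.image_singleton, hA]
    exact Ideal.span_singleton_mul_left_unit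
      (IsUnit.of_mul_eq_one (G.e * G.S (G.S G.e) ^ 2) (by linear_combination (1 + G.e * G.S G.e * G.S (G.S G.e)) * G.e_mul)) _

end GenusData

end PureCubicRing

namespace PureCubicRing

set_option linter.unusedSectionVars false

/-- An extension `B` of `O` which is large enough to contain the cubic Gauss sums: it is closed
under cube roots, contains the `p`-th roots of unity and is Galois over `O`. -/
structure LargeExtension {O : Type*} [CommRing O] [IsDedekindDomain O] [CharZero O]
    {p : ℕ} [hp : Fact p.Prime] (D : PureCubicRing O p) (B : Type*) [CommRing B] where
  f : O →+* B
  f_inj : Function.Injective f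
  exists_of_fixed : ∀ x, (∀ T : B ≃+* B, (∀ a, T (f a) = f a) → T x = x) → ∃ a, f a = x
  σ₀ : B ≃+* B
  σ₀_f : ∀ a, σ₀ (f a) = f (D.s a)
  z : B
  z_prim : IsPrimitiveRoot z p
  dvd_of_pow : ∀ x y : B, y ^ 3 ∣ x ^ 3 → y ∣ x
  Q : Ideal B
  Q_prime : Q.IsPrime
  Q_f : ∀ a, f a ∈ Q → a ∈ D.P
  f_Q : ∀ a ∈ D.P, f a ∈ Q

namespace LargeExtension

variable {O : Type*} [CommRing O] [IsDedekindDomain O] [CharZero O]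
  {p : ℕ} [hp : Fact p.Prime] {D : PureCubicRing O p} {B : Type*} [CommRing B] [IsDomain B]
  [CharZero B] (G : LargeExtension D B)

include G

/-- The additive character sending `1` to the chosen primitive root of unity. -/
def ψ : AddChar (ZMod p) B := AddChar.zmodChar p G.z_prim.pow_eq_one

theorem ψ_apply (a : ZMod p) : G.ψ a = G.z ^ a.val := rfl

theorem ψ_prim : G.ψ.IsPrimitive := AddChar.zmodChar_primitive_of_primitive_root p G.z_prim

/-- The cubic residue character with values in `B`. -/
def χ : MulChar (ZMod p) B := D.χ.ringHomComp G.f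

theorem χ_apply (a : ZMod p) : G.χ a = G.f (D.χ a) := rfl

theorem χ_ne : G.χ ≠ 1 := (MulChar.ringHomComp_ne_one_iff G.f_inj).2 D.χ_ne

theorem χ_mul_χ_ne : G.χ * G.χ ≠ 1 := by
  rw [χ, ← MulChar.ringHomComp_mul]
  exact (MulChar.ringHomComp_ne_one_iff G.f_inj).2 D.χ_mul_χ_ne

theorem χ_inv : G.χ⁻¹ = G.χ * G.χ := by
  rw [χ, MulChar.ringHomComp_inv, D.χ_inv, ← MulChar.ringHomComp_mul, pow_two]

theorem ζ_eq : G.f D.ζ ^ 2 + G.f D.ζ + 1 = 0 := by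
  simpa using congrArg G.f D.ζ_eq

theorem ζ_pow : G.f D.ζ ^ 3 = 1 := by
  simpa using congrArg G.f D.ζ_pow

theorem θ_ne_zero : G.f D.θ ≠ 0 := fun h => D.θ_ne_zero (G.f_inj (by rw [h, map_zero]))

theorem θ_pow : G.f D.θ ^ 3 = p := by rw [← map_pow, D.θ_pow, map_natCast]

/-- The cubic Gauss sum. -/
noncomputable def g : B := gaussSum G.χ G.ψ

/-- The conjugate cubic Gauss sum. -/
noncomputable def g' : B := gaussSum G.χ⁻¹ G.ψ

theorem χ_neg_one : G.χ⁻¹ (-1) = 1 := by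
  have h : (-1 : ZMod p) = (-1) ^ 3 := by norm_num
  rw [χ_inv, MulChar.mul_apply, χ_apply, h, map_pow, D.χ_apply_pow (by simp), map_one, one_mul]

theorem g_mul_g' : G.g * G.g' = p := by
  have h := gaussSum_mul_gaussSum_eq_card G.χ_ne G.ψ_prim
  rw [ZMod.card] at h
  rw [g, g', ← mul_gaussSum_inv_eq_gaussSum G.χ⁻¹, G.χ_neg_one, one_mul, h]

theorem g_pow : G.g ^ 3 = p * G.f D.π := by
  have h := jacobiSum_mul_nontrivial G.χ_mul_χ_ne G.ψ
  rw [← G.χ_inv, χ, jacobiSum_ringHomComp] at h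
  rw [← G.g_mul_g', π]
  change G.g' * _ = G.g * G.g at h
  linear_combination (-G.g) * h

theorem g'_pow : G.g' ^ 3 = p * G.f (D.t D.π) := by
  have h0 : G.χ⁻¹ * G.χ⁻¹ = G.χ := by
    rw [inv_mul_eq_iff_eq_mul, inv_eq_iff_mul_eq_one, ← G.χ_inv, mul_inv_cancel]
  have h := jacobiSum_mul_nontrivial (χ := G.χ⁻¹) (φ := G.χ⁻¹) (by rw [h0]; exact G.χ_ne) G.ψ
  rw [h0, χ, MulChar.ringHomComp_inv, jacobiSum_ringHomComp, ← D.t_π, ← MulChar.ringHomComp_inv] at h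
  rw [← G.g_mul_g']
  change G.g * _ = G.g' * G.g' at h
  linear_combination (-G.g') * h

theorem exists_ρ : ∃ ρ, G.g = G.f D.θ * ρ :=
  G.dvd_of_pow _ _ ⟨G.f D.π, by rw [G.g_pow, G.θ_pow]⟩

theorem exists_ρ' : ∃ ρ, G.g' = G.f D.θ * ρ :=
  G.dvd_of_pow _ _ ⟨G.f (D.t D.π), by rw [G.g'_pow, G.θ_pow]⟩

/-- A cube root of the Jacobi sum. -/
noncomputable def ρ : B := G.exists_ρ.choose

/-- A cube root of the conjugate Jacobi sum. -/
noncomputable def ρ' : B := G.exists_ρ'.choose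

theorem g_eq : G.g = G.f D.θ * G.ρ := G.exists_ρ.choose_spec

theorem g'_eq : G.g' = G.f D.θ * G.ρ' := G.exists_ρ'.choose_spec

theorem ρ_pow : G.ρ ^ 3 = G.f D.π := by
  have := G.g_pow
  rw [g_eq, mul_pow, ← G.θ_pow] at this
  exact mul_left_cancel₀ (pow_ne_zero 3 G.θ_ne_zero) this

theorem ρ'_pow : G.ρ' ^ 3 = G.f (D.t D.π) := by
  have := G.g'_pow
  rw [g'_eq, mul_pow, ← G.θ_pow] at this
  exact mul_left_cancel₀ (pow_ne_zero 3 G.θ_ne_zero) this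

theorem ρ_mul : G.ρ * G.ρ' = G.f D.θ := by
  have := G.g_mul_g'
  rw [g_eq, g'_eq, ← G.θ_pow] at this
  apply mul_left_cancel₀ (pow_ne_zero 2 G.θ_ne_zero)
  linear_combination this

theorem ρ_ne_zero : G.ρ ≠ 0 := fun h => by
  have := G.ρ_mul
  rw [h, zero_mul] at this
  exact G.θ_ne_zero this.symm

/-- Every automorphism of `B` raises the roots of unity to some power. -/
theorem exists_exponent (T : B ≃+* B) : ∃ n : (ZMod p)ˣ, ∀ a, T (G.ψ a) = G.ψ (n * a) := by
  have h1 : T G.z ^ p = 1 := by rw [← map_pow, G.z_prim.pow_eq_one, map_one]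
  obtain ⟨i, -, hi⟩ := G.z_prim.eq_pow_of_pow_eq_one h1
  have hT : ∀ a, T (G.ψ a) = G.ψ ((i : ZMod p) * a) := fun a => by
    rw [ψ_apply, map_pow, ← hi, ← pow_mul]
    conv_rhs => rw [← ZMod.natCast_zmod_val a]
    rw [← Nat.cast_mul, ψ, AddChar.zmodChar_apply']
  have h0 : (i : ZMod p) ≠ 0 := fun h0 => by
    have h2 := hT 1
    rw [h0, zero_mul, AddChar.map_zero_eq_one, ← map_one T] at h2
    have h3 := T.injective h2
    rw [ψ_apply] at h3
    have : Fact (1 < p) := ⟨hp.out.one_lt⟩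
    rw [ZMod.val_one, pow_one] at h3
    exact G.z_prim.ne_one hp.out.one_lt h3
  exact ⟨Units.mk0 _ h0, hT⟩

/-- A gaussian period. -/
noncomputable def per (x : O) : B := by
  classical exact ∑ a : ZMod p with D.χ a = x, G.ψ a

/-- A product of cyclotomic numbers. -/
noncomputable def cyc (x : O) : B := by
  classical exact ∏ a : ZMod p with D.χ a = x, (1 - G.ψ a)

theorem map_per {T : B ≃+* B} {n : (ZMod p)ˣ} (h : ∀ a, T (G.ψ a) = G.ψ (n * a)) (x : O) :
    T (G.per x) = G.per (D.χ n * x) := by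
  classical
  rw [per, per, map_sum]
  have hn := IsUnit.map D.χ n.isUnit
  apply Finset.sum_bij (fun a _ => (n : ZMod p) * a)
  · intro a ha
    simp only [Finset.mem_filter, Finset.mem_univ, true_and] at ha ⊢
    rw [map_mul, ha]
  · intro a _ b _ hab; exact n.isUnit.mul_left_cancel hab
  · intro b hb
    refine ⟨((n⁻¹ : (ZMod p)ˣ) : ZMod p) * b, ?_, Units.mul_inv_cancel_left n b⟩
    simp only [Finset.mem_filter, Finset.mem_univ, true_and] at hb ⊢
    apply hn.mul_left_cancel
    rw [← map_mul, Units.mul_inv_cancel_left, hb]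
  · intro a _; exact h a

theorem map_cyc {T : B ≃+* B} {n : (ZMod p)ˣ} (h : ∀ a, T (G.ψ a) = G.ψ (n * a)) (x : O) :
    T (G.cyc x) = G.cyc (D.χ n * x) := by
  classical
  rw [cyc, cyc, map_prod]
  have hn := IsUnit.map D.χ n.isUnit
  apply Finset.prod_bij (fun a _ => (n : ZMod p) * a)
  · intro a ha
    simp only [Finset.mem_filter, Finset.mem_univ, true_and] at ha ⊢
    rw [map_mul, ha]
  · intro a _ b _ hab; exact n.isUnit.mul_left_cancel hab
  · intro b hb
    refine ⟨((n⁻¹ : (ZMod p)ˣ) : ZMod p) * b, ?_, Units.mul_inv_cancel_left n b⟩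
    simp only [Finset.mem_filter, Finset.mem_univ, true_and] at hb ⊢
    apply hn.mul_left_cancel
    rw [← map_mul, Units.mul_inv_cancel_left, hb]
  · intro a _; rw [map_sub, map_one, h a]

theorem map_g {T : B ≃+* B} {n : (ZMod p)ˣ} (h : ∀ a, T (G.ψ a) = G.ψ (n * a))
    (hT : ∀ a, T (G.f (D.χ a)) = G.f (D.χ a)) : G.f (D.χ n) * T G.g = G.g := by
  have : T G.g = gaussSum G.χ (G.ψ.mulShift n) := by
    rw [g, gaussSum, gaussSum, map_sum]
    refine Finset.sum_congr rfl fun a _ => ?_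
    rw [map_mul, h, AddChar.mulShift_apply, χ_apply, hT]
  rw [this, ← χ_apply, gaussSum_mulShift, g]

theorem per_eq (x : O) [DecidableEq O] : G.per x = ∑ a, if D.χ a = x then G.ψ a else 0 := by
  rw [per, ← Finset.sum_filter]
  congr!

theorem ζ_ne_one' : D.ζ ^ 2 ≠ 1 ∧ D.ζ ^ 2 ≠ D.ζ := by
  have h := D.ζ_eq
  have h1 := D.ζ_ne_one
  have h2 := D.ζ_ne_zero
  constructor <;> intro h3
  · rw [h3] at h
    have : D.ζ = -2 := by linear_combination h
    rw [this] at h3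
    norm_num at h3
  · apply h1
    apply mul_left_cancel₀ h2
    linear_combination h3

theorem χ_cases (a : ZMod p) :
    (a = 0 ∧ D.χ a ≠ 1 ∧ D.χ a ≠ D.ζ ∧ D.χ a ≠ D.ζ ^ 2 ∧ D.χ a = 0) ∨
    (a ≠ 0 ∧ D.χ a = 1 ∧ D.χ a ≠ D.ζ ∧ D.χ a ≠ D.ζ ^ 2) ∨
    (a ≠ 0 ∧ D.χ a ≠ 1 ∧ D.χ a = D.ζ ∧ D.χ a ≠ D.ζ ^ 2) ∨
    (a ≠ 0 ∧ D.χ a ≠ 1 ∧ D.χ a ≠ D.ζ ∧ D.χ a = D.ζ ^ 2) := by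
  have h1 := D.ζ_ne_one
  have h2 := D.ζ_ne_zero
  obtain ⟨h3, h4⟩ := G.ζ_ne_one'
  by_cases ha : a = 0
  · left
    have : D.χ a = 0 := by rw [ha]; exact D.χ.map_zero
    exact ⟨ha, by rw [this]; exact zero_ne_one, by rw [this]; exact h2.symm,
      by rw [this]; exact (pow_ne_zero 2 h2).symm, this⟩
  · right
    have h0 := D.χ_apply_pow ha
    rcases D.χ_apply a with h | h | h | h
    · rw [h] at h0; norm_num at h0
    · exact Or.inl ⟨ha, h, by rw [h]; exact h1.symm, by rw [h]; exact h3.symm⟩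
    · exact Or.inr (Or.inl ⟨ha, by rw [h]; exact h1, h, by rw [h]; exact h4.symm⟩)
    · exact Or.inr (Or.inr ⟨ha, by rw [h]; exact h3, by rw [h]; exact h4, h⟩)

theorem sum_per : G.per 1 + G.per D.ζ + G.per (D.ζ ^ 2) = -1 := by
  classical
  have h : ∑ a, G.ψ a = 0 := AddChar.sum_eq_zero_of_ne_one (by
    simpa using G.ψ_prim one_ne_zero)
  have h1 : (1 : B) = ∑ a : ZMod p, if a = 0 then 1 else 0 := by simp
  rw [eq_neg_iff_add_eq_zero, h1, per_eq, per_eq, per_eq, ← Finset.sum_add_distrib,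
    ← Finset.sum_add_distrib, ← Finset.sum_add_distrib]
  refine Eq.trans ?_ h
  refine Finset.sum_congr rfl fun a _ => ?_
  rcases G.χ_cases a with ⟨h1, h2, h3, h4, -⟩ | ⟨h1, h2, h3, h4⟩ | ⟨h1, h2, h3, h4⟩ | ⟨h1, h2, h3, h4⟩
  · rw [if_neg h2, if_neg h3, if_neg h4, if_pos h1, h1, AddChar.map_zero_eq_one]; ring
  · rw [if_pos h2, if_neg h3, if_neg h4, if_neg h1]; ring
  · rw [if_neg h2, if_pos h3, if_neg h4, if_neg h1]; ring
  · rw [if_neg h2, if_neg h3, if_pos h4, if_neg h1]; ring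

theorem g_eq_per : G.g = G.per 1 + G.f D.ζ * G.per D.ζ + G.f D.ζ ^ 2 * G.per (D.ζ ^ 2) := by
  classical
  rw [per_eq, per_eq, per_eq, Finset.mul_sum, Finset.mul_sum, ← Finset.sum_add_distrib,
    ← Finset.sum_add_distrib, g, gaussSum]
  refine Finset.sum_congr rfl fun a _ => ?_
  rw [χ_apply]
  rcases G.χ_cases a with ⟨h1, h2, h3, h4, h5⟩ | ⟨h1, h2, h3, h4⟩ | ⟨h1, h2, h3, h4⟩ | ⟨h1, h2, h3, h4⟩
  · rw [if_neg h2, if_neg h3, if_neg h4, h5, map_zero]; ring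
  · rw [if_pos h2, if_neg h3, if_neg h4, h2, map_one]; ring
  · rw [if_neg h2, if_pos h3, if_neg h4, h3]; ring
  · rw [if_neg h2, if_neg h3, if_pos h4, h4, map_pow]; ring

theorem g'_eq_per : G.g' = G.per 1 + G.f D.ζ ^ 2 * G.per D.ζ + G.f D.ζ * G.per (D.ζ ^ 2) := by
  classical
  rw [per_eq, per_eq, per_eq, Finset.mul_sum, Finset.mul_sum, ← Finset.sum_add_distrib,
    ← Finset.sum_add_distrib, g', gaussSum]
  refine Finset.sum_congr rfl fun a _ => ?_
  rw [χ_inv, MulChar.mul_apply, χ_apply]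
  rcases G.χ_cases a with ⟨h1, h2, h3, h4, h5⟩ | ⟨h1, h2, h3, h4⟩ | ⟨h1, h2, h3, h4⟩ | ⟨h1, h2, h3, h4⟩
  · rw [if_neg h2, if_neg h3, if_neg h4, h5, map_zero]; ring
  · rw [if_pos h2, if_neg h3, if_neg h4, h2, map_one]; ring
  · rw [if_neg h2, if_pos h3, if_neg h4, h3]; ring
  · rw [if_neg h2, if_neg h3, if_pos h4, h4, map_pow]
    linear_combination (G.f D.ζ * G.ψ a) * G.ζ_pow

theorem per_mul : 3 * (G.per 1 * G.per D.ζ + G.per D.ζ * G.per (D.ζ ^ 2) +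
    G.per (D.ζ ^ 2) * G.per 1) = 1 - p := by
  have h1 := G.sum_per
  have h2 := G.g_mul_g'
  have h3 := G.ζ_eq
  rw [g_eq_per, g'_eq_per] at h2
  generalize G.f D.ζ = z at *
  rw [← h2]
  generalize G.per 1 = a at *
  generalize G.per D.ζ = b at *
  generalize G.per (D.ζ ^ 2) = c at *
  grind

theorem cyc_eq (x : O) [DecidableEq O] :
    G.cyc x = ∏ a, if D.χ a = x then 1 - G.ψ a else 1 := by
  rw [cyc, ← Finset.prod_filter]
  congr!

theorem prod_cyc : G.cyc 1 * G.cyc D.ζ * G.cyc (D.ζ ^ 2) = p := by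
  classical
  obtain ⟨m, hm⟩ : ∃ m, p = m + 1 := ⟨p - 1, by have := hp.out.pos; omega⟩
  have h : ∏ a : ZMod p, (if a = 0 then 1 else 1 - G.ψ a) = p := by
    have hz : IsPrimitiveRoot G.z (m + 1) := hm ▸ G.z_prim
    have h1 := hz.prod_one_sub_pow_eq_order
    rw [show ((p : ℕ) : B) = m + 1 by rw [hm]; push_cast; rfl, ← h1]
    have h2 : ∀ a : ZMod p, (if a = 0 then 1 else 1 - G.ψ a) = if a ≠ 0 then 1 - G.ψ a else 1 :=
      fun a => by simp
    simp_rw [h2]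
    rw [← Finset.prod_filter]
    symm
    apply Finset.prod_bij (fun k _ => ((k + 1 : ℕ) : ZMod p))
    · intro k hk
      simp only [Finset.mem_filter, Finset.mem_univ, true_and, Finset.mem_range] at hk ⊢
      rw [Ne, ZMod.natCast_eq_zero_iff]
      exact Nat.not_dvd_of_pos_of_lt (by omega) (by omega)
    · intro a ha b hb hab
      rw [Finset.mem_range] at ha hb
      rw [ZMod.natCast_eq_natCast_iff', Nat.mod_eq_of_lt (by omega), Nat.mod_eq_of_lt (by omega)]
        at hab
      omega
    · intro b hb
      simp only [Finset.mem_filter, Finset.mem_univ, true_and] at hb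
      have h3 : b.val ≠ 0 := fun h => hb ((ZMod.val_eq_zero b).1 h)
      have h4 := ZMod.val_lt b
      refine ⟨b.val - 1, by rw [Finset.mem_range]; omega, ?_⟩
      rw [Nat.sub_add_cancel (by omega), ZMod.natCast_zmod_val]
    · intro k _
      rw [ψ, AddChar.zmodChar_apply']
  rw [cyc_eq, cyc_eq, cyc_eq, ← Finset.prod_mul_distrib, ← Finset.prod_mul_distrib, ← h]
  refine Finset.prod_congr rfl fun a _ => ?_
  rcases G.χ_cases a with ⟨h1, h2, h3, h4, -⟩ | ⟨h1, h2, h3, h4⟩ | ⟨h1, h2, h3, h4⟩ | ⟨h1, h2, h3, h4⟩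
  · rw [if_neg h2, if_neg h3, if_neg h4, if_pos h1]; ring
  · rw [if_pos h2, if_neg h3, if_neg h4, if_neg h1]; ring
  · rw [if_neg h2, if_pos h3, if_neg h4, if_neg h1]; ring
  · rw [if_neg h2, if_neg h3, if_pos h4, if_neg h1]; ring

theorem exists_S (h : D.cP ≠ 1) : ∃ S : B ≃+* B, (∀ a, S (G.f a) = G.f a) ∧
    S G.ρ = G.f D.ζ * G.ρ := by
  have h1 : ∃ T : B ≃+* B, (∀ a, T (G.f a) = G.f a) ∧ T G.ρ ≠ G.ρ := by
    by_contra! hcon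
    obtain ⟨r, hr⟩ := G.exists_of_fixed _ hcon
    apply h
    rw [D.cP_eq_one_iff]
    refine ⟨r, ?_⟩
    have h2 : r ^ 3 = D.π := G.f_inj (by rw [map_pow, hr, G.ρ_pow])
    have h3 : Ideal.span {r} ^ 3 = D.P ^ 3 := by rw [Ideal.span_singleton_pow, h2, D.P_pow]
    exact pow_left_injective (n := 3) (by norm_num) h3
  obtain ⟨T, hT, hρ⟩ := h1
  have h2 : (T G.ρ - G.ρ) * ((T G.ρ - G.f D.ζ * G.ρ) * (T G.ρ - G.f D.ζ ^ 2 * G.ρ)) = 0 := by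
    have h3 : T G.ρ ^ 3 = G.ρ ^ 3 := by rw [← map_pow, G.ρ_pow, hT]
    have h4 := G.ζ_eq
    generalize T G.ρ = x at *
    generalize G.f D.ζ = z at *
    linear_combination h3 + (-(x - G.ρ) * G.ρ * x + (x - G.ρ) * G.ρ ^ 2 * (z - 1)) * h4
  rcases mul_eq_zero.1 h2 with h3 | h3
  · exact absurd (sub_eq_zero.1 h3) hρ
  · rcases mul_eq_zero.1 h3 with h3 | h3
    · exact ⟨T, hT, sub_eq_zero.1 h3⟩
    · refine ⟨T.trans T, fun a => by simp [hT], ?_⟩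
      have h4 := sub_eq_zero.1 h3
      simp only [RingEquiv.trans_apply, h4, map_mul, map_pow, hT]
      linear_combination G.f D.ζ * G.ρ * G.ζ_pow

theorem χ_exponent_of_ρ {T : B ≃+* B} (hT : ∀ a, T (G.f a) = G.f a) {n : (ZMod p)ˣ}
    (hn : ∀ a, T (G.ψ a) = G.ψ (n * a)) {x : O} (hx : T G.ρ = G.f x * G.ρ) : D.χ n * x = 1 := by
  have h := G.map_g hn fun a => hT _
  rw [g_eq, map_mul, hT, hx] at h
  apply G.f_inj
  rw [map_mul, map_one]
  apply mul_left_cancel₀ (mul_ne_zero G.θ_ne_zero G.ρ_ne_zero)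
  linear_combination h

theorem exists_σ {S : B ≃+* B} (hS : ∀ a, S (G.f a) = G.f a) {v : (ZMod p)ˣ}
    (hv : ∀ a, S (G.ψ a) = G.ψ (v * a)) (hχ : D.χ v = D.ζ ^ 2) :
    ∃ (σ : B ≃+* B) (u : (ZMod p)ˣ), (∀ a, σ (G.f a) = G.f (D.s a)) ∧
      (∀ a, σ (G.ψ a) = G.ψ (u * a)) ∧ D.χ u = 1 := by
  obtain ⟨u, hu⟩ := G.exists_exponent G.σ₀
  have h3 := D.ζ_pow
  rcases G.χ_cases u with ⟨h, -⟩ | ⟨-, h, -⟩ | ⟨-, -, h, -⟩ | ⟨-, -, -, h⟩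
  · exact absurd h u.ne_zero
  · exact ⟨G.σ₀, u, G.σ₀_f, hu, h⟩
  · refine ⟨S.trans G.σ₀, u * v, fun a => by simp [hS, G.σ₀_f], fun a => ?_, ?_⟩
    · rw [RingEquiv.trans_apply, hv, hu, Units.val_mul, mul_assoc]
    · rw [Units.val_mul, map_mul, h, hχ]; linear_combination h3
  · refine ⟨(S.trans S).trans G.σ₀, u * (v * v), fun a => by simp [hS, G.σ₀_f], fun a => ?_, ?_⟩
    · rw [RingEquiv.trans_apply, RingEquiv.trans_apply, hv, hv, hu, Units.val_mul, Units.val_mul,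
        mul_assoc, mul_assoc]
    · rw [Units.val_mul, Units.val_mul, map_mul, map_mul, h, hχ]
      linear_combination (D.ζ ^ 3 + 1) * h3

theorem ψ_sub_one_mem (a : ZMod p) : G.ψ a - 1 ∈ G.Q := by
  obtain ⟨r, hr⟩ := exists_add_pow_prime_eq hp.out (G.ψ a - 1) 1
  have h1 : G.ψ a ^ p = 1 := by
    rw [ψ_apply, ← pow_mul, mul_comm, pow_mul, G.z_prim.pow_eq_one, one_pow]
  rw [sub_add_cancel, one_pow, h1] at hr
  have h2 : (G.ψ a - 1) ^ p = p * (-((G.ψ a - 1) * r)) := by linear_combination -hr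
  have h3 : (p : B) ∈ G.Q := by simpa using G.f_Q _ D.p_mem
  exact G.Q_prime.mem_of_pow_mem _ (h2 ▸ Ideal.mul_mem_right _ _ h3)

open Classical in
/-- The quotient of two products of cyclotomic numbers. -/
noncomputable def quo (i : ℕ) : B :=
  ∏ a : ZMod p with D.χ a = 1, ∑ j ∈ Finset.range i, G.ψ a ^ j

open Classical in
/-- The number of cubic residues modulo `p`. -/
noncomputable def num (_ : LargeExtension D B) : ℕ := (Finset.univ.filter fun a : ZMod p => D.χ a = 1).card

theorem cyc_mul_quo (v : (ZMod p)ˣ) :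
    G.cyc 1 * G.quo (v : ZMod p).val = G.cyc (D.χ v) := by
  classical
  rw [cyc, quo, ← Finset.prod_mul_distrib, cyc]
  have hn := IsUnit.map D.χ v.isUnit
  apply Finset.prod_bij (fun a _ => (v : ZMod p) * a)
  · intro a ha
    simp only [Finset.mem_filter, Finset.mem_univ, true_and] at ha ⊢
    rw [map_mul, ha, mul_one]
  · intro a _ b _ hab; exact v.isUnit.mul_left_cancel hab
  · intro b hb
    refine ⟨((v⁻¹ : (ZMod p)ˣ) : ZMod p) * b, ?_, Units.mul_inv_cancel_left v b⟩
    simp only [Finset.mem_filter, Finset.mem_univ, true_and] at hb ⊢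
    apply hn.mul_left_cancel
    rw [← map_mul, Units.mul_inv_cancel_left, hb, mul_one]
  · intro a _
    rw [mul_neg_geom_sum, ← AddChar.map_nsmul_eq_pow, nsmul_eq_mul, ZMod.natCast_zmod_val]

theorem map_quo_sub_mem {T : B ≃+* B} {n : (ZMod p)ˣ} (h : ∀ a, T (G.ψ a) = G.ψ (n * a)) (i : ℕ) :
    T (G.quo i) - (i : B) ^ G.num ∈ G.Q := by
  classical
  rw [← Ideal.Quotient.eq, quo, map_prod, map_prod, map_pow, num, ← Finset.prod_const]
  refine Finset.prod_congr rfl fun a _ => ?_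
  have h1 : ∀ b, Ideal.Quotient.mk G.Q (G.ψ b) = 1 := fun b => by
    rw [← map_one (Ideal.Quotient.mk G.Q), Ideal.Quotient.eq]; exact G.ψ_sub_one_mem b
  simp [map_sum, map_pow, h, h1]

theorem pow_num_ne_one {v : (ZMod p)ˣ} (hv : D.χ v ≠ 1) : (v : ZMod p) ^ G.num ≠ 1 := by
  classical
  intro h
  set H := (Finset.univ.filter fun a : ZMod p => D.χ a = 1) with hH
  have hne : ∀ a ∈ H, a ≠ 0 := fun a ha h0 => by
    rw [hH, Finset.mem_filter, h0] at ha
    have h1 : D.χ 0 = 0 := D.χ.map_zero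
    rw [h1] at ha
    exact zero_ne_one ha.2
  have hpos : 0 < G.num := Finset.card_pos.2 ⟨1, by simp⟩
  have h1 : H ⊆ (Polynomial.nthRoots G.num (1 : ZMod p)).toFinset := fun a ha => by
    rw [Multiset.mem_toFinset, Polynomial.mem_nthRoots hpos]
    have h2 : ∏ b ∈ H, a * b = ∏ b ∈ H, b := by
      apply Finset.prod_bij (fun b _ => a * b)
      · intro b hb
        rw [hH, Finset.mem_filter] at ha hb ⊢
        exact ⟨Finset.mem_univ _, by rw [map_mul, ha.2, hb.2, one_mul]⟩
      · intro x _ y _ hxy; exact mul_left_cancel₀ (hne a ha) hxy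
      · intro b hb
        refine ⟨a⁻¹ * b, ?_, mul_inv_cancel_left₀ (hne a ha) b⟩
        rw [hH, Finset.mem_filter] at ha hb ⊢
        refine ⟨Finset.mem_univ _, ?_⟩
        have := congrArg D.χ (mul_inv_cancel_left₀ (hne a (by rw [hH, Finset.mem_filter]; exact ha)) b)
        rwa [map_mul, ha.2, one_mul, hb.2] at this
      · intro b _; rfl
    rw [Finset.prod_mul_distrib, Finset.prod_const] at h2
    exact mul_right_cancel₀ (Finset.prod_ne_zero_iff.2 hne) (h2.trans (one_mul _).symm)
  have h2 := Finset.eq_of_subset_of_card_le h1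
    ((Multiset.toFinset_card_le _).trans (Polynomial.card_nthRoots _ _))
  have h3 : (v : ZMod p) ∈ H := by rw [h2, Multiset.mem_toFinset, Polynomial.mem_nthRoots hpos, h]
  rw [hH, Finset.mem_filter] at h3
  exact hv h3.2

theorem exists_genusData (h : D.cP ≠ 1) : Nonempty (GenusData D B) := by
  obtain ⟨S, hS, hρ⟩ := G.exists_S h
  obtain ⟨v, hv⟩ := G.exists_exponent S
  have hz := D.ζ_pow
  have hχv : D.χ v = D.ζ ^ 2 := by
    linear_combination D.ζ ^ 2 * G.χ_exponent_of_ρ hS hv hρ - D.χ v * hz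
  obtain ⟨σ, u, hσ, hu, hχu⟩ := G.exists_σ hS hv hχv
  let M : Subring B :=
    { carrier := {x | ∀ T : B ≃+* B, (∀ a, T (G.f a) = G.f a) → T G.ρ = G.ρ → T x = x}
      mul_mem' := fun hx hy T hT hTρ => by rw [map_mul, hx T hT hTρ, hy T hT hTρ]
      one_mem' := fun T _ _ => map_one T
      add_mem' := fun hx hy T hT hTρ => by rw [map_add, hx T hT hTρ, hy T hT hTρ]
      zero_mem' := fun T _ _ => map_zero T
      neg_mem' := fun hx T hT hTρ => by rw [map_neg, hx T hT hTρ] }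
  have hfz := G.ζ_pow
  have hSSS : S (S (S G.ρ)) = G.ρ := by
    rw [hρ, map_mul, hS, hρ, map_mul, map_mul, hS, hρ]
    linear_combination G.ρ * hfz
  have hfix : ∀ T : B ≃+* B, (∀ a, T (G.f a) = G.f a) → T G.ρ = G.ρ →
      ∃ n : (ZMod p)ˣ, (∀ a, T (G.ψ a) = G.ψ (n * a)) ∧ D.χ n = 1 := fun T hT hTρ => by
    obtain ⟨n, hn⟩ := G.exists_exponent T
    refine ⟨n, hn, ?_⟩
    have := G.χ_exponent_of_ρ hT hn (x := 1) (by rw [hTρ, map_one, one_mul])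
    rwa [mul_one] at this
  have hSS : ∀ a, (S.trans S) (G.ψ a) = G.ψ ((v * v : (ZMod p)ˣ) * a) := fun a => by
    rw [RingEquiv.trans_apply, hv, hv, Units.val_mul, mul_assoc]
  have hSper : S (G.per 1) = G.per (D.ζ ^ 2) := by rw [G.map_per hv, hχv, mul_one]
  have hSSper : S (S (G.per 1)) = G.per D.ζ := by
    rw [hSper, G.map_per hv, hχv]; congr 1; linear_combination D.ζ * hz
  have hScyc : S (G.cyc 1) = G.cyc (D.ζ ^ 2) := by rw [G.map_cyc hv, hχv, mul_one]
  have hSScyc : S (G.cyc (D.ζ ^ 2)) = G.cyc D.ζ := by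
    rw [G.map_cyc hv, hχv]; congr 1; linear_combination D.ζ * hz
  have hσcyc : ∀ x, σ (G.cyc x) = G.cyc x := fun x => by rw [G.map_cyc hu, hχu, one_mul]
  have hp0 : (p : B) ≠ 0 := Nat.cast_ne_zero.2 hp.out.ne_zero
  have hprod := G.prod_cyc
  have hc0 : G.cyc 1 ≠ 0 := fun h0 => by simp [h0] at hprod; exact hp0 hprod.symm
  set i := (v : ZMod p).val with hi
  set q := G.quo i with hq
  have hmul : G.cyc 1 * q = G.cyc (D.ζ ^ 2) := by rw [hq, hi, G.cyc_mul_quo, hχv]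
  have hmul2 : G.cyc (D.ζ ^ 2) * S q = G.cyc D.ζ := by
    rw [← hSScyc, ← hmul, map_mul, hScyc, hmul]
  have hmul3 : G.cyc D.ζ * S (S q) = G.cyc 1 := by
    have h1 := congrArg S hmul2
    rw [map_mul, hSScyc, G.map_cyc hv, hχv] at h1
    rw [h1]; congr 1; linear_combination hz
  have hq1 : q * S q * S (S q) = 1 := by
    apply mul_left_cancel₀ hc0
    linear_combination (S q * S (S q)) * hmul + S (S q) * hmul2 + hmul3
  obtain ⟨e, he⟩ : G.f D.θ ∣ G.cyc 1 := G.dvd_of_pow _ _ ⟨S q * S (S q) ^ 2, by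
    rw [G.θ_pow, ← hprod, ← hmul2, ← hmul]
    linear_combination (-G.cyc 1 ^ 3 * (1 + q * S q * S (S q))) * hq1⟩
  have hSe : S e = q * e := by
    apply mul_left_cancel₀ G.θ_ne_zero
    have := hScyc
    rw [he, map_mul, hS, ← hmul, he] at this
    linear_combination this
  have hSSe : S (S e) = S q * S e := by rw [hSe, map_mul, ← hSe]
  have hSSSe : S (S (S e)) = e := by
    rw [hSSe, map_mul, hSSe, hSe]
    linear_combination e * hq1
  have hemul : e * S e * S (S e) = 1 := by
    rw [hSSe, hSe]
    apply mul_left_cancel₀ (pow_ne_zero 3 G.θ_ne_zero)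
    have h1 := hprod
    rw [← hmul2, ← hmul, he, ← G.θ_pow] at h1
    linear_combination h1
  have hcSe : G.cyc (D.ζ ^ 2) = G.f D.θ * S e := by rw [← hScyc, he, map_mul, hS]
  have hcSSe : G.cyc D.ζ = G.f D.θ * S (S e) := by rw [← hSScyc, hcSe, map_mul, hS]
  have hσe : ∀ x y, G.cyc x = G.f D.θ * y → σ y = G.f D.ζ ^ 2 * y := fun x y hxy => by
    have h1 := hσcyc x
    rw [hxy, map_mul, hσ, D.s_θ, map_mul] at h1
    apply mul_left_cancel₀ G.θ_ne_zero
    linear_combination G.f D.ζ ^ 2 * h1 - G.f D.θ * σ y * hfz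
  have hid : ∀ a, (RingEquiv.refl B) (G.ψ a) = G.ψ ((1 : (ZMod p)ˣ) * a) := fun a => by simp
  have hq0 : q - (i : B) ^ G.num ∈ G.Q := G.map_quo_sub_mem hid i
  have hq1' : S q - (i : B) ^ G.num ∈ G.Q := G.map_quo_sub_mem hv i
  have hq2 : S (S q) - (i : B) ^ G.num ∈ G.Q := G.map_quo_sub_mem hSS i
  have hcast : (((i : ℤ) ^ G.num : ℤ) : B) = (i : B) ^ G.num := by push_cast; rfl
  refine ⟨{
    f := G.f
    f_inj := G.f_inj
    exists_of_mul := fun x a b hb hx => G.exists_of_fixed x fun T hT => ?_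
    S := S
    σ := σ
    M := M
    ρ := G.ρ
    ρ' := G.ρ'
    η := G.per 1
    e := e
    Q := G.Q
    c := (i : ℤ) ^ G.num
    S_f := hS
    σ_f := hσ
    f_mem := fun a T hT _ => hT a
    S_mem := fun x hx T hT hTρ => ?_
    S_S_S := fun x hx => hx ((S.trans S).trans S) (fun a => by simp [hS]) hSSS
    exists_of_S_eq := fun x hx hSx => G.exists_of_fixed x fun T hT => ?_
    ρ_mem := fun T _ hTρ => hTρ
    ρ'_mem := fun T hT hTρ => ?_
    η_mem := fun T hT hTρ => ?_
    e_mem := fun T hT hTρ => ?_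
    ρ_pow := G.ρ_pow
    ρ_mul := G.ρ_mul
    ρ'_pow := G.ρ'_pow
    S_ρ := hρ
    S_ρ' := ?_
    η_add := ?_
    η_mul := ?_
    e_mul := hemul
    σ_e := hσe 1 e he
    σ_S_e := hσe _ _ hcSe
    σ_S_S_e := hσe _ _ hcSSe
    Q_f := G.Q_f
    c_dvd := ?_
    S_e_sub := ?_
    S_S_e_sub := ?_
    e_sub := ?_ }⟩
  · have h1 := congrArg T hx
    rw [map_mul, hT, hT, ← hx] at h1
    exact mul_right_cancel₀ (fun h0 => hb (G.f_inj (by rw [h0, map_zero]))) h1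
  · have hS' : ∀ a, S.symm (G.f a) = G.f a := fun a => by rw [RingEquiv.symm_apply_eq, hS]
    have hs : G.f D.ζ * S.symm G.ρ = G.ρ := by
      have := S.symm_apply_apply G.ρ
      rwa [hρ, map_mul, hS'] at this
    have h1 := hx ((S.trans T).trans S.symm) (fun a => by simp [hS, hT, hS']) (by
      simp [hρ, hT, hTρ, hS', hs])
    simpa [RingEquiv.symm_apply_eq] using h1
  · have h1 : (T G.ρ - G.ρ) * ((T G.ρ - G.f D.ζ * G.ρ) * (T G.ρ - G.f D.ζ ^ 2 * G.ρ)) = 0 := by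
      have h1 := congrArg T G.ρ_pow
      rw [map_pow, hT, ← G.ρ_pow] at h1
      have h2 := G.ζ_eq
      linear_combination h1 + (-T G.ρ ^ 2 * G.ρ + T G.ρ * G.ρ ^ 2 * G.f D.ζ) * h2 - G.ρ ^ 3 * hfz
    have hSSx : S (S x) = x := by rw [hSx, hSx]
    rcases mul_eq_zero.1 h1 with h1 | h1
    · exact hx T hT (sub_eq_zero.1 h1)
    rcases mul_eq_zero.1 h1 with h1 | h1
    · have h2 := hx (T.trans (S.trans S)) (fun a => by simp [hS, hT]) (by
        simp only [RingEquiv.trans_apply, sub_eq_zero.1 h1, map_mul, hS, hρ]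
        linear_combination G.ρ * hfz)
      simp only [RingEquiv.trans_apply] at h2
      exact S.injective (S.injective (h2.trans hSSx.symm))
    · have h2 := hx (T.trans S) (fun a => by simp [hS, hT]) (by
        simp only [RingEquiv.trans_apply, sub_eq_zero.1 h1, map_mul, map_pow, hS, hρ]
        linear_combination G.ρ * hfz)
      simp only [RingEquiv.trans_apply] at h2
      exact S.injective (h2.trans hSx.symm)
  · have h1 := congrArg T G.ρ_mul
    rw [map_mul, hT, hTρ, ← G.ρ_mul] at h1
    exact mul_left_cancel₀ G.ρ_ne_zero h1
  · obtain ⟨n, hn, h1⟩ := hfix T hT hTρ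
    rw [G.map_per hn, h1, one_mul]
  · obtain ⟨n, hn, h1⟩ := hfix T hT hTρ
    have h2 := G.map_cyc hn 1
    rw [h1, one_mul, he, map_mul, hT] at h2
    exact mul_left_cancel₀ G.θ_ne_zero h2
  · have h1 := congrArg S G.ρ_mul
    rw [map_mul, hS, hρ, ← G.ρ_mul] at h1
    apply mul_left_cancel₀ G.ρ_ne_zero
    linear_combination G.f D.ζ ^ 2 * h1 - G.ρ * S G.ρ' * hfz
  · rw [hSSper, hSper, ← G.sum_per]; ring
  · rw [hSSper, hSper, ← G.per_mul]; ring
  · have h1 : ((p : ℤ)) ∣ ((i : ℤ) ^ G.num) ^ 3 - 1 := by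
      rw [← D.intCast_mem_P]
      refine G.Q_f _ ?_
      rw [← Ideal.Quotient.eq] at hq0 hq1' hq2
      have h1 := congrArg (Ideal.Quotient.mk G.Q) hq1
      rw [map_mul, map_mul, hq0, hq1', hq2, ← map_mul, ← map_mul, Ideal.Quotient.eq] at h1
      have e : G.f ((((i : ℤ) ^ G.num) ^ 3 - 1 : ℤ) : O) =
          (i : B) ^ G.num * (i : B) ^ G.num * (i : B) ^ G.num - 1 := by
        push_cast
        simp only [map_sub, map_pow, map_natCast, map_one]
        ring
      rwa [e]
    have h2 : ¬ (p : ℤ) ∣ (i : ℤ) ^ G.num - 1 := fun h2 => by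
      refine G.pow_num_ne_one (v := v) (hχv ▸ G.ζ_ne_one'.1) ?_
      rw [← ZMod.intCast_zmod_eq_zero_iff_dvd] at h2
      push_cast at h2
      rw [hi, ZMod.natCast_zmod_val] at h2
      exact sub_eq_zero.1 h2
    have h3 : ((i : ℤ) ^ G.num) ^ 3 - 1 = ((i : ℤ) ^ G.num - 1) *
      (((i : ℤ) ^ G.num) ^ 2 + (i : ℤ) ^ G.num + 1) := by ring
    exact ((Nat.prime_iff_prime_int.1 hp.out).dvd_or_dvd (h3 ▸ h1)).resolve_left h2
  · rw [hSe, hcast, ← sub_mul]; exact Ideal.mul_mem_right _ _ hq0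
  · rw [hSSe, hcast, ← sub_mul]; exact Ideal.mul_mem_right _ _ hq1'
  · have : e = S (S q) * S (S e) := by conv_lhs => rw [← hSSSe, hSSe, map_mul]
    nth_rw 1 [this]
    rw [hcast, ← sub_mul]; exact Ideal.mul_mem_right _ _ hq2

end LargeExtension

end PureCubicRing

/-- The field `K = ℚ(∛p, ζ₃)` with its automorphisms. -/
structure PureCubicField (K : Type*) [Field K] [NumberField K] (p : ℕ) [Fact p.Prime] where
  (σ τ : K ≃ₐ[ℚ] K)
  (θ ζ : K)
  p_mod : p % 9 = 1
  θ_pow : θ ^ 3 = p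
  ζ_eq : ζ ^ 2 + ζ + 1 = 0
  σ_θ : σ θ = ζ * θ
  σ_ζ : σ ζ = ζ
  τ_θ : τ θ = θ
  τ_ζ : τ ζ = ζ ^ 2
  exists_eq : ∀ x, ∃ a a' b b' c c' : ℚ,
    x = a + a' * ζ + (b + b' * ζ) * θ + (c + c' * ζ) * θ ^ 2

namespace PureCubicField

set_option linter.unusedSectionVars false

variable {K : Type*} [Field K] [NumberField K] {p : ℕ} [hp : Fact p.Prime]
  (F : PureCubicField K p)

include F

theorem ζ_pow : F.ζ ^ 3 = 1 := by linear_combination (F.ζ - 1) * F.ζ_eq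

theorem ζ_ne_one : F.ζ ≠ 1 := fun h => by
  have := F.ζ_eq
  rw [h] at this
  norm_num at this

theorem ζ_prim : IsPrimitiveRoot F.ζ 3 :=
  IsPrimitiveRoot.iff_orderOf.2 (orderOf_eq_prime F.ζ_pow F.ζ_ne_one)

theorem θ_ne_zero : F.θ ≠ 0 := fun h => by
  have := F.θ_pow
  rw [h] at this
  exact (Nat.cast_ne_zero (R := K)).2 hp.out.ne_zero (by rw [← this]; simp)

theorem ext {f g : K ≃ₐ[ℚ] K} (h1 : f F.θ = g F.θ) (h2 : f F.ζ = g F.ζ) (x : K) : f x = g x := by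
  obtain ⟨a, a', b, b', c, c', rfl⟩ := F.exists_eq x
  simp [h1, h2]

theorem σ_σ_σ (x : K) : F.σ (F.σ (F.σ x)) = x := by
  refine F.ext (f := (F.σ.trans F.σ).trans F.σ) (g := AlgEquiv.refl) ?_ ?_ x
  · simp only [AlgEquiv.trans_apply, F.σ_θ, map_mul, F.σ_ζ, AlgEquiv.coe_refl, id]
    linear_combination F.θ * F.ζ_pow
  · simp [F.σ_ζ]

theorem τ_τ (x : K) : F.τ (F.τ x) = x := by
  refine F.ext (f := F.τ.trans F.τ) (g := AlgEquiv.refl) ?_ ?_ x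
  · simp [F.τ_θ]
  · simp only [AlgEquiv.trans_apply, F.τ_ζ, map_pow, AlgEquiv.coe_refl, id]
    linear_combination F.ζ * F.ζ_pow

theorem τ_σ (x : K) : F.τ (F.σ x) = F.σ (F.σ (F.τ x)) := by
  refine F.ext (f := F.σ.trans F.τ) (g := (F.τ.trans F.σ).trans F.σ) ?_ ?_ x
  · simp only [AlgEquiv.trans_apply, F.σ_θ, map_mul, F.σ_ζ, F.τ_θ, F.τ_ζ]; ring
  · simp [F.σ_ζ, F.τ_ζ]

theorem coeff_eq_zero {x y z : K} (hx : F.σ x = x) (hy : F.σ y = y) (hz : F.σ z = z)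
    (h : x + y * F.θ + z * F.θ ^ 2 = 0) : x = 0 ∧ y = 0 ∧ z = 0 := by
  have h1 := congrArg F.σ h
  have h2 := congrArg F.σ h1
  simp only [map_add, map_mul, map_pow, hx, hy, hz, F.σ_θ, F.σ_ζ, map_zero] at h1 h2
  have h3 : (3 : K) ≠ 0 := by norm_num
  have hz := F.ζ_eq
  have hz3 := F.ζ_pow
  have ht := F.θ_ne_zero
  refine ⟨?_, ?_, ?_⟩
  · apply mul_left_cancel₀ h3
    linear_combination h + h1 + h2 - (y * F.θ + z * F.θ ^ 2 * (F.ζ ^ 2 - F.ζ + 1)) * hz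
  · apply mul_left_cancel₀ (mul_ne_zero h3 ht)
    linear_combination h + F.ζ ^ 2 * h1 + F.ζ * h2 - (x + z * F.θ ^ 2 * (F.ζ ^ 3 - F.ζ + 1)) * hz
      - 2 * y * F.θ * hz3
  · apply mul_left_cancel₀ (mul_ne_zero h3 (pow_ne_zero 2 ht))
    linear_combination h + F.ζ * h1 + F.ζ ^ 2 * h2 - x * hz - (y * F.θ) * hz
      - (z * F.θ ^ 2 * (F.ζ ^ 3 + 2) + F.ζ * y * F.θ) * hz3

theorem rat_eq_zero {a b : ℚ} (h : (a : K) + b * F.ζ = 0) : a = 0 ∧ b = 0 := by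
  have h1 := congrArg F.τ h
  simp only [map_add, map_mul, map_ratCast, F.τ_ζ, map_zero] at h1
  have hz := F.ζ_eq
  have hb : (b : K) = 0 := by
    apply mul_left_cancel₀ (show (3 : K) ≠ 0 by norm_num)
    linear_combination (F.ζ - F.ζ ^ 2) * (h1 - h) + b * (F.ζ ^ 2 - 3 * F.ζ + 3) * hz
  have ha : (a : K) = 0 := by rw [hb] at h; linear_combination h
  exact ⟨by exact_mod_cast ha, by exact_mod_cast hb⟩

theorem σ_rat (a b : ℚ) : F.σ (a + b * F.ζ) = a + b * F.ζ := by simp [F.σ_ζ]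

theorem exists_of_σ {x : K} (h : F.σ x = x) : ∃ a b : ℚ, x = a + b * F.ζ := by
  obtain ⟨a, a', b, b', c, c', hx⟩ := F.exists_eq x
  refine ⟨a, a', ?_⟩
  have h1 := F.coeff_eq_zero (x := a + a' * F.ζ - x) (y := b + b' * F.ζ) (z := c + c' * F.ζ)
    (by rw [map_sub, F.σ_rat, h]) (F.σ_rat _ _) (F.σ_rat _ _) (by linear_combination -hx)
  exact (sub_eq_zero.1 h1.1).symm

theorem exists_of_τ {x : K} (h : F.τ x = x) : ∃ a b c : ℚ, x = a + b * F.θ + c * F.θ ^ 2 := by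
  obtain ⟨a, a', b, b', c, c', hx⟩ := F.exists_eq x
  refine ⟨a - a' / 2, b - b' / 2, c - c' / 2, ?_⟩
  have h1 : F.τ x = a + a' * F.ζ ^ 2 + (b + b' * F.ζ ^ 2) * F.θ + (c + c' * F.ζ ^ 2) * F.θ ^ 2 := by
    rw [hx]; simp [F.τ_ζ, F.τ_θ]
  push_cast
  linear_combination (hx + h1 - h) / 2 + (a' + b' * F.θ + c' * F.θ ^ 2) / 2 * F.ζ_eq

theorem exists_of_σ_τ {x : K} (h : F.σ x = x) (h' : F.τ x = x) : ∃ a : ℚ, x = a := by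
  obtain ⟨a, b, rfl⟩ := F.exists_of_σ h
  simp only [map_add, map_mul, map_ratCast, F.τ_ζ] at h'
  have h1 : ((b : ℚ) : K) + (2 * b : ℚ) * F.ζ = 0 := by
    push_cast
    linear_combination b * F.ζ_eq - h'
  exact ⟨a, by rw [(F.rat_eq_zero h1).1]; simp⟩

/-- The six monomials `ζ ^ i * θ ^ j`. -/
def monomials : Fin 3 × Fin 2 → K := fun i => F.ζ ^ (i.2 : ℕ) * F.θ ^ (i.1 : ℕ)

theorem finrank_eq : Module.finrank ℚ K = 6 := by
  have hli : LinearIndependent ℚ F.monomials := by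
    rw [Fintype.linearIndependent_iff]
    intro g hg
    simp only [monomials, Fintype.sum_prod_type, Fin.sum_univ_three, Fin.sum_univ_two, Fin.val_zero,
      Fin.val_one, Fin.val_two, pow_zero, pow_one, one_mul, Rat.smul_def, mul_one] at hg
    have h1 := F.coeff_eq_zero (F.σ_rat (g (0, 0)) (g (0, 1))) (F.σ_rat (g (1, 0)) (g (1, 1)))
      (F.σ_rat (g (2, 0)) (g (2, 1))) (by rw [← hg]; ring)
    have h2 := F.rat_eq_zero h1.1
    have h3 := F.rat_eq_zero h1.2.1
    have h4 := F.rat_eq_zero h1.2.2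
    rintro ⟨i, j⟩
    fin_cases i <;> fin_cases j
    exacts [h2.1, h2.2, h3.1, h3.2, h4.1, h4.2]
  have hsp : ⊤ ≤ Submodule.span ℚ (Set.range F.monomials) := fun x _ => by
    obtain ⟨a, a', b, b', c, c', rfl⟩ := F.exists_eq x
    rw [Submodule.mem_span_range_iff_exists_fun]
    refine ⟨fun i => ![![a, a'], ![b, b'], ![c, c']] i.1 i.2, ?_⟩
    simp only [monomials, Fintype.sum_prod_type, Fin.sum_univ_three, Fin.sum_univ_two, Fin.val_zero,
      Fin.val_one, Fin.val_two, pow_zero, pow_one, one_mul, Rat.smul_def, mul_one]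
    simp
    ring
  simpa using Module.finrank_eq_card_basis (Module.Basis.mk hli hsp)

end PureCubicField

theorem NumberField.exists_int_of_isIntegral {K : Type*} [Field K] [NumberField K] {r : ℚ}
    {x : K} (h : IsIntegral ℤ x) (hr : (r : K) = x) : ∃ n : ℤ, r = n := by
  have h1 : IsIntegral ℤ r := by
    rw [← isIntegral_algebraMap_iff (algebraMap ℚ K).injective]
    simpa [hr] using h
  obtain ⟨n, hn⟩ := IsIntegrallyClosed.isIntegral_iff.1 h1
  exact ⟨n, by simpa using hn.symm⟩

theorem Int.exists_eq_three_mul {n m N : ℤ} (h : m ^ 2 = 3 * (4 * N - n ^ 2)) :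
    ∃ a b : ℤ, m = 3 * b ∧ n = 2 * a - b := by
  obtain ⟨b, rfl⟩ : (3 : ℤ) ∣ m := Int.prime_three.dvd_of_dvd_pow (h ▸ dvd_mul_right _ _)
  have h1 : n ^ 2 + 3 * b ^ 2 = 4 * N := by linarith
  have h2 : (2 : ℤ) ∣ (n + b) := by
    have h3 : (2 : ℤ) ∣ (n + b) ^ 2 := ⟨2 * N - b ^ 2 + n * b, by linarith⟩
    exact Int.prime_two.dvd_of_dvd_pow h3
  obtain ⟨a, ha⟩ := h2
  exact ⟨a, b, rfl, by linarith⟩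

namespace PureCubicField

set_option linter.unusedSectionVars false

variable {K : Type*} [Field K] [NumberField K] {p : ℕ} [hp : Fact p.Prime]
  (F : PureCubicField K p)

include F

theorem isIntegral_θ : IsIntegral ℤ F.θ := by
  refine IsIntegral.of_pow (n := 3) (by norm_num) ?_
  rw [F.θ_pow]
  exact_mod_cast isIntegral_algebraMap (R := ℤ) (A := K) (x := (p : ℤ))

theorem isIntegral_ζ : IsIntegral ℤ F.ζ := F.ζ_prim.isIntegral (by norm_num)

/-- The integral element `(1 + θ + θ²) / 3`. -/
def β : K := (1 + F.θ + F.θ ^ 2) / 3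

theorem isIntegral_β : IsIntegral ℤ F.β := by
  obtain ⟨q, hq⟩ : ∃ q : ℕ, p = 9 * q + 1 := ⟨p / 9, by have := F.p_mod; omega⟩
  refine ⟨Polynomial.X ^ 3 + Polynomial.C (-1 : ℤ) * Polynomial.X ^ 2
    + Polynomial.C (-3 * q : ℤ) * Polynomial.X + Polynomial.C (-3 * q * q : ℤ), ?_, ?_⟩
  · monicity!
  · have h := F.θ_pow
    have hq' : (p : K) = 9 * q + 1 := by rw [hq]; push_cast; ring
    rw [hq'] at h
    simp [Polynomial.eval₂_add, Polynomial.eval₂_mul, β]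
    field_simp
    generalize F.θ = θ at *
    generalize (q : K) = q at *
    grind

/-- `σ` on the ring of integers. -/
def s : 𝓞 K ≃+* 𝓞 K := RingOfIntegers.mapRingEquiv F.σ.toRingEquiv

/-- `τ` on the ring of integers. -/
def t : 𝓞 K ≃+* 𝓞 K := RingOfIntegers.mapRingEquiv F.τ.toRingEquiv

@[simp] theorem coe_s (x : 𝓞 K) : ((F.s x : 𝓞 K) : K) = F.σ x := rfl

@[simp] theorem coe_t (x : 𝓞 K) : ((F.t x : 𝓞 K) : K) = F.τ x := rfl

/-- `θ` as an algebraic integer. -/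
def θ' : 𝓞 K := ⟨F.θ, F.isIntegral_θ⟩

/-- `ζ` as an algebraic integer. -/
def ζ' : 𝓞 K := ⟨F.ζ, F.isIntegral_ζ⟩

/-- `β` as an algebraic integer. -/
def β' : 𝓞 K := ⟨F.β, F.isIntegral_β⟩

@[simp] theorem coe_θ' : (F.θ' : K) = F.θ := rfl
@[simp] theorem coe_ζ' : (F.ζ' : K) = F.ζ := rfl
@[simp] theorem coe_β' : (F.β' : K) = F.β := rfl

theorem exists_int_of_s {x : 𝓞 K} (h : F.s x = x) : ∃ a b : ℤ, x = a + b * F.ζ' := by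
  have h' : F.σ (x : K) = x := congrArg (algebraMap (𝓞 K) K) h
  obtain ⟨a, b, hx⟩ := F.exists_of_σ h'
  have hz := F.ζ_eq
  have hτ : F.τ (x : K) = a + b * F.ζ ^ 2 := by rw [hx]; simp [F.τ_ζ]
  have hxi : IsIntegral ℤ (x : K) := RingOfIntegers.isIntegral_coe x
  have hti : IsIntegral ℤ (F.τ (x : K)) := RingOfIntegers.isIntegral_coe (F.t x)
  obtain ⟨n, hn⟩ : ∃ n : ℤ, 2 * a - b = n := NumberField.exists_int_of_isIntegral (hxi.add hti) (by
    rw [hτ, hx]; push_cast; linear_combination -b * hz)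
  obtain ⟨N, hN⟩ : ∃ N : ℤ, a ^ 2 - a * b + b ^ 2 = N :=
    NumberField.exists_int_of_isIntegral (hxi.mul hti) (by
      rw [hτ, hx]; push_cast
      linear_combination (-(a : K) * b - b ^ 2 * (F.ζ - 1)) * hz)
  obtain ⟨m, hm⟩ : ∃ m : ℤ, 3 * b = m := NumberField.exists_int_of_isIntegral
      ((F.isIntegral_ζ.sub (F.isIntegral_ζ.pow 2)).mul (hti.sub hxi)) (by
    rw [hτ, hx]; push_cast
    linear_combination b * (F.ζ ^ 2 - 3 * F.ζ + 3) * hz)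
  have hmn : m ^ 2 = 3 * (4 * N - n ^ 2) := by
    have : ((m ^ 2 : ℤ) : ℚ) = (3 * (4 * N - n ^ 2) : ℤ) := by
      push_cast
      rw [← hm, ← hN, ← hn]; ring
    exact_mod_cast this
  obtain ⟨a', b', rfl, rfl⟩ := Int.exists_eq_three_mul hmn
  have hb : b = b' := by push_cast at hm; linarith
  have ha : a = a' := by push_cast at hn; linarith
  refine ⟨a', b', RingOfIntegers.ext ?_⟩
  rw [hx, ha, hb]
  simp

theorem σ_of_mem {x : K} (h : x ∈ ℚ⟮F.ζ⟯) : F.σ x = x := by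
  induction h using IntermediateField.adjoin_induction with
  | mem x hx => rw [Set.mem_singleton_iff.1 hx, F.σ_ζ]
  | algebraMap x => simp
  | add x y _ _ hx hy => rw [map_add, hx, hy]
  | inv x _ hx => rw [map_inv₀, hx]
  | mul x y _ _ hx hy => rw [map_mul, hx, hy]

theorem exists_generator (I : Ideal (𝓞 K)) :
    ∃ g ∈ I, F.s g = g ∧ ∀ x ∈ I, F.s x = x → ∃ y, x = g * y := by
  have := F.ζ_prim.intermediateField_adjoin_isCyclotomicExtension ℚ
  have : IsCyclotomicExtension {3} ℚ ℚ⟮F.ζ⟯ := by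
    convert this
    · rfl
    · exact Subsingleton.elim (α := Algebra ℚ ℚ⟮F.ζ⟯) _ _
  have := IsCyclotomicExtension.Rat.three_pid ℚ⟮F.ζ⟯
  obtain ⟨g, hg⟩ := (IsPrincipalIdealRing.principal
    (I.comap (algebraMap (𝓞 ℚ⟮F.ζ⟯) (𝓞 K)))).principal
  have hgI : g ∈ I.comap (algebraMap (𝓞 ℚ⟮F.ζ⟯) (𝓞 K)) := by
    rw [hg]; exact Submodule.mem_span_singleton_self g
  refine ⟨algebraMap _ _ g, hgI, RingOfIntegers.ext (F.σ_of_mem (SetLike.coe_mem (g : ℚ⟮F.ζ⟯))), ?_⟩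
  intro x hx hsx
  obtain ⟨a, b, rfl⟩ := F.exists_int_of_s hsx
  let z : 𝓞 ℚ⟮F.ζ⟯ := ⟨AdjoinSimple.gen ℚ F.ζ, by
    change IsIntegral ℤ _; rw [← isIntegral_algebraMap_iff (algebraMap ℚ⟮F.ζ⟯ K).injective]
    exact F.isIntegral_ζ⟩
  have hz : algebraMap (𝓞 ℚ⟮F.ζ⟯) (𝓞 K) z = F.ζ' := RingOfIntegers.ext rfl
  have hmem : (a + b * z : 𝓞 ℚ⟮F.ζ⟯) ∈ I.comap (algebraMap (𝓞 ℚ⟮F.ζ⟯) (𝓞 K)) := by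
    rw [Ideal.mem_comap, map_add, map_mul, hz, map_intCast, map_intCast]; exact hx
  rw [hg, Ideal.submodule_span_eq, Ideal.mem_span_singleton'] at hmem
  obtain ⟨y, hy⟩ := hmem
  refine ⟨algebraMap _ _ y, ?_⟩
  have h2 := congrArg (algebraMap (𝓞 ℚ⟮F.ζ⟯) (𝓞 K)) hy
  rw [map_add, map_mul, map_mul, hz, map_intCast, map_intCast] at h2
  rw [← h2, mul_comm]

theorem card_θ' : Nat.card (𝓞 K ⧸ Ideal.span {F.θ'}) = p ^ 2 := by
  have h1 : Nat.card (𝓞 K ⧸ Ideal.span {F.θ'}) = Ideal.absNorm (Ideal.span {F.θ'}) := by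
    rw [Ideal.absNorm_apply, Submodule.cardQuot_apply]
  have h2 : Ideal.absNorm (Ideal.span {F.θ'}) ^ 3 = (p ^ 2) ^ 3 := by
    have h3 : F.θ' ^ 3 = (p : 𝓞 K) := RingOfIntegers.ext (by simp [F.θ_pow])
    rw [← map_pow, Ideal.span_singleton_pow, h3, Ideal.absNorm_span_singleton]
    have h4 : Algebra.norm ℤ (p : 𝓞 K) = (p : ℤ) ^ 6 := by
      have := Algebra.norm_algebraMap_of_basis (RingOfIntegers.basis K) (p : ℤ)
      rw [← Module.finrank_eq_card_chooseBasisIndex, RingOfIntegers.rank, F.finrank_eq] at this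
      simpa using this
    rw [h4, Int.natAbs_pow, Int.natAbs_natCast]; ring
  rw [h1]
  exact Nat.pow_left_injective (n := 3) (by norm_num) h2

/-- The ring of integers of a pure cubic field. -/
theorem exists_ring : ∃ D : PureCubicRing (𝓞 K) p,
    D.s = F.s ∧ D.t = F.t ∧ D.θ = F.θ' ∧ D.ζ = F.ζ' := by
  have hz : IsPrimitiveRoot F.ζ' 3 :=
    IsPrimitiveRoot.of_map_of_injective (f := algebraMap (𝓞 K) K)
      (by exact F.ζ_prim) RingOfIntegers.coe_injective
  obtain ⟨χ, hχ⟩ := MulChar.exists_mulChar_orderOf (ZMod p) (n := 3)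
    (by rw [ZMod.card]; have := F.p_mod; omega) hz
  refine ⟨{ s := F.s, t := F.t, θ := F.θ', ζ := F.ζ', β := F.β', χ := χ
            s_s_s := fun x => RingOfIntegers.ext (F.σ_σ_σ x)
            t_t := fun x => RingOfIntegers.ext (F.τ_τ x)
            t_s := fun x => RingOfIntegers.ext (F.τ_σ x)
            p_mod := F.p_mod
            θ_pow := RingOfIntegers.ext (by simp [F.θ_pow])
            ζ_eq := RingOfIntegers.ext (by simp [F.ζ_eq])
            s_θ := RingOfIntegers.ext (by simp [F.σ_θ])
            s_ζ := RingOfIntegers.ext (by simp [F.σ_ζ])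
            t_θ := RingOfIntegers.ext (by simp [F.τ_θ])
            t_ζ := RingOfIntegers.ext (by simp [F.τ_ζ])
            β_eq := RingOfIntegers.ext (by
              have h3 : algebraMap (𝓞 K) K 3 = 3 := map_ofNat _ 3
              simp [β, h3]; field_simp)
            χ_pow := by rw [← hχ, pow_orderOf_eq_one]
            χ_ne := fun h => by rw [h, orderOf_one] at hχ; omega
            fixed := fun x h => F.exists_int_of_s h
            pid := F.exists_generator
            card_θ := F.card_θ' }, rfl, rfl, rfl, rfl⟩

/-- The ring of integers of a pure cubic field. -/
def ring : PureCubicRing (𝓞 K) p := F.exists_ring.choose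

@[simp] theorem ring_s : F.ring.s = F.s := F.exists_ring.choose_spec.1
@[simp] theorem ring_t : F.ring.t = F.t := F.exists_ring.choose_spec.2.1
@[simp] theorem ring_θ : F.ring.θ = F.θ' := F.exists_ring.choose_spec.2.2.1
@[simp] theorem ring_ζ : F.ring.ζ = F.ζ' := F.exists_ring.choose_spec.2.2.2

end PureCubicField

theorem Module.Basis.nonempty_addEquiv {A : Type*} [AddCommGroup A] {m n : ℕ}
    (b : Module.Basis (Fin m) ℤ A) (h : m = n) : Nonempty (A ≃+ (Fin n → ℤ)) := by
  subst h
  exact ⟨b.equivFun.toAddEquiv⟩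

namespace PureCubicField

set_option linter.unusedSectionVars false

variable {K : Type*} [Field K] [NumberField K] {p : ℕ} [hp : Fact p.Prime]
  (F : PureCubicField K p)

include F

theorem isTotallyComplex : IsTotallyComplex K := by
  refine ⟨fun v => InfinitePlace.not_isReal_iff_isComplex.1 fun ⟨φ, hφ, _⟩ => ?_⟩
  have h1 := congrArg φ F.ζ_eq
  simp only [map_add, map_pow, map_one, map_zero] at h1
  have h2 : (starRingEnd ℂ) (φ F.ζ) = φ F.ζ := by
    have := RingHom.congr_fun hφ F.ζ
    simpa using this
  obtain ⟨r, hr⟩ := Complex.conj_eq_iff_real.1 h2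
  rw [hr] at h1
  have h3 : r ^ 2 + r + 1 = 0 := by exact_mod_cast h1
  nlinarith [sq_nonneg (2 * r + 1)]

theorem rank_eq : Units.rank K = 2 := by
  have := F.isTotallyComplex
  have h1 : InfinitePlace.nrRealPlaces K = 0 := IsTotallyComplex.nrRealPlaces_eq_zero K
  have h2 := IsTotallyComplex.finrank (K := K)
  rw [F.finrank_eq] at h2
  rw [Units.rank, InfinitePlace.card_eq_nrRealPlaces_add_nrComplexPlaces]
  omega

theorem mem_torsion_iff (u : (𝓞 K)ˣ) : u ∈ Units.torsion K ↔ F.ring.s u = u := by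
  constructor
  · intro hu
    set S : (𝓞 K)ˣ →* (𝓞 K)ˣ := Units.map (F.ring.s : 𝓞 K →* 𝓞 K) with hS
    set T : (𝓞 K)ˣ →* (𝓞 K)ˣ := Units.map (F.ring.t : 𝓞 K →* 𝓞 K) with hT
    have hmem : ∀ (f : (𝓞 K)ˣ →* (𝓞 K)ˣ) {x}, x ∈ Units.torsion K → f x ∈ Units.torsion K :=
      fun f x hx => by
        rw [Units.torsion, CommGroup.mem_torsion] at hx ⊢
        exact f.isOfFinOrder hx
    obtain ⟨g, hg⟩ := IsCyclic.exists_generator (α := Units.torsion K)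
    have hpow : ∀ x ∈ Units.torsion K, ∃ k : ℤ, x = (g : (𝓞 K)ˣ) ^ k := fun x hx => by
      obtain ⟨k, hk⟩ := Subgroup.mem_zpowers_iff.1 (hg ⟨x, hx⟩)
      exact ⟨k, by rw [← Subgroup.coe_zpow, hk]⟩
    have hcomm : ∀ x ∈ Units.torsion K, T (S x) = S (T x) := fun x hx => by
      obtain ⟨a, ha⟩ := hpow _ (hmem S g.2)
      obtain ⟨b, hb⟩ := hpow _ (hmem T g.2)
      obtain ⟨k, rfl⟩ := hpow _ hx
      rw [map_zpow, map_zpow, map_zpow, map_zpow, ha, hb, map_zpow, map_zpow, ha, hb,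
        ← zpow_mul (g : (𝓞 K)ˣ) b a, ← zpow_mul (g : (𝓞 K)ˣ) a b, mul_comm]
    have hTS : T (S (T u)) = S (S u) := Units.ext (by
      change F.ring.t (F.ring.s (F.ring.t u)) = F.ring.s (F.ring.s u)
      rw [F.ring.t_s, F.ring.t_t])
    have hTT : T (T u) = u := Units.ext (F.ring.t_t u)
    have h1 : S u = S (S u) := by
      rw [← hTS, hcomm _ (hmem T hu), hTT]
    have h2 : u = S u := Units.ext (F.ring.s.injective (congrArg Units.val h1))
    exact (congrArg Units.val h2).symm
  · intro h
    rw [Units.torsion, CommGroup.mem_torsion, isOfFinOrder_iff_pow_eq_one]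
    refine ⟨6, by norm_num, Units.ext ?_⟩
    rw [Units.val_pow_eq_pow_val, Units.val_one]
    rcases F.ring.fixed_unit_cube u.isUnit h with h | h
    · linear_combination ((u : 𝓞 K) ^ 3 + 1) * h
    · linear_combination ((u : 𝓞 K) ^ 3 - 1) * h

theorem index_Λ : F.ring.Λ.index = 3 := by
  obtain ⟨e⟩ := Module.Basis.nonempty_addEquiv (A := Additive ((𝓞 K)ˣ ⧸ Units.torsion K))
    (Units.basisModTorsion K) F.rank_eq
  exact F.ring.index_Λ_eq_three F.mem_torsion_iff e

end PureCubicField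

namespace PureCubicField

set_option linter.unusedSectionVars false

variable {K : Type*} [Field K] [NumberField K] {p : ℕ} [hp : Fact p.Prime]
  (F : PureCubicField K p)

include F

omit F in
theorem dvd_of_pow_dvd_pow {Ω : Type*} [Field Ω] {x y : 𝓞 Ω} (h : y ^ 3 ∣ x ^ 3) : y ∣ x := by
  obtain ⟨c, hc⟩ := h
  by_cases hy : y = 0
  · have : x = 0 := by simpa [hy] using hc
    simp [this]
  have hy' : (y : Ω) ≠ 0 := by simpa using hy
  have hc' : (x : Ω) ^ 3 = (y : Ω) ^ 3 * c := by
    rw [← map_pow, hc, map_mul, map_pow]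
  have hi : IsIntegral ℤ ((x : Ω) / y) := by
    refine IsIntegral.of_pow (n := 3) (by norm_num) ?_
    rw [div_pow, hc', mul_div_cancel_left₀ _ (pow_ne_zero 3 hy')]
    exact RingOfIntegers.isIntegral_coe c
  exact ⟨⟨_, hi⟩, RingOfIntegers.ext (by
    change (x : Ω) = (y : Ω) * (x / y)
    field_simp)⟩

theorem exists_largeExtension :
    Nonempty (PureCubicRing.LargeExtension F.ring (𝓞 (AlgebraicClosure K))) := by
  set Ω := AlgebraicClosure K
  let e : Ω ≃+* Ω := IsAlgClosure.equivOfEquiv Ω Ω F.σ.toRingEquiv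
  have he : ∀ x : K, e (algebraMap K Ω x) = algebraMap K Ω (F.σ x) :=
    IsAlgClosure.equivOfEquiv_algebraMap Ω Ω F.σ.toRingEquiv
  have hinj : Function.Injective (algebraMap (𝓞 K) (𝓞 Ω)) := fun x y h =>
    RingOfIntegers.ext ((algebraMap K Ω).injective (congrArg (algebraMap (𝓞 Ω) Ω) h))
  have := F.ring.P_prime
  obtain ⟨Q, hQ, hQP⟩ := Ideal.exists_ideal_over_prime_of_isIntegral_of_isDomain (S := 𝓞 Ω)
    F.ring.P (by rw [(RingHom.injective_iff_ker_eq_bot _).1 hinj]; exact bot_le)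
  have hp0 : NeZero (p : Ω) := ⟨Nat.cast_ne_zero.2 hp.out.ne_zero⟩
  obtain ⟨z, hz⟩ := HasEnoughRootsOfUnity.exists_primitiveRoot Ω p
  refine ⟨{ f := algebraMap (𝓞 K) (𝓞 Ω), f_inj := hinj
            exists_of_fixed := fun x hx => ?_
            σ₀ := RingOfIntegers.mapRingEquiv e
            σ₀_f := fun a => RingOfIntegers.ext ?_
            z := ⟨z, hz.isIntegral hp.out.pos⟩
            z_prim := IsPrimitiveRoot.of_map_of_injective (f := algebraMap (𝓞 Ω) Ω)
              hz RingOfIntegers.coe_injective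
            dvd_of_pow := fun x y => dvd_of_pow_dvd_pow
            Q := Q
            Q_prime := hQ
            Q_f := fun a ha => by rw [← hQP]; exact ha
            f_Q := fun a ha => by rw [← hQP] at ha; exact ha }⟩
  · have h1 : ∃ a : K, algebraMap K Ω a = x := by
      refine (InfiniteGalois.mem_range_algebraMap_iff_fixed (k := K) (x : Ω)).2 fun f => ?_
      exact congrArg (algebraMap (𝓞 Ω) Ω) (hx (RingOfIntegers.mapRingEquiv f.toRingEquiv)
        fun a => RingOfIntegers.ext (f.commutes (a : K)))
    obtain ⟨a, ha⟩ := h1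
    refine ⟨⟨a, ?_⟩, RingOfIntegers.ext ha⟩
    change IsIntegral ℤ a
    rw [← isIntegral_algebraMap_iff (algebraMap K Ω).injective, ha]
    exact RingOfIntegers.isIntegral_coe x
  · rw [ring_s]
    exact he a

theorem classGroup_structure :
    ∃ w j : ℕ, 1 ≤ w ∧ (j = w ∨ j + 1 = w) ∧
      Nonempty (CommGroup.primaryComponent (ClassGroup (𝓞 K)) 3 ≃*
        Multiplicative (ZMod (3 ^ w)) × Multiplicative (ZMod (3 ^ j))) ∧
      (∃ c : CommGroup.primaryComponent (ClassGroup (𝓞 K)) 3, orderOf c = 3 ^ w ∧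
        ∀ x, primaryMap 3 F.ring.tC x = x ↔ x ∈ Subgroup.zpowers c) ∧
      (j = w ↔ F.ring.cP ≠ 1) ∧ (j = w → 2 ≤ w) := by
  refine F.ring.classGroup_structure F.index_Λ fun h => ?_
  obtain ⟨L⟩ := F.exists_largeExtension
  obtain ⟨G⟩ := L.exists_genusData h
  exact G.exists_ideal

end PureCubicField

section Adjoin

variable {K : Type*} [Field K] [CharZero K]

theorem exists_eq_add_mul_mul {z x y : K} (hz : z ^ 2 + z + 1 = 0)
    (hx : ∃ a b : ℚ, x = a + b * z) (hy : ∃ a b : ℚ, y = a + b * z) :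
    ∃ a b : ℚ, x * y = a + b * z := by
  obtain ⟨a, b, rfl⟩ := hx
  obtain ⟨c, d, rfl⟩ := hy
  refine ⟨a * c - b * d, a * d + b * c - b * d, ?_⟩
  push_cast
  linear_combination b * d * hz

theorem exists_eq_add_mul_add {z x y : K}
    (hx : ∃ a b : ℚ, x = a + b * z) (hy : ∃ a b : ℚ, y = a + b * z) :
    ∃ a b : ℚ, x + y = a + b * z := by
  obtain ⟨a, b, rfl⟩ := hx
  obtain ⟨c, d, rfl⟩ := hy
  refine ⟨a + c, b + d, ?_⟩
  push_cast
  ring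

theorem exists_eq_of_mem_adjoin {z θ : K} {p : ℕ} (hz : z ^ 2 + z + 1 = 0) (hθ : θ ^ 3 = p)
    {s : Set K} (hs : ∀ x ∈ s, x = z ∨ x = z ^ 2 ∨ x = θ ∨ x = θ ^ 2) {x : K} (hx : x ∈ Algebra.adjoin ℚ s) :
    ∃ a a' b b' c c' : ℚ, x = a + a' * z + (b + b' * z) * θ + (c + c' * z) * θ ^ 2 := by
  suffices h : ∃ A B C : K, (∃ a b : ℚ, A = a + b * z) ∧ (∃ a b : ℚ, B = a + b * z) ∧
      (∃ a b : ℚ, C = a + b * z) ∧ x = A + B * θ + C * θ ^ 2 by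
    obtain ⟨_, _, _, ⟨a, a', rfl⟩, ⟨b, b', rfl⟩, ⟨c, c', rfl⟩, h⟩ := h
    exact ⟨a, a', b, b', c, c', h⟩
  have h0 : ∃ a b : ℚ, (0 : K) = a + b * z := ⟨0, 0, by simp⟩
  have h1 : ∃ a b : ℚ, (1 : K) = a + b * z := ⟨1, 0, by simp⟩
  have hp : ∃ a b : ℚ, (p : K) = a + b * z := ⟨p, 0, by simp⟩
  induction hx using Algebra.adjoin_induction with
  | mem x hx =>
    rcases hs x hx with rfl | rfl | rfl | rfl
    · exact ⟨x, 0, 0, ⟨0, 1, by simp⟩, h0, h0, by simp⟩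
    · exact ⟨z ^ 2, 0, 0, ⟨-1, -1, by push_cast; linear_combination hz⟩, h0, h0, by simp⟩
    · exact ⟨0, 1, 0, h0, h1, h0, by simp⟩
    · exact ⟨0, 0, 1, h0, h0, h1, by simp⟩
  | algebraMap r => exact ⟨r, 0, 0, ⟨r, 0, by simp⟩, h0, h0, by simp⟩
  | add x y _ _ hx hy =>
    obtain ⟨A, B, C, hA, hB, hC, rfl⟩ := hx
    obtain ⟨A', B', C', hA', hB', hC', rfl⟩ := hy
    exact ⟨A + A', B + B', C + C', exists_eq_add_mul_add hA hA', exists_eq_add_mul_add hB hB',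
      exists_eq_add_mul_add hC hC', by ring⟩
  | mul x y _ _ hx hy =>
    obtain ⟨A, B, C, hA, hB, hC, rfl⟩ := hx
    obtain ⟨A', B', C', hA', hB', hC', rfl⟩ := hy
    have m {x y : K} := exists_eq_add_mul_mul (x := x) (y := y) hz
    have a {x y : K} := exists_eq_add_mul_add (z := z) (x := x) (y := y)
    exact ⟨A * A' + p * (B * C' + C * B'), A * B' + B * A' + p * (C * C'),
      A * C' + B * B' + C * A',
      a (m hA hA') (m hp (a (m hB hC') (m hC hB'))),
      a (a (m hA hB') (m hB hA')) (m hp (m hC hC')),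
      a (a (m hA hC') (m hB hB')) (m hC hA'), by
        linear_combination (B * C' + C * B' + C * C' * θ) * hθ⟩

end Adjoin

theorem zetaK_eq (d : ℕ) : zetaK d ^ 2 + zetaK d + 1 = 0 := by
  have h := zeta3_isPrimitiveRoot.geom_sum_eq_zero (by norm_num)
  simp only [Finset.sum_range_succ, Finset.sum_range_zero, pow_zero, pow_one, zero_add] at h
  exact Subtype.ext (by
    change zeta3 ^ 2 + zeta3 + 1 = 0
    linear_combination h)

theorem cbrtK_pow (d : ℕ) : cbrtK d ^ 3 = d := Subtype.ext (cbrt_pow_three d)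

theorem mem_adjoin_Kc (d : ℕ) (x : Kc d) :
    x ∈ Algebra.adjoin ℚ ({cbrtK d, zetaK d} : Set (Kc d)) := by
  have hx : (x : ℂ) ∈ (IntermediateField.adjoin ℚ {cbrt d, zeta3}).toSubalgebra := x.2
  rw [adjoin_toSubalgebra_of_isAlgebraic] at hx
  · suffices h : ∀ y ∈ Algebra.adjoin ℚ ({cbrt d, zeta3} : Set ℂ), ∃ h : y ∈ Kc d,
        (⟨y, h⟩ : Kc d) ∈ Algebra.adjoin ℚ ({cbrtK d, zetaK d} : Set (Kc d)) from (h x hx).2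
    intro y hy
    induction hy using Algebra.adjoin_induction with
    | mem y hy =>
      rcases hy with rfl | rfl
      · exact ⟨cbrt_mem d, Algebra.subset_adjoin (Or.inl rfl)⟩
      · exact ⟨zeta3_mem d, Algebra.subset_adjoin (Or.inr rfl)⟩
    | algebraMap r =>
      refine ⟨(Kc d).algebraMap_mem r, ?_⟩
      have : (⟨algebraMap ℚ ℂ r, (Kc d).algebraMap_mem r⟩ : Kc d) = algebraMap ℚ (Kc d) r :=
        Subtype.ext (by simp)
      rw [this]
      exact Subalgebra.algebraMap_mem _ r
    | add x y _ _ hx hy =>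
      obtain ⟨hx, hx'⟩ := hx
      obtain ⟨hy, hy'⟩ := hy
      exact ⟨add_mem hx hy, add_mem hx' hy'⟩
    | mul x y _ _ hx hy =>
      obtain ⟨hx, hx'⟩ := hx
      obtain ⟨hy, hy'⟩ := hy
      exact ⟨mul_mem hx hy, mul_mem hx' hy'⟩
  · rintro x (rfl | rfl)
    · exact (isIntegral_cbrt d).isAlgebraic
    · exact isIntegral_zeta3.isAlgebraic

theorem exists_cbrt_p {d p e₁ : ℕ} (hp : p.Prime) (he₁ : e₁ = 1 ∨ e₁ = 2) (hdp : d = p ^ e₁) :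
    ∃ θ ∈ LS d, θ ^ 3 = p ∧ (cbrtK d = θ ∨ cbrtK d = θ ^ 2) := by
  have h := cbrtK_pow d
  have hmem : cbrtK d ∈ LS d := IntermediateField.mem_adjoin_simple_self ℚ _
  have hp0 : (p : Kc d) ≠ 0 := Nat.cast_ne_zero.2 hp.ne_zero
  rcases he₁ with rfl | rfl
  · refine ⟨cbrtK d, hmem, ?_, Or.inl rfl⟩
    rw [h]; simp [hdp]
  · have h' : cbrtK d ^ 3 = (p : Kc d) ^ 2 := by rw [h]; simp [hdp]
    refine ⟨cbrtK d ^ 2 / p, div_mem (pow_mem hmem 2) (_root_.natCast_mem _ _), ?_, Or.inr ?_⟩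
    · field_simp
      linear_combination (cbrtK d ^ 3 + (p : Kc d) ^ 2) * h'
    · field_simp
      linear_combination -(cbrtK d) * h'

theorem exists_pureCubicField {d p e₁ : ℕ} [hp : Fact p.Prime] (hp9 : p % 9 = 1)
    (he₁ : e₁ = 1 ∨ e₁ = 2) (hdp : d = p ^ e₁)
    {σ : Kc d ≃ₐ[ℚ] Kc d} (hσfix : ∀ x : Kc d, x ∈ k0S d → σ x = x) (hσne : σ ≠ 1)
    {τ : Kc d ≃ₐ[ℚ] Kc d} (hτfix : ∀ x : Kc d, x ∈ LS d → τ x = x) (hτne : τ ≠ 1) :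
    ∃ F : PureCubicField (Kc d) p, F.σ = σ ∧ F.τ = τ ∧ (∀ x, x ∈ k0S d ↔ σ x = x) ∧
      ∀ x, x ∈ LS d ↔ τ x = x := by
  obtain ⟨θ, hθmem, hθ, hc⟩ := exists_cbrt_p hp.out he₁ hdp
  set z := zetaK d with hz
  have hzmem : z ∈ k0S d := IntermediateField.mem_adjoin_simple_self ℚ _
  have hz2 : z ^ 2 + z + 1 = 0 := zetaK_eq d
  have hσz : σ z = z := hσfix z hzmem
  have hτθ : τ θ = θ := hτfix θ hθmem
  have hp0 : (p : Kc d) ≠ 0 := Nat.cast_ne_zero.2 hp.out.ne_zero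
  have hθ0 : θ ≠ 0 := by rintro rfl; exact hp0 (by rw [← hθ]; simp)
  have hex (x : Kc d) := exists_eq_of_mem_adjoin hz2 hθ (s := {cbrtK d, z}) (by
    rintro x (rfl | hx)
    · exact Or.inr (Or.inr hc)
    · exact Or.inl hx) (mem_adjoin_Kc d x)
  have hroot {x : Kc d} (h : x ^ 2 + x + 1 = 0) : x = z ∨ x = z ^ 2 := by
    have : (x - z) * (x - z ^ 2) = 0 := by linear_combination h + (z - 1 - x) * hz2
    rcases mul_eq_zero.1 this with h | h
    · exact Or.inl (sub_eq_zero.1 h)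
    · exact Or.inr (sub_eq_zero.1 h)
  have hσθ : σ θ ≠ θ := fun h => hσne (by
    ext x
    obtain ⟨a, a', b, b', c, c', rfl⟩ := hex x
    simp [h, hσz])
  have hτz : τ z = z ^ 2 := by
    have h1 : τ z ≠ z := fun h => hτne (by
      ext x
      obtain ⟨a, a', b, b', c, c', rfl⟩ := hex x
      simp [h, hτθ])
    refine (hroot ?_).resolve_left h1
    simpa using congrArg τ hz2
  obtain ⟨ζ, hζ⟩ : ∃ ζ, σ θ = ζ * θ := ⟨σ θ / θ, by field_simp⟩
  have hζ1 : ζ ≠ 1 := by rintro rfl; exact hσθ (by rw [hζ, one_mul])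
  have hζ2 : ζ ^ 2 + ζ + 1 = 0 := by
    have h1 := congrArg σ hθ
    rw [map_pow, hζ, map_natCast, ← hθ] at h1
    have h2 : (ζ - 1) * (ζ ^ 2 + ζ + 1) * θ ^ 3 = 0 := by linear_combination h1
    rcases mul_eq_zero.1 h2 with h2 | h2
    · exact (mul_eq_zero.1 h2).resolve_left (sub_ne_zero.2 hζ1)
    · exact absurd h2 (pow_ne_zero 3 hθ0)
  have hζz := hroot hζ2
  have hz3 : z ^ 3 = 1 := by linear_combination (z - 1) * hz2
  let F : PureCubicField (Kc d) p :=
    { σ := σ, τ := τ, θ := θ, ζ := ζ, p_mod := hp9, θ_pow := hθ, ζ_eq := hζ2, σ_θ := hζ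
      σ_ζ := by rcases hζz with h | h <;> simp [h, hσz]
      τ_θ := hτθ
      τ_ζ := by rcases hζz with h | h <;> simp [h, hτz]
      exists_eq := fun x => exists_eq_of_mem_adjoin hζ2 hθ (s := {cbrtK d, z}) (by
        rintro x (rfl | rfl)
        · exact Or.inr (Or.inr hc)
        · rcases hζz with h | h
          · exact Or.inl h.symm
          · exact Or.inr (Or.inl (by rw [h]; linear_combination -z * hz3))) (mem_adjoin_Kc d x) }
  refine ⟨F, rfl, rfl, fun x => ⟨hσfix x, fun h => ?_⟩, fun x => ⟨hτfix x, fun h => ?_⟩⟩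
  · obtain ⟨a, b, rfl⟩ := F.exists_of_σ (x := x) h
    have hζmem : ζ ∈ k0S d := by
      rcases hζz with rfl | rfl
      · exact hzmem
      · exact pow_mem hzmem 2
    have hrat (r : ℚ) : ((r : ℚ) : Kc d) ∈ k0S d := by
      simpa using (k0S d).algebraMap_mem r
    exact add_mem (hrat a) (mul_mem (hrat b) hζmem)
  · obtain ⟨a, b, c, rfl⟩ := F.exists_of_τ (x := x) h
    have hrat (r : ℚ) : ((r : ℚ) : Kc d) ∈ LS d := by
      simpa using (LS d).algebraMap_mem r
    exact add_mem (add_mem (hrat a) (mul_mem (hrat b) hθmem)) (mul_mem (hrat c) (pow_mem hθmem 2))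

namespace PureCubicField

variable {K : Type*} [Field K] [NumberField K] {p : ℕ} [hp : Fact p.Prime]
  (F : PureCubicField K p)

include F

theorem isGalois : IsGalois ℚ K := by
  refine IsGalois.of_fixedField_eq_bot ℚ K ?_
  rw [eq_bot_iff]
  intro x hx
  have h (f : K ≃ₐ[ℚ] K) : f x = x := hx ⟨f, Subgroup.mem_top f⟩
  obtain ⟨a, rfl⟩ := F.exists_of_σ_τ (h F.σ) (h F.τ)
  exact IntermediateField.mem_bot.2 ⟨a, by simp⟩

theorem eq_or_of_sq_add {x : K} (hx : x ^ 2 + x + 1 = 0) : x = F.ζ ∨ x = F.ζ ^ 2 := by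
  have : (x - F.ζ) * (x - F.ζ ^ 2) = 0 := by
    linear_combination hx + (F.ζ - 1 - x) * F.ζ_eq
  exact (mul_eq_zero.1 this).imp sub_eq_zero.1 sub_eq_zero.1

theorem norm_of_fixed_τ {E : IntermediateField ℚ K} (hE : ∀ x, x ∈ E ↔ F.τ x = x) (x : K) :
    (Algebra.norm E x : K) = x * F.τ x := by
  classical
  have := F.isGalois
  have : IsGalois E K := IsGalois.tower_top_of_isGalois ℚ E K
  let τ' : Gal(K/E) := { F.τ with commutes' := fun y => (hE y).1 y.2 }
  have hne : (1 : Gal(K/E)) ≠ τ' := fun h => by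
    have h1 : F.ζ = F.τ F.ζ := congrArg (fun f : Gal(K/E) => f F.ζ) h
    rw [F.τ_ζ] at h1
    have h2 := F.ζ_eq
    have h3 : F.ζ * (F.ζ - 1) = 0 := by linear_combination -h1
    rcases mul_eq_zero.1 h3 with h | h
    · rw [h] at h2; norm_num at h2
    · exact F.ζ_ne_one (sub_eq_zero.1 h)
  have huniv : (Finset.univ : Finset (Gal(K/E))) = {1, τ'} := by
    symm
    rw [Finset.eq_univ_iff_forall]
    intro φ
    have h1 : φ F.θ = F.θ := φ.commutes ⟨F.θ, (hE _).2 F.τ_θ⟩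
    have h2 : φ F.ζ = F.ζ ∨ φ F.ζ = F.ζ ^ 2 := F.eq_or_of_sq_add (by
      simpa using congrArg φ F.ζ_eq)
    rw [Finset.mem_insert, Finset.mem_singleton]
    refine h2.imp (fun h => AlgEquiv.ext fun x => ?_) (fun h => AlgEquiv.ext fun x => ?_)
    · exact F.ext (f := φ.restrictScalars ℚ) (g := AlgEquiv.refl) h1 h x
    · exact F.ext (f := φ.restrictScalars ℚ) (g := F.τ) (h1.trans F.τ_θ.symm) (h.trans F.τ_ζ.symm) x
  have h := Algebra.norm_eq_prod_automorphisms E x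
  rw [huniv, Finset.prod_pair hne] at h
  exact h

theorem norm_of_fixed_σ {E : IntermediateField ℚ K} (hE : ∀ x, x ∈ E ↔ F.σ x = x) (x : K) :
    (Algebra.norm E x : K) = x * F.σ x * F.σ (F.σ x) := by
  classical
  have := F.isGalois
  have : IsGalois E K := IsGalois.tower_top_of_isGalois ℚ E K
  let σ' : Gal(K/E) := { F.σ with commutes' := fun y => (hE y).1 y.2 }
  have h1 : σ' F.θ = F.ζ * F.θ := F.σ_θ
  have h2 : (σ' * σ') F.θ = F.ζ ^ 2 * F.θ := by
    change F.σ (F.σ F.θ) = _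
    rw [F.σ_θ, map_mul, F.σ_θ, F.σ_ζ]; ring
  have hz0 : F.ζ ≠ 0 := F.ζ_prim.ne_zero (by norm_num)
  have hne1 : (1 : Gal(K/E)) ≠ σ' := fun h => by
    have h3 : F.θ = σ' F.θ := congrArg (fun f : Gal(K/E) => f F.θ) h
    rw [h1] at h3
    exact F.ζ_ne_one (mul_right_cancel₀ F.θ_ne_zero (by rw [← h3, one_mul]))
  have hne2 : (1 : Gal(K/E)) ≠ σ' * σ' := fun h => by
    have h3 : F.θ = (σ' * σ') F.θ := congrArg (fun f : Gal(K/E) => f F.θ) h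
    rw [h2] at h3
    have h4 : F.ζ ^ 2 = 1 := mul_right_cancel₀ F.θ_ne_zero (by rw [← h3, one_mul])
    exact F.ζ_ne_one (by have := F.ζ_pow; rw [pow_succ, h4, one_mul] at this; exact this)
  have hne3 : σ' ≠ σ' * σ' := fun h => hne1 (mul_left_cancel (a := σ') (by rw [mul_one]; exact h))
  have huniv : (Finset.univ : Finset (Gal(K/E))) = {1, σ', σ' * σ'} := by
    symm
    rw [Finset.eq_univ_iff_forall]
    intro φ
    have h3 : φ F.ζ = F.ζ := φ.commutes ⟨F.ζ, (hE _).2 F.σ_ζ⟩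
    have h4 : φ F.θ ^ 3 = F.θ ^ 3 := by rw [← map_pow, F.θ_pow, map_natCast]
    have h5 : (φ F.θ - F.θ) * ((φ F.θ - F.ζ * F.θ) * (φ F.θ - F.ζ ^ 2 * F.θ)) = 0 := by
      have := F.ζ_eq
      generalize φ F.θ = x at *
      generalize F.θ = θ at *
      generalize F.ζ = z at *
      grind
    simp only [Finset.mem_insert, Finset.mem_singleton]
    rcases mul_eq_zero.1 h5 with h | h
    · exact Or.inl (AlgEquiv.ext (F.ext (f := φ.restrictScalars ℚ) (g := AlgEquiv.refl)
        (sub_eq_zero.1 h) h3))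
    · rcases mul_eq_zero.1 h with h | h
      · exact Or.inr (Or.inl (AlgEquiv.ext (F.ext (f := φ.restrictScalars ℚ) (g := F.σ)
          ((sub_eq_zero.1 h).trans h1.symm) (h3.trans F.σ_ζ.symm))))
      · exact Or.inr (Or.inr (AlgEquiv.ext (F.ext (f := φ.restrictScalars ℚ) (g := F.σ * F.σ)
          ((sub_eq_zero.1 h).trans h2.symm)
          (h3.trans ((congrArg F.σ F.σ_ζ).trans F.σ_ζ).symm))))
  have h := Algebra.norm_eq_prod_automorphisms E x
  rw [huniv, Finset.prod_insert (by simp [hne1, hne2]), Finset.prod_pair hne3, ← mul_assoc] at h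
  exact h

end PureCubicField

section

variable {d p : ℕ} [Fact p.Prime] (F : PureCubicField (Kc d) p)
  (hk : ∀ x, x ∈ k0S d ↔ F.σ x = x) (hL : ∀ x, x ∈ LS d ↔ F.τ x = x)

include hk hL

theorem subfieldUnits_eq : subfieldUnits d F.σ = F.ring.E₀ := by
  rw [subfieldUnits, PureCubicRing.E₀]
  congr 1
  ext u
  simp only [Set.mem_ofPred_eq, F.ring_s, F.ring_t]
  have key {f g : 𝓞 (Kc d)} : (f : Kc d) = g ↔ f = g := RingOfIntegers.coe_injective.eq_iff
  refine or_congr ?_ (or_congr ?_ (or_congr ?_ ?_))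
  · rw [hk, ← key]; rfl
  · rw [hL, ← key]; rfl
  · rw [IntermediateField.mem_map]
    constructor
    · rintro ⟨w, hw, h⟩
      have hw' : w = ((F.s (F.s u) : 𝓞 (Kc d)) : Kc d) := by
        exact (F.σ_σ_σ w).symm.trans (congrArg (fun y => F.σ (F.σ y)) h)
      refine ⟨F.s (F.s u), key.1 ?_, key.1 ?_⟩
      · rw [← hw']
        change F.τ _ = _
        rw [← hw']; exact (hL w).1 hw
      · exact (F.σ_σ_σ _).symm
    · rintro ⟨w, hw, h⟩
      refine ⟨w, (hL _).2 (key.2 hw), (key.2 h).symm⟩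
  · rw [IntermediateField.mem_map]
    constructor
    · rintro ⟨w, hw, h⟩
      have hw' : w = ((F.s u : 𝓞 (Kc d)) : Kc d) := by
        exact (F.σ_σ_σ w).symm.trans (congrArg F.σ h)
      refine ⟨F.s u, key.1 ?_, key.1 ?_⟩
      · change F.τ _ = _
        rw [← hw']; exact (hL w).1 hw
      · exact (F.σ_σ_σ _).symm
    · rintro ⟨w, hw, h⟩
      refine ⟨w, (hL _).2 (key.2 hw), (key.2 h).symm⟩

theorem subfieldUnitIndex_eq_one_iff : subfieldUnitIndex d F.σ = 1 ↔ F.ring.cP = 1 := by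
  rw [subfieldUnitIndex, subfieldUnits_eq F hk hL, F.ring.index_E₀_eq_one_iff,
    F.ring.E₀_eq_top_iff F.index_Λ]

theorem subfieldUnitIndex_eq_three_iff : subfieldUnitIndex d F.σ = 3 ↔ F.ring.cP ≠ 1 := by
  rw [subfieldUnitIndex, subfieldUnits_eq F hk hL, F.ring.index_E₀_eq_three_iff F.index_Λ,
    ne_eq, F.ring.E₀_eq_top_iff F.index_Λ]

end

section

variable {d p : ℕ} [Fact p.Prime] (F : PureCubicField (Kc d) p)
  (hk : ∀ x, x ∈ k0S d ↔ F.σ x = x)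

/-- The inclusion `k₀ → k` on rings of integers. -/
abbrev k0Incl (d : ℕ) : 𝓞 (k0S d) →+* 𝓞 (Kc d) := RingOfIntegers.mapRingHom (algebraMap (k0S d) (Kc d))

theorem k0Incl_injective : Function.Injective (k0Incl d) := fun _ _ h =>
  RingOfIntegers.ext (Subtype.ext (congrArg (fun w : 𝓞 (Kc d) => (w : Kc d)) h))

include hk

theorem mem_unitNorm_gen_iff (u : (𝓞 (k0S d))ˣ) :
    (∃ v : (𝓞 (Kc d))ˣ, Algebra.norm (k0S d) ((v : 𝓞 (Kc d)) : Kc d) = ((u : 𝓞 (k0S d)) : k0S d)) ↔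
      ∃ v : (𝓞 (Kc d))ˣ, F.ring.N v = k0Incl d u := by
  refine exists_congr fun v => ?_
  rw [← Subtype.coe_inj, F.norm_of_fixed_σ hk, PureCubicRing.N, F.ring_s]
  exact (RingOfIntegers.coe_injective.eq_iff (f := (algebraMap (𝓞 (Kc d)) (Kc d)))
    (a := v * F.s v * F.s (F.s v)) (b := k0Incl d u))

theorem s_k0Incl (u : 𝓞 (k0S d)) : F.ring.s (k0Incl d u) = k0Incl d u := by
  rw [F.ring_s]
  exact RingOfIntegers.ext ((hk _).1 (u : k0S d).2)

theorem unit_cases (u : (𝓞 (k0S d))ˣ) :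
    ∃ i : ℕ, k0Incl d u = F.ring.ζ ^ i ∨ k0Incl d u = - F.ring.ζ ^ i :=
  F.ring.cube_cases (F.ring.fixed_unit_cube (u.isUnit.map (k0Incl d)) (s_k0Incl F hk u))

theorem unitNormIndex_of_ne (h : F.ring.cP ≠ 1) : unitNormIndex d = 1 := by
  rw [unitNormIndex, Subgroup.index_eq_one, Subgroup.eq_top_iff']
  intro u
  refine Subgroup.subset_closure ((mem_unitNorm_gen_iff F hk u).2 ?_)
  obtain ⟨v, hv⟩ := F.ring.exists_unit_N_eq_ζ F.index_Λ h
  have hpow : ∀ i : ℕ, F.ring.N (v ^ i : (𝓞 (Kc d))ˣ) = F.ring.ζ ^ i := fun i => by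
    induction i with
    | zero => simp [PureCubicRing.N]
    | succ i ih => rw [pow_succ, Units.val_mul, F.ring.N_mul, ih, hv, pow_succ]
  obtain ⟨i, hi | hi⟩ := unit_cases F hk u
  · exact ⟨v ^ i, by rw [hi, hpow]⟩
  · exact ⟨-v ^ i, by rw [hi, Units.val_neg, F.ring.N_neg, hpow]⟩

theorem exists_zeta_unit : ∃ z : (𝓞 (k0S d))ˣ, k0Incl d z = F.ring.ζ := by
  have hfi : IsIntegral ℤ (⟨F.ζ, (hk _).2 F.σ_ζ⟩ : k0S d) := by
    rw [← isIntegral_algebraMap_iff (algebraMap (k0S d) (Kc d)).injective]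
    exact F.isIntegral_ζ
  let z : 𝓞 (k0S d) := ⟨⟨F.ζ, (hk _).2 F.σ_ζ⟩, hfi⟩
  have hz : k0Incl d z = F.ring.ζ := by rw [F.ring_ζ]; rfl
  have hz3 : z ^ 3 = 1 := k0Incl_injective (by rw [map_pow, hz, F.ring.ζ_pow, map_one])
  exact ⟨Units.ofPowEqOne z 3 hz3 (by norm_num), hz⟩

theorem unitNormIndex_of_eq (h : F.ring.cP = 1) : unitNormIndex d = 3 := by
  have hN : ∀ v : (𝓞 (Kc d))ˣ, F.ring.N v = 1 ∨ F.ring.N v = -1 :=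
    fun v => F.ring.mem_normOne.1 ((F.ring.normOne_eq_top_iff F.index_Λ).2 h v)
  have hker : unitNormSubgroup d = (powMonoidHom 2 : (𝓞 (k0S d))ˣ →* (𝓞 (k0S d))ˣ).ker := by
    apply le_antisymm
    · rw [unitNormSubgroup, Subgroup.closure_le]
      intro u hu
      obtain ⟨v, hv⟩ := (mem_unitNorm_gen_iff F hk u).1 hu
      have h1 : k0Incl d u ^ 2 = 1 := by
        rw [← hv]
        rcases hN v with h | h <;> rw [h] <;> ring
      rw [SetLike.mem_coe, MonoidHom.mem_ker, powMonoidHom_apply]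
      refine Units.ext (k0Incl_injective ?_)
      rw [Units.val_pow_eq_pow_val, map_pow, h1, Units.val_one, map_one]
    · intro u hu
      rw [MonoidHom.mem_ker, powMonoidHom_apply] at hu
      refine Subgroup.subset_closure ((mem_unitNorm_gen_iff F hk u).2 ?_)
      have h1 : k0Incl d u ^ 2 = 1 := by
        rw [← map_pow, ← Units.val_pow_eq_pow_val, hu, Units.val_one, map_one]
      refine ⟨Units.map (k0Incl d : 𝓞 (k0S d) →* 𝓞 (Kc d)) u, ?_⟩
      change F.ring.N (k0Incl d u) = _
      rw [F.ring.N_of_fixed (s_k0Incl F hk u), pow_succ, h1, one_mul]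
  obtain ⟨z, hz⟩ := exists_zeta_unit F hk
  have hz3 : z ^ 3 = 1 := Units.ext (k0Incl_injective (by
    rw [Units.val_pow_eq_pow_val, map_pow, hz, F.ring.ζ_pow, Units.val_one, map_one]))
  have hz1 : z ≠ 1 := fun h => by
    have h1 : F.ring.ζ = 1 := by rw [← hz, h, Units.val_one, map_one]
    have h2 : F.ζ = 1 := by
      have := congrArg (fun w : 𝓞 (Kc d) => (w : Kc d)) h1
      simpa using this
    exact F.ζ_ne_one h2
  have hrange : (powMonoidHom 2 : (𝓞 (k0S d))ˣ →* (𝓞 (k0S d))ˣ).range = Subgroup.zpowers z := by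
    apply le_antisymm
    · rintro _ ⟨u, rfl⟩
      obtain ⟨i, hi⟩ := unit_cases F hk u
      refine ⟨(2 * i : ℕ), ?_⟩
      refine Units.ext (k0Incl_injective ?_)
      simp only [zpow_natCast, powMonoidHom_apply, Units.val_pow_eq_pow_val, map_pow, hz]
      rcases hi with hi | hi <;> rw [hi] <;> ring
    · rw [Subgroup.zpowers_le]
      exact ⟨z ^ 2, by rw [powMonoidHom_apply, ← pow_mul, pow_succ, hz3, one_mul]⟩
  rw [unitNormIndex, hker, Subgroup.index_ker, hrange, Nat.card_zpowers, orderOf_eq_prime hz3 hz1]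

end

theorem Subgroup.mem_closure_image_iff {G H : Type*} [Group G] [Group H] (f : G →* H) {P : G → Prop}
    (h1 : P 1) (hm : ∀ x y, P x → P y → P (x * y)) (hi : ∀ x, P x → P x⁻¹) {I : H} :
    I ∈ Subgroup.closure {I | ∃ x, I = f x ∧ P x} ↔ ∃ x, I = f x ∧ P x := by
  refine ⟨fun h => ?_, fun h => Subgroup.subset_closure h⟩
  induction h using Subgroup.closure_induction with
  | mem I h => exact h
  | one => exact ⟨1, f.map_one.symm, h1⟩
  | mul I J _ _ hI hJ =>
    obtain ⟨x, rfl, hx⟩ := hI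
    obtain ⟨y, rfl, hy⟩ := hJ
    exact ⟨x * y, (f.map_mul x y).symm, hm x y hx hy⟩
  | inv I _ hI =>
    obtain ⟨x, rfl, hx⟩ := hI
    exact ⟨x⁻¹, (f.map_inv x).symm, hi x hx⟩

theorem Subgroup.card_quotient_eq_three {G : Type*} [CommGroup G] (A B : Subgroup G) {g : G}
    (hg : g ∈ A) (h3 : g ^ 3 ∈ B) (h1 : g ∉ B) (h : ∀ a ∈ A, ∃ n : ℕ, (g ^ n)⁻¹ * a ∈ B) :
    Nat.card (A ⧸ B.subgroupOf A) = 3 := by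
  set q : A ⧸ B.subgroupOf A := QuotientGroup.mk ⟨g, hg⟩ with hq
  have hq3 : q ^ 3 = 1 := by
    rw [hq, ← QuotientGroup.mk_pow, QuotientGroup.eq_one_iff]
    exact h3
  have hq1 : q ≠ 1 := fun h => h1 (by
    rw [hq, QuotientGroup.eq_one_iff] at h
    exact h)
  rw [← orderOf_eq_card_of_forall_mem_zpowers (g := q), orderOf_eq_prime hq3 hq1]
  intro x
  obtain ⟨⟨a, ha⟩, rfl⟩ := QuotientGroup.mk_surjective x
  obtain ⟨n, hn⟩ := h a ha
  refine ⟨n, ?_⟩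
  change q ^ (n : ℤ) = _
  rw [zpow_natCast, hq, ← QuotientGroup.mk_pow]
  exact QuotientGroup.eq.2 hn

theorem Subgroup.card_closure_eq_three {A Q : Type*} [CommGroup A] [CommGroup Q] (f : A →* Q)
    {S : Set Q} {g : A} (hg : f g ∈ S) (h3 : f (g ^ 3) = 1) (h1 : f g ≠ 1)
    (h : ∀ c ∈ S, ∃ n : ℕ, c = f (g ^ n)) : Nat.card (Subgroup.closure S) = 3 := by
  have e : Subgroup.closure S = Subgroup.zpowers (f g) := by
    apply le_antisymm
    · rw [Subgroup.closure_le]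
      intro c hc
      obtain ⟨n, rfl⟩ := h c hc
      rw [map_pow]
      exact Subgroup.pow_mem _ (Subgroup.mem_zpowers _) n
    · rw [Subgroup.zpowers_le]
      exact Subgroup.subset_closure hg
  rw [e, Nat.card_zpowers, orderOf_eq_prime (by rw [← map_pow, h3]) h1]

section

variable {K : Type*} [Field K] [NumberField K]

theorem NumberField.spanSingleton_eq_iff {x y : K} :
    FractionalIdeal.spanSingleton (𝓞 K)⁰ x = FractionalIdeal.spanSingleton (𝓞 K)⁰ y ↔
      ∃ u : (𝓞 K)ˣ, x = (u : 𝓞 K) * y := by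
  rw [eq_comm, FractionalIdeal.spanSingleton_eq_spanSingleton]
  exact exists_congr fun u => by rw [Units.smul_def, Algebra.smul_def, eq_comm]

theorem NumberField.toPrincipalIdeal_eq_iff {x y : Kˣ} :
    toPrincipalIdeal (𝓞 K) K x = toPrincipalIdeal (𝓞 K) K y ↔
      ∃ u : (𝓞 K)ˣ, (x : K) = (u : 𝓞 K) * y := by
  rw [_root_.toPrincipalIdeal_eq_iff, coe_toPrincipalIdeal, NumberField.spanSingleton_eq_iff]

theorem NumberField.exists_int_mul (x : K) : ∃ n : ℤ, n ≠ 0 ∧ ∃ z : 𝓞 K, (z : K) = n * x := by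
  obtain ⟨y, hy, h⟩ := ((IsFractionRing.isAlgebraic_iff ℤ ℚ K).2
    (Algebra.IsAlgebraic.isAlgebraic x)).exists_integral_multiple
  exact ⟨y, hy, ⟨y • x, h⟩, by simp⟩

end

section

variable {d p : ℕ} [Fact p.Prime] (F : PureCubicField (Kc d) p)

theorem mem_ambPrincipalL_iff {I : (FractionalIdeal (𝓞 (LS d))⁰ (LS d))ˣ} :
    I ∈ ambPrincipalL d F.σ ↔ ∃ x : (LS d)ˣ, I = toPrincipalIdeal (𝓞 (LS d)) (LS d) x ∧
      FractionalIdeal.spanSingleton (𝓞 (Kc d))⁰ (F.σ (algebraMap (LS d) (Kc d) (x : LS d))) =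
        FractionalIdeal.spanSingleton (𝓞 (Kc d))⁰ (algebraMap (LS d) (Kc d) (x : LS d)) := by
  refine Subgroup.mem_closure_image_iff (toPrincipalIdeal (𝓞 (LS d)) (LS d)) (P := fun x =>
    FractionalIdeal.spanSingleton (𝓞 (Kc d))⁰ (F.σ (algebraMap (LS d) (Kc d) (x : LS d))) =
        FractionalIdeal.spanSingleton (𝓞 (Kc d))⁰ (algebraMap (LS d) (Kc d) (x : LS d))) ?_ ?_ ?_
  · simp
  · intro x y hx hy
    simp only [Units.val_mul, map_mul, ← FractionalIdeal.spanSingleton_mul_spanSingleton] at *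
    rw [hx, hy]
  · intro x hx
    simp only [Units.val_inv_eq_inv_val, map_inv₀, ← FractionalIdeal.spanSingleton_inv] at *
    rw [hx]

theorem mem_principalFromK0_iff {I : (FractionalIdeal (𝓞 (Kc d))⁰ (Kc d))ˣ} :
    I ∈ principalFromK0 d ↔ ∃ y : (Kc d)ˣ, I = toPrincipalIdeal (𝓞 (Kc d)) (Kc d) y ∧
      (y : Kc d) ∈ k0S d := by
  rw [← Subgroup.mem_closure_image_iff (toPrincipalIdeal (𝓞 (Kc d)) (Kc d))
    (P := fun y => (y : Kc d) ∈ k0S d) (one_mem _) (fun x y hx hy => mul_mem hx hy)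
    (fun x hx => by rw [Units.val_inv_eq_inv_val]; exact inv_mem hx)]
  rw [principalFromK0]
  simp only [and_comm]

theorem mem_principalFromQ_iff {I : (FractionalIdeal (𝓞 (LS d))⁰ (LS d))ˣ} :
    I ∈ principalFromQ d ↔ ∃ r : ℚˣ, I = toPrincipalIdeal (𝓞 (LS d)) (LS d)
      (Units.map (algebraMap ℚ (LS d)).toMonoidHom r) := by
  have := Subgroup.mem_closure_image_iff ((toPrincipalIdeal (𝓞 (LS d)) (LS d)).comp
    (Units.map (algebraMap ℚ (LS d)).toMonoidHom)) (P := fun _ => True) trivial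
    (fun _ _ _ _ => trivial) (fun _ _ => trivial) (I := I)
  simp only [and_true] at this
  exact this

end

section

variable {d p : ℕ} [Fact p.Prime] (F : PureCubicField (Kc d) p)
  (hL : ∀ x, x ∈ LS d ↔ F.τ x = x)

/-- The inclusion `L → k` on rings of integers. -/
abbrev LIncl (d : ℕ) : 𝓞 (LS d) →+* 𝓞 (Kc d) := RingOfIntegers.mapRingHom (algebraMap (LS d) (Kc d))

include hL

theorem exists_of_t {v : 𝓞 (Kc d)} (h : F.ring.t v = v) : ∃ w : 𝓞 (LS d), LIncl d w = v := by
  have hv : (v : Kc d) ∈ LS d := by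
    rw [hL, ← F.coe_t, ← F.ring_t, h]
  refine ⟨⟨⟨v, hv⟩, ?_⟩, rfl⟩
  exact (isIntegral_algebraMap_iff (algebraMap (LS d) (Kc d)).injective).1
    (RingOfIntegers.isIntegral_coe v)

omit hL in
theorem LIncl_injective : Function.Injective (LIncl d) := fun _ _ h =>
  RingOfIntegers.ext (Subtype.ext (congrArg (fun w : 𝓞 (Kc d) => (w : Kc d)) h))

theorem exists_unit_of_t {v : (𝓞 (Kc d))ˣ} (h : F.ring.t v = v) :
    ∃ w : (𝓞 (LS d))ˣ, LIncl d w = v := by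
  obtain ⟨w, hw⟩ := exists_of_t F hL h
  have h' : F.ring.t (v⁻¹ : (𝓞 (Kc d))ˣ) = (v⁻¹ : (𝓞 (Kc d))ˣ) := by
    have : (v : 𝓞 (Kc d)) * F.ring.t (v⁻¹ : (𝓞 (Kc d))ˣ) = v * (v⁻¹ : (𝓞 (Kc d))ˣ) := by
      conv_lhs => rw [← h, ← map_mul, Units.mul_inv, map_one]
      rw [Units.mul_inv]
    exact mul_left_cancel₀ v.ne_zero this
  obtain ⟨w', hw'⟩ := exists_of_t F hL h'
  refine ⟨⟨w, w', LIncl_injective ?_, LIncl_injective ?_⟩, hw⟩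
  · rw [map_mul, hw, hw', Units.mul_inv, map_one]
  · rw [map_mul, hw, hw', Units.inv_mul, map_one]

theorem t_LIncl (x : 𝓞 (LS d)) : F.ring.t (LIncl d x) = LIncl d x := by
  rw [F.ring_t]
  exact RingOfIntegers.ext ((hL _).1 (x : LS d).2)

omit hL in
theorem exists_ambiguous {x : Kc d} (hx : x ≠ 0) {u : (𝓞 (Kc d))ˣ} (h : F.σ x = (u : 𝓞 (Kc d)) * x) :
    ∃ n : ℤ, n ≠ 0 ∧ ∃ z : 𝓞 (Kc d), (z : Kc d) = n * x ∧ z ≠ 0 ∧ F.ring.s z = u * z := by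
  obtain ⟨n, hn, z, hz⟩ := NumberField.exists_int_mul x
  refine ⟨n, hn, z, hz, ?_, ?_⟩
  · rintro rfl
    exact mul_ne_zero (Int.cast_ne_zero.2 hn) hx
      (hz.symm.trans (map_zero (algebraMap (𝓞 (Kc d)) (Kc d))))
  · rw [F.ring_s]
    refine RingOfIntegers.ext ?_
    refine (congrArg F.σ hz).trans (Eq.trans ?_
      (map_mul (algebraMap (𝓞 (Kc d)) (Kc d)) (u : 𝓞 (Kc d)) z).symm)
    rw [map_mul, h, map_intCast, mul_left_comm]
    exact congrArg (fun y => ((u : 𝓞 (Kc d)) : Kc d) * y) hz.symm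

theorem card_absPrincipalFactors : Nat.card (absPrincipalFactors d F.σ) = 3 := by
  let θL : (LS d)ˣ := Units.mk0 ⟨F.θ, (hL _).2 F.τ_θ⟩ (fun h => F.θ_ne_zero (congrArg Subtype.val h))
  have hθL : ((θL : LS d) : Kc d) = F.θ := rfl
  obtain ⟨z, hz⟩ := F.ring.isUnit_ζ
  rw [F.ring_ζ] at hz
  refine Subgroup.card_quotient_eq_three (ambPrincipalL d F.σ) (principalFromQ d)
    (g := toPrincipalIdeal (𝓞 (LS d)) (LS d) θL) ?_ ?_ ?_ ?_
  · refine (mem_ambPrincipalL_iff F).2 ⟨θL, rfl, ?_⟩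
    refine NumberField.spanSingleton_eq_iff.2 ⟨z, ?_⟩
    rw [hz]
    exact F.σ_θ
  · have hp0 : (p : ℚ) ≠ 0 := Nat.cast_ne_zero.2 (Fact.out : p.Prime).ne_zero
    refine mem_principalFromQ_iff.2 ⟨Units.mk0 (p : ℚ) hp0, ?_⟩
    rw [← map_pow]
    congr 1
    refine Units.ext (Subtype.ext ?_)
    exact F.θ_pow.trans (by simp)
  · intro h
    obtain ⟨r, hr⟩ := mem_principalFromQ_iff.1 h
    obtain ⟨u, hu⟩ := NumberField.toPrincipalIdeal_eq_iff.1 hr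
    have hr' : (r : ℚ) * (r : ℚ).den = (r : ℚ).num := Rat.mul_den_eq_num _
    have h1 : F.ring.θ ^ 1 * (((r : ℚ).den : ℤ) : 𝓞 (Kc d)) =
        ((r : ℚ).num : 𝓞 (Kc d)) * LIncl d u := by
      refine RingOfIntegers.ext ?_
      have h2 : F.θ = ((u : 𝓞 (LS d)) : LS d) * ((r : ℚ) : Kc d) := congrArg Subtype.val hu
      have h3 : (((r : ℚ).num : ℚ) : Kc d) = (r : ℚ) * (((r : ℚ).den : ℚ) : Kc d) := by
        rw [← Rat.cast_mul, hr']
      simp only [F.ring_θ, pow_one, map_mul, F.coe_θ', map_intCast, map_natCast, Int.cast_natCast]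
      rw [h2]
      push_cast at h3
      rw [h3]
      change _ = _ * (((u : 𝓞 (LS d)) : LS d) : Kc d)
      ring
    have := F.ring.three_dvd_of_pow (by exact_mod_cast (r : ℚ).den_ne_zero) (u.isUnit.map (LIncl d)) h1
    norm_num at this
  · intro I hI
    obtain ⟨x, rfl, hx⟩ := (mem_ambPrincipalL_iff F).1 hI
    obtain ⟨u, hu⟩ := NumberField.spanSingleton_eq_iff.1 hx
    have hx0 : ((x : LS d) : Kc d) ≠ 0 := fun h => x.ne_zero (Subtype.ext h)
    obtain ⟨n, hn, y, hy, hy0, hys⟩ := exists_ambiguous F hx0 hu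
    have hyt : F.ring.t y = y := by
      rw [F.ring_t]
      refine RingOfIntegers.ext ?_
      rw [F.coe_t, hy, map_mul, map_intCast, (hL _).1 (x : LS d).2]
    obtain ⟨a, r, v, hyv, hv⟩ := F.ring.exists_of_s_t hy0 u.isUnit hys hyt
    obtain ⟨w, hw⟩ := exists_unit_of_t F hL hv
    have hr : r ≠ 0 := by
      rintro rfl
      exact hy0 (by rw [hyv]; simp)
    have hrn : (r / n : ℚ) ≠ 0 := div_ne_zero (Int.cast_ne_zero.2 hr) (Int.cast_ne_zero.2 hn)
    refine ⟨a, mem_principalFromQ_iff.2 ⟨Units.mk0 (r / n : ℚ) hrn, ?_⟩⟩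
    rw [← map_pow, ← map_inv, ← map_mul, NumberField.toPrincipalIdeal_eq_iff]
    refine ⟨w, Subtype.ext ?_⟩
    have h1 : (y : Kc d) = F.θ ^ a * r * ((w : 𝓞 (LS d)) : LS d) := by
      rw [hyv, ← hw, F.ring_θ]
      simp only [map_mul, map_pow, map_intCast, F.coe_θ']
      rfl
    have hn0 : (n : Kc d) ≠ 0 := Int.cast_ne_zero.2 hn
    have hθ0 := pow_ne_zero a F.θ_ne_zero
    rw [hy] at h1
    have h2 : (F.θ ^ a)⁻¹ * ((x : LS d) : Kc d) =
        ((w : 𝓞 (LS d)) : LS d) * ((r / n : ℚ) : Kc d) := by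
      push_cast
      field_simp
      rw [mul_comm, h1]; ring
    rw [Units.val_mul, Units.val_inv_eq_inv_val, Units.val_pow_eq_pow_val]
    exact h2

end

section

/-- The projection `𝒫_k^G → 𝒫_k^G/𝒫_{k₀}`. -/
def ambMk (d : ℕ) (σ : Kc d ≃ₐ[ℚ] Kc d) : ambPrincipalK d σ →* ambPrincipalQuot d σ where
  toFun := QuotientGroup.mk
  map_one' := rfl
  map_mul' _ _ := rfl

theorem ambMk_eq_iff {d : ℕ} {σ : Kc d ≃ₐ[ℚ] Kc d} {a b : ambPrincipalK d σ} :
    ambMk d σ a = ambMk d σ b ↔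
      (a : (FractionalIdeal (𝓞 (Kc d))⁰ (Kc d))ˣ)⁻¹ * b ∈ principalFromK0 d := QuotientGroup.eq

theorem ambMk_eq_one_iff {d : ℕ} {σ : Kc d ≃ₐ[ℚ] Kc d} {a : ambPrincipalK d σ} :
    ambMk d σ a = 1 ↔ (a : (FractionalIdeal (𝓞 (Kc d))⁰ (Kc d))ˣ) ∈ principalFromK0 d := by
  rw [eq_comm, ← map_one (ambMk d σ), ambMk_eq_iff, OneMemClass.coe_one, inv_one, one_mul]

variable {d p : ℕ} [Fact p.Prime] (F : PureCubicField (Kc d) p)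
  (hk : ∀ x, x ∈ k0S d ↔ F.σ x = x) (hL : ∀ x, x ∈ LS d ↔ F.τ x = x)

include hL

theorem exists_relative_factor {x : Kc d} (hx : x ≠ 0)
    (h : FractionalIdeal.spanSingleton (𝓞 (Kc d))⁰ (F.σ x) =
      FractionalIdeal.spanSingleton (𝓞 (Kc d))⁰ x) {r : ℚˣ} {u : (𝓞 (LS d))ˣ}
    (hn : Algebra.norm (LS d) x = algebraMap ℚ (LS d) (r : ℚ) * ((u : 𝓞 (LS d)) : LS d)) :
    ∃ n : ℤ, n ≠ 0 ∧ ∃ z : 𝓞 (Kc d), (z : Kc d) = n * x ∧ z ≠ 0 ∧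
      (∃ v, IsUnit v ∧ F.ring.s z = v * z) ∧ ∃ k m : ℤ, k ≠ 0 ∧ ∃ v : 𝓞 (Kc d), IsUnit v ∧
        (k : 𝓞 (Kc d)) * (z * F.ring.t z) = m * v := by
  obtain ⟨u', hu'⟩ := NumberField.spanSingleton_eq_iff.1 h
  obtain ⟨n, hn0, z, hz, hz0, hzs⟩ := exists_ambiguous F hx hu'
  refine ⟨n, hn0, z, hz, hz0, ⟨u', u'.isUnit, hzs⟩, (r : ℚ).den, n ^ 2 * (r : ℚ).num,
    by exact_mod_cast (r : ℚ).den_ne_zero, LIncl d u, u.isUnit.map _, ?_⟩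
  have h1 : x * F.τ x = ((r : ℚ) : Kc d) * ((u : 𝓞 (LS d)) : LS d) :=
    (F.norm_of_fixed_τ hL x).symm.trans (congrArg Subtype.val hn)
  have hr' : (r : ℚ) * (r : ℚ).den = (r : ℚ).num := Rat.mul_den_eq_num _
  have h3 : (((r : ℚ).num : ℚ) : Kc d) = (r : ℚ) * (((r : ℚ).den : ℚ) : Kc d) := by
    rw [← Rat.cast_mul, hr']
  push_cast at h3
  refine RingOfIntegers.ext ?_
  have ht : ((F.ring.t z : 𝓞 (Kc d)) : Kc d) = n * F.τ x := by
    rw [F.ring_t, F.coe_t]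
    exact (congrArg F.τ hz).trans (by rw [map_mul, map_intCast])
  have h4 : (((r : ℚ).den : ℤ) : Kc d) * ((n * x) * (n * F.τ x)) =
      ((n ^ 2 * (r : ℚ).num : ℤ) : Kc d) * (((u : 𝓞 (LS d)) : LS d) : Kc d) := by
    push_cast
    rw [h3]
    linear_combination (((r : ℚ).den : Kc d) * n ^ 2) * h1
  rw [← ht, ← hz] at h4
  simp only [map_mul, map_intCast]
  exact h4

include hk

omit hL in
theorem mem_k0S_of_fixed {y : 𝓞 (Kc d)} (hy : F.ring.s y = y) (n : ℤ) :
    (y : Kc d) / n ∈ k0S d := by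
  rw [hk, map_div₀, map_intCast, ← F.coe_s, ← F.ring_s, hy]

theorem card_relPrincipalFactors_of_ne (hP : F.ring.cP ≠ 1) :
    Nat.card (relPrincipalFactors d F.σ) = 1 := by
  suffices h : relPrincipalFactors d F.σ = ⊥ by rw [h, Subgroup.card_bot]
  rw [relPrincipalFactors, Subgroup.closure_eq_bot_iff]
  rintro c ⟨x, h, rfl, r, u, hn⟩
  refine ambMk_eq_one_iff.2 ?_
  obtain ⟨n, hn0, z, hz, hz0, ⟨v, hv, hs⟩, k, m, hk0, v', hv', e⟩ :=
    exists_relative_factor F hL x.ne_zero h hn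
  obtain ⟨y, hy0, hy, w, hw⟩ := F.ring.exists_fixed_of_cP_ne hz0 hv hs hk0 hv' e hP
  have hn0' : (n : Kc d) ≠ 0 := Int.cast_ne_zero.2 hn0
  have hy0' : (y : Kc d) ≠ 0 := RingOfIntegers.coe_ne_zero_iff.2 hy0
  refine mem_principalFromK0_iff.2 ⟨Units.mk0 ((y : Kc d) / n) (div_ne_zero hy0' hn0'), ?_,
    mem_k0S_of_fixed F hk hy n⟩
  refine NumberField.toPrincipalIdeal_eq_iff.2 ⟨w, ?_⟩
  have h1 : (n : Kc d) * x = y * (w : 𝓞 (Kc d)) := by rw [← hz, hw]; rfl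
  rw [Units.val_mk0]
  field_simp
  linear_combination h1

theorem card_relPrincipalFactors_of_eq (hP : F.ring.cP = 1) :
    Nat.card (relPrincipalFactors d F.σ) = 3 := by
  obtain ⟨ρ, hρ⟩ := F.ring.cP_eq_one_iff.1 hP
  have hρ0 : ρ ≠ 0 := by
    rintro rfl
    exact F.ring.P_ne_bot (by rw [← hρ]; simp)
  have hρ0' : (ρ : Kc d) ≠ 0 := RingOfIntegers.coe_ne_zero_iff.2 hρ0
  have hτρ : ((F.ring.t ρ : 𝓞 (Kc d)) : Kc d) = F.τ ρ := by rw [F.ring_t, F.coe_t]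
  have hσρ : ((F.ring.s ρ : 𝓞 (Kc d)) : Kc d) = F.σ ρ := by rw [F.ring_s, F.coe_s]
  have hτρ0 : F.τ (ρ : Kc d) ≠ 0 := by simpa using hρ0'
  let g : (Kc d)ˣ := Units.mk0 ((ρ : Kc d) / F.τ ρ) (div_ne_zero hρ0' hτρ0)
  have hg : FractionalIdeal.spanSingleton (𝓞 (Kc d))⁰ (F.σ (g : Kc d)) =
      FractionalIdeal.spanSingleton (𝓞 (Kc d))⁰ (g : Kc d) := by
    obtain ⟨u, hu⟩ := F.ring.s_ρ hρ
    obtain ⟨u', hu'⟩ : ∃ u' : (𝓞 (Kc d))ˣ, F.ring.s (F.ring.t ρ) = u' * F.ring.t ρ := by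
      obtain ⟨u', h'⟩ := (((u.isUnit.map F.ring.s).mul u.isUnit).map F.ring.t)
      refine ⟨u', ?_⟩
      rw [← F.ring.t_s_s, hu, map_mul, hu, h', ← map_mul]
      ring_nf
    have h1 : F.σ (ρ : Kc d) = (u : 𝓞 (Kc d)) * (ρ : Kc d) := by
      rw [← hσρ, hu]; rfl
    have h2 : F.σ (F.τ (ρ : Kc d)) = (u' : 𝓞 (Kc d)) * F.τ (ρ : Kc d) := by
      rw [← hτρ, ← F.coe_s, ← F.ring_s, hu']; rfl
    have hu0 : ((u' : 𝓞 (Kc d)) : Kc d) ≠ 0 := RingOfIntegers.coe_ne_zero_iff.2 u'.ne_zero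
    have hinv : ((u' : 𝓞 (Kc d)) : Kc d) * ((u'⁻¹ : (𝓞 (Kc d))ˣ) : 𝓞 (Kc d)) = 1 :=
      congrArg (algebraMap (𝓞 (Kc d)) (Kc d)) (Units.mul_inv u')
    refine NumberField.spanSingleton_eq_iff.2 ⟨u * u'⁻¹, ?_⟩
    have h3 : (((u * u'⁻¹ : (𝓞 (Kc d))ˣ) : 𝓞 (Kc d)) : Kc d) =
      ((u : 𝓞 (Kc d)) : Kc d) * ((u'⁻¹ : (𝓞 (Kc d))ˣ) : 𝓞 (Kc d)) := rfl
    rw [h3, Units.val_mk0, map_div₀, h1, h2]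
    field_simp
    linear_combination - hinv
  refine Subgroup.card_closure_eq_three (ambMk d F.σ)
    (g := ⟨toPrincipalIdeal (𝓞 (Kc d)) (Kc d) g, Subgroup.subset_closure ⟨g, rfl, hg⟩⟩) ?_ ?_ ?_ ?_
  · refine ⟨g, hg, rfl, 1, 1, Subtype.ext ?_⟩
    rw [F.norm_of_fixed_τ hL]
    have h1 : (g : Kc d) * F.τ g = 1 := by
      rw [Units.val_mk0, map_div₀, F.τ_τ]
      field_simp
    exact h1.trans (by simp)
  · refine ambMk_eq_one_iff.2 (mem_principalFromK0_iff.2 ?_)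
    obtain ⟨u, hu⟩ := F.ring.ρ_pow hρ
    obtain ⟨u', hu'⟩ := u.isUnit.map F.ring.t
    have hπ : (F.ring.π : Kc d) ≠ 0 := RingOfIntegers.coe_ne_zero_iff.2 F.ring.π_ne_zero
    have hπ' : ((F.ring.t F.ring.π : 𝓞 (Kc d)) : Kc d) ≠ 0 :=
      RingOfIntegers.coe_ne_zero_iff.2 F.ring.t_π_ne_zero
    have h1 : (ρ : Kc d) ^ 3 = ((u : 𝓞 (Kc d)) : Kc d) * F.ring.π := by
      have h2 := congrArg (algebraMap (𝓞 (Kc d)) (Kc d)) hu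
      simp only [map_mul, map_pow] at h2
      exact h2
    have h1' : F.τ (ρ : Kc d) ^ 3 = ((u' : 𝓞 (Kc d)) : Kc d) *
        (F.ring.t F.ring.π : 𝓞 (Kc d)) := by
      have h2 := congrArg F.ring.t hu
      rw [map_pow, map_mul, ← hu'] at h2
      have h3 := congrArg (algebraMap (𝓞 (Kc d)) (Kc d)) h2
      simp only [map_mul, map_pow] at h3
      rw [← hτρ]
      exact h3
    refine ⟨Units.mk0 ((F.ring.π : Kc d) / (F.ring.t F.ring.π : 𝓞 (Kc d))) (div_ne_zero hπ hπ'),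
      ?_, ?_⟩
    · rw [SubmonoidClass.coe_pow, ← map_pow, NumberField.toPrincipalIdeal_eq_iff]
      refine ⟨u * u'⁻¹, ?_⟩
      have hu0 : ((u' : 𝓞 (Kc d)) : Kc d) ≠ 0 := RingOfIntegers.coe_ne_zero_iff.2 u'.ne_zero
      have hinv : ((u' : 𝓞 (Kc d)) : Kc d) * ((u'⁻¹ : (𝓞 (Kc d))ˣ) : 𝓞 (Kc d)) = 1 :=
        congrArg (algebraMap (𝓞 (Kc d)) (Kc d)) (Units.mul_inv u')
      have h3 : (((u * u'⁻¹ : (𝓞 (Kc d))ˣ) : 𝓞 (Kc d)) : Kc d) =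
        ((u : 𝓞 (Kc d)) : Kc d) * ((u'⁻¹ : (𝓞 (Kc d))ˣ) : 𝓞 (Kc d)) := rfl
      rw [h3, Units.val_pow_eq_pow_val, Units.val_mk0, Units.val_mk0, div_pow, h1, h1']
      field_simp
      linear_combination - hinv
    · rw [hk, Units.val_mk0, map_div₀, ← F.coe_s, ← F.coe_s, ← F.ring_s, F.ring.s_π, F.ring.s_t_π]
  · intro h
    obtain ⟨y, hy, hyk⟩ := mem_principalFromK0_iff.1 (ambMk_eq_one_iff.1 h)
    obtain ⟨w, hw⟩ := NumberField.toPrincipalIdeal_eq_iff.1 hy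
    obtain ⟨n, hn, z, hz⟩ := NumberField.exists_int_mul (y : Kc d)
    refine F.ring.ρ_mul_ne hρ hn (y := z) ?_ w ?_
    · rw [F.ring_s]
      refine RingOfIntegers.ext ?_
      rw [F.coe_s, hz, map_mul, map_intCast, (hk _).1 hyk]
    · refine RingOfIntegers.ext ?_
      have h1 : (ρ : Kc d) / F.τ ρ = (w : 𝓞 (Kc d)) * (y : Kc d) := hw
      rw [div_eq_iff hτρ0] at h1
      have h2 : (ρ : Kc d) * n = ((F.ring.t ρ : 𝓞 (Kc d)) : Kc d) * ((z : Kc d) *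
          ((w : 𝓞 (Kc d)) : Kc d)) := by
        rw [hτρ, hz]
        linear_combination (n : Kc d) * h1
      simp only [map_mul, map_intCast]
      exact h2
  · rintro c ⟨x, h, rfl, r, u, hn⟩
    obtain ⟨n, hn0, z, hz, hz0, ⟨v, hv, hs⟩, k, m, hk0, v', hv', e⟩ :=
      exists_relative_factor F hL x.ne_zero h hn
    obtain ⟨a, y, hy0, hy, w, hw⟩ := F.ring.exists_fixed_of_span_eq_P hz0 hv hs hk0 hv' e hρ
    refine ⟨a, Eq.symm (ambMk_eq_iff.2 (mem_principalFromK0_iff.2 ?_))⟩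
    have hn0' : (n : Kc d) ≠ 0 := Int.cast_ne_zero.2 hn0
    have hy0' : (y : Kc d) ≠ 0 := RingOfIntegers.coe_ne_zero_iff.2 hy0
    refine ⟨Units.mk0 ((y : Kc d) / n) (div_ne_zero hy0' hn0'), ?_,
      mem_k0S_of_fixed F hk hy n⟩
    rw [SubmonoidClass.coe_pow, ← map_pow, ← map_inv, ← map_mul, NumberField.toPrincipalIdeal_eq_iff]
    refine ⟨w, ?_⟩
    have h1 : (z : Kc d) * F.τ (ρ : Kc d) ^ a = (ρ : Kc d) ^ a * ((y : Kc d) * (w : 𝓞 (Kc d))) := by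
      have h2 := congrArg (algebraMap (𝓞 (Kc d)) (Kc d)) hw
      simp only [map_mul, map_pow] at h2
      rw [← hτρ]
      exact h2
    rw [hz] at h1
    rw [Units.val_mul, Units.val_inv_eq_inv_val, Units.val_pow_eq_pow_val, Units.val_mk0,
      Units.val_mk0, div_pow, inv_div]
    have h3 := pow_ne_zero a hρ0'
    field_simp
    linear_combination h1

end

section

variable {d p : ℕ} [Fact p.Prime] (F : PureCubicField (Kc d) p)

theorem LIncl_isIntegral : (LIncl d).IsIntegral := by
  intro x
  obtain ⟨q, hq, hx⟩ := RingOfIntegers.isIntegral x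
  refine ⟨q.map (Int.castRingHom _), hq.map _, ?_⟩
  rw [Polynomial.eval₂_map, ← hx]
  congr 1

theorem primaryComponent_L_isCyclic (hL : ∀ x, x ∈ LS d ↔ F.τ x = x)
    {c : CommGroup.primaryComponent (ClassGroup (𝓞 (Kc d))) 3}
    (hc : ∀ x, primaryMap 3 F.ring.tC x = x ↔ x ∈ Subgroup.zpowers c) :
    IsCyclic (CommGroup.primaryComponent (ClassGroup (𝓞 (LS d))) 3) ∧
      Nat.card (CommGroup.primaryComponent (ClassGroup (𝓞 (LS d))) 3) = orderOf c := by
  have hf : Function.Injective (LIncl d) := LIncl_injective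
  have hfix : ∀ x, F.ring.t x = x ↔ ∃ r, LIncl d r = x :=
    fun x => ⟨exists_of_t F hL, by rintro ⟨r, rfl⟩; exact t_LIncl F hL r⟩
  exact primaryComponent_isCyclic_of_fixed (classMap (LIncl d) hf) F.ring.tC
    (fun a => classMap_sq_eq_one hf LIncl_isIntegral F.ring.t_t hfix)
    (classMap_classMap_of_fixed hf hfix)
    (fun c => exists_classMap_eq_sq hf F.ring.t_t hfix) c hc

end

theorem PureCubicRing.isPrincipal_iff {O : Type*} [CommRing O] [IsDedekindDomain O] [CharZero O]
    {p : ℕ} [Fact p.Prime] (D : PureCubicRing O p) {Q J : Ideal O} (hQ : Q.IsPrime)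
    (h : Ideal.span {(p : O)} = Q ^ 3 * J) : D.cP = 1 ↔ Submodule.IsPrincipal Q := by
  have hp0 : Ideal.span {(p : O)} ≠ ⊥ := by
    simpa using (Fact.out : p.Prime).ne_zero
  have hQ0 : Q ≠ ⊥ := by
    rintro rfl
    exact hp0 (by rw [h]; simp)
  have hdvd : Q ∣ D.P ^ 3 * D.P' ^ 3 := by
    rw [← D.span_p, h]
    exact (dvd_pow_self Q three_ne_zero).mul_right J
  have hQprime : Prime Q := Ideal.prime_of_isPrime hQ0 hQ
  rcases hQprime.dvd_or_dvd hdvd with h' | h'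
  · rw [associated_iff_eq.1 (hQprime.associated_of_dvd D.prime_P (hQprime.dvd_of_dvd_pow h')),
      cP, ClassGroup.mk0_eq_one_iff]
  · rw [associated_iff_eq.1 (hQprime.associated_of_dvd D.prime_P' (hQprime.dvd_of_dvd_pow h')),
      ← ClassGroup.mk0_eq_one_iff (mem_nonZeroDivisors_of_ne_zero D.P'_ne_bot)]
    have e := D.cP_mul_cP'
    exact ⟨fun h1 => by rwa [h1, one_mul] at e, fun h1 => by
      rw [show D.cP' = 1 from h1, mul_one] at e; exact e⟩

theorem ZMod.card_multiplicative_prod (a b : ℕ) :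
    Nat.card (Multiplicative (ZMod (3 ^ a)) × Multiplicative (ZMod (3 ^ b))) = 3 ^ (a + b) := by
  rw [Nat.card_prod, pow_add]
  congr 1
  · exact Nat.card_zmod _
  · exact Nat.card_zmod _

/-- **Corollary 2.8** (Gerth): for `d = p^{e₁}` with `p ≡ 1 (mod 9)` prime: `Q = 1` iff
`C_{L,3} ≅ (3^w)` and `C_{k,3} ≅ (3^w, 3^{w-1})` for some `w ≥ 1`, iff `L` is of type `α`;
`Q = 3` iff `C_{L,3} ≅ (3^w)` and `C_{k,3} ≅ (3^w, 3^w)` for some `w ≥ 2`, iff `L` is of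
type `γ`; `C_{k,3}` is never of type `(3,3)`; and, with `p𝓞_k = 𝔓³·τ(𝔓)³`, `Q = 1` iff
`𝔓` is principal. -/
theorem gerth_p_one_mod_nine
    (d p e₁ : ℕ) (hp : p.Prime) (hp9 : p % 9 = 1) (he₁ : e₁ = 1 ∨ e₁ = 2)
    (hdp : d = p ^ e₁)
    (σ : ↥(Kc d) ≃ₐ[ℚ] ↥(Kc d)) (hσfix : ∀ x : ↥(Kc d), x ∈ k0S d → σ x = x)
    (hσne : σ ≠ 1)
    (τ : ↥(Kc d) ≃ₐ[ℚ] ↥(Kc d)) (hτfix : ∀ x : ↥(Kc d), x ∈ LS d → τ x = x) (hτne : τ ≠ 1)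
    (U A R : ℕ)
    (hU : 3 ^ U = unitNormIndex d)
    (hA : 3 ^ A = Nat.card (absPrincipalFactors d σ))
    (hR : 3 ^ R = Nat.card ↥(relPrincipalFactors d σ)) :
    ((subfieldUnitIndex d σ = 1 ↔
      ∃ w : ℕ, 1 ≤ w ∧
        Nat.card ↥(CommGroup.primaryComponent (ClassGroup (𝓞 ↥(LS d))) 3) = 3 ^ w ∧
        IsCyclic ↥(CommGroup.primaryComponent (ClassGroup (𝓞 ↥(LS d))) 3) ∧
        Nonempty (↥(CommGroup.primaryComponent (ClassGroup (𝓞 ↥(Kc d))) 3) ≃*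
          (Multiplicative (ZMod (3 ^ w)) × Multiplicative (ZMod (3 ^ (w - 1)))))) ∧
     (subfieldUnitIndex d σ = 1 ↔ (U = 1 ∧ A = 1 ∧ R = 1))) ∧
    ((subfieldUnitIndex d σ = 3 ↔
      ∃ w : ℕ, 2 ≤ w ∧
        Nat.card ↥(CommGroup.primaryComponent (ClassGroup (𝓞 ↥(LS d))) 3) = 3 ^ w ∧
        IsCyclic ↥(CommGroup.primaryComponent (ClassGroup (𝓞 ↥(LS d))) 3) ∧
        Nonempty (↥(CommGroup.primaryComponent (ClassGroup (𝓞 ↥(Kc d))) 3) ≃*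
          (Multiplicative (ZMod (3 ^ w)) × Multiplicative (ZMod (3 ^ w))))) ∧
     (subfieldUnitIndex d σ = 3 ↔ (U = 0 ∧ A = 1 ∧ R = 0))) ∧
    (¬ Nonempty (↥(CommGroup.primaryComponent (ClassGroup (𝓞 ↥(Kc d))) 3) ≃*
        (Multiplicative (ZMod 3) × Multiplicative (ZMod 3)))) ∧
    (∀ 𝔓 : Ideal (𝓞 ↥(Kc d)), 𝔓.IsPrime →
      Ideal.span {(p : 𝓞 ↥(Kc d))} =
        𝔓 ^ 3 * (Ideal.map (RingOfIntegers.mapRingHom τ) 𝔓) ^ 3 →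
      (subfieldUnitIndex d σ = 1 ↔ Submodule.IsPrincipal 𝔓)) := by
  have : Fact p.Prime := ⟨hp⟩
  obtain ⟨F, rfl, rfl, hk, hL⟩ := exists_pureCubicField hp9 he₁ hdp hσfix hσne hτfix hτne
  obtain ⟨w, j, hw, hj, ⟨e⟩, ⟨c, hcw, hc⟩, hjP, hw2⟩ := F.classGroup_structure
  obtain ⟨hcyc, hcard⟩ := primaryComponent_L_isCyclic F hL hc
  rw [hcw] at hcard
  have hcardK : Nat.card (CommGroup.primaryComponent (ClassGroup (𝓞 (Kc d))) 3) = 3 ^ (w + j) :=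
    (Nat.card_congr e.toEquiv).trans (ZMod.card_multiplicative_prod w j)
  have hinj : ∀ {m n : ℕ}, 3 ^ m = 3 ^ n → m = n := fun h =>
    Nat.pow_right_injective (by norm_num : 2 ≤ 3) h
  have hA1 : A = 1 := hinj (hA.trans (card_absPrincipalFactors F hL))
  have hQ1 := subfieldUnitIndex_eq_one_iff F hk hL
  have hQ3 := subfieldUnitIndex_eq_three_iff F hk hL
  have hα : F.ring.cP = 1 → U = 1 ∧ A = 1 ∧ R = 1 := fun h =>
    ⟨hinj (hU.trans (unitNormIndex_of_eq F hk h)), hA1,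
      hinj (hR.trans (card_relPrincipalFactors_of_eq F hk hL h))⟩
  have hγ : F.ring.cP ≠ 1 → U = 0 ∧ A = 1 ∧ R = 0 := fun h =>
    ⟨hinj (hU.trans (unitNormIndex_of_ne F hk h)), hA1,
      hinj (hR.trans (card_relPrincipalFactors_of_ne F hk hL h))⟩
  have hsum : ∀ {a b : ℕ}, Nonempty (CommGroup.primaryComponent (ClassGroup (𝓞 (Kc d))) 3 ≃*
      Multiplicative (ZMod (3 ^ a)) × Multiplicative (ZMod (3 ^ b))) → w + j = a + b := by
    rintro a b ⟨e'⟩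
    exact hinj (hcardK.symm.trans
      ((Nat.card_congr e'.toEquiv).trans (ZMod.card_multiplicative_prod a b)))
  refine ⟨⟨hQ1.trans ⟨fun h => ?_, ?_⟩, hQ1.trans ⟨hα, fun h => ?_⟩⟩,
    ⟨hQ3.trans ⟨fun h => ?_, ?_⟩, hQ3.trans ⟨hγ, fun h h' => ?_⟩⟩, ?_, fun 𝔓 h𝔓 h => ?_⟩
  · obtain rfl : w = j + 1 := by
      rcases hj with rfl | rfl
      · exact absurd h (hjP.1 rfl)
      · rfl
    exact ⟨j + 1, hw, hcard, hcyc, ⟨e⟩⟩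
  · rintro ⟨v, hv, hv1, -, hv2⟩
    obtain rfl : w = v := hinj (hcard.symm.trans hv1)
    have := hsum hv2
    by_contra hP
    have := hjP.2 hP
    omega
  · by_contra hP
    have := (hγ hP).1
    omega
  · have hjw := hjP.2 h
    subst hjw
    exact ⟨j, hw2 rfl, hcard, hcyc, ⟨e⟩⟩
  · rintro ⟨v, hv, hv1, -, hv2⟩
    obtain rfl : w = v := hinj (hcard.symm.trans hv1)
    have := hsum hv2
    exact hjP.1 (by omega)
  · have := (hα h').1
    omega
  · intro h
    have := hsum (a := 1) (b := 1) h
    have := hw2 (by omega)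
    omega
  · exact hQ1.trans (F.ring.isPrincipal_iff h𝔓 h)
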